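/- Let Ω ⊊ ℂⁿ be a domain. Then Ω is holomorphically convex (equivalently, a domain of holomorphy) if and only if the function z ↦ -log(d_{∂Ω}(z)) is plurisubharmonic on the whole domain Ω. -/

import Mathlib

open MeasureTheory Metric Filter Topology Set
open scoped ENNReal

noncomputable section

/-- The positive part of an extended real number, as an extended nonnegative real. -/
def erealToENNReal (x : EReal) : ℝ≥0∞ := if x = ⊤ then ⊤ else ENNReal.ofReal x.toReal

variable {E : Type*} [NormedAddCommGroup E] [MeasureSpace E]

/-- The mean value `M_u(x,r)` of an extended-real-valued function `u` over the ball `B(x,r)`,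
computed as the difference of the integrals of the positive and negative parts. -/
def erealBallAvg (u : E → EReal) (x : E) (r : ℝ) : EReal :=
  (((∫⁻ y in ball x r, erealToENNReal (u y)) / volume (ball x r) : ℝ≥0∞) : EReal)
    - (((∫⁻ y in ball x r, erealToENNReal (-(u y))) / volume (ball x r) : ℝ≥0∞) : EReal)

/-- The sub-mean value property on a set `s`: at each point of `s` the value of `u` is at most
its average over every sufficiently small ball centered at the point and contained in `s`. -/
def SubmeanOn (u : E → EReal) (s : Set E) : Prop :=
  ∀ x ∈ s, ∃ R > 0, ∀ r : ℝ, 0 < r → r < R → closedBall x r ⊆ s →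
    u x ≤ erealBallAvg u x r

/-- `u : E → [-∞,∞)` is subharmonic on `s` if it is upper semicontinuous on `s`, not
identically `-∞` on `s`, takes values in `[-∞,∞)`, and satisfies the sub-mean value
inequality on `s`. -/
def IsSubharmonicOn (u : E → EReal) (s : Set E) : Prop :=
  UpperSemicontinuousOn u s ∧ (¬ ∀ x ∈ s, u x = ⊥) ∧ (∀ x ∈ s, u x < ⊤) ∧ SubmeanOn u s

/-- `u` is plurisubharmonic on `s ⊆ ℂⁿ` if it is upper semicontinuous on `s`, not identically
`-∞` on `s`, takes values in `[-∞,∞)`, and its restriction to every complex line satisfies the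
sub-mean value inequality (i.e. is subharmonic where defined). -/
def IsPlurisubharmonicOn {n : ℕ} (u : EuclideanSpace ℂ (Fin n) → EReal)
    (s : Set (EuclideanSpace ℂ (Fin n))) : Prop :=
  UpperSemicontinuousOn u s ∧ (¬ ∀ z ∈ s, u z = ⊥) ∧ (∀ z ∈ s, u z < ⊤) ∧
    ∀ a b : EuclideanSpace ℂ (Fin n),
      SubmeanOn (fun w : ℂ => u (a + w • b)) {w : ℂ | a + w • b ∈ s}

/-- The holomorphic hull of a compact `K` inside `Ω`: points `z ∈ Ω` where every function
holomorphic on `Ω` is bounded by its sup-norm over `K`. -/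
def holomorphicHull {n : ℕ} (Ω K : Set (EuclideanSpace ℂ (Fin n))) :
    Set (EuclideanSpace ℂ (Fin n)) :=
  {z ∈ Ω | ∀ f : EuclideanSpace ℂ (Fin n) → ℂ, DifferentiableOn ℂ f Ω →
    ‖f z‖ ≤ sSup ((fun w => ‖f w‖) '' K)}

/-- `Ω` is holomorphically convex: the holomorphic hull of every compact subset of `Ω` is a
compact subset of `Ω`. -/
def HolomorphicallyConvex {n : ℕ} (Ω : Set (EuclideanSpace ℂ (Fin n))) : Prop :=
  ∀ K ⊆ Ω, IsCompact K → IsCompact (holomorphicHull Ω K)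

section LeviProblem

set_option linter.unusedSectionVars false

open scoped ContDiff ComplexConjugate

section FirstOrder

variable {V : Type*} [NormedAddCommGroup V] [InnerProductSpace ℂ V]

/-- Smooth complex-valued functions with compact support contained in `W`. -/
structure IsTest (W : Set V) (k : V → ℂ) : Prop where
  contDiff : ContDiff ℝ ∞ k
  compact : HasCompactSupport k
  subset : tsupport k ⊆ W

/-- The first-order operator `(∂_v + σ i ∂_{iv}) / 2`: it is `∂̄` in the direction `v` for `σ = 1`
and `∂` for `σ = -1`. -/
def del (σ : ℂ) (v : V) (k : V → ℂ) (x : V) : ℂ :=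
  (1 / 2) * (fderiv ℝ k x v + σ * Complex.I * fderiv ℝ k x (Complex.I • v))

theorem ContDiff.differentiableAt_infty {k : V → ℂ} (hk : ContDiff ℝ ∞ k) (x : V) :
    DifferentiableAt ℝ k x := (hk.differentiable (by simp)) x

theorem del_congr {σ : ℂ} {v : V} {k l : V → ℂ} {x : V} (h : k =ᶠ[𝓝 x] l) :
    del σ v k x = del σ v l x := by
  simp only [del, h.fderiv_eq]

theorem del_add {σ : ℂ} {v : V} {k l : V → ℂ} {x : V} (hk : DifferentiableAt ℝ k x)
    (hl : DifferentiableAt ℝ l x) :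
    del σ v (fun y => k y + l y) x = del σ v k x + del σ v l x := by
  simp only [del, fderiv_fun_add hk hl, _root_.add_apply]; ring

theorem del_sub {σ : ℂ} {v : V} {k l : V → ℂ} {x : V} (hk : DifferentiableAt ℝ k x)
    (hl : DifferentiableAt ℝ l x) :
    del σ v (fun y => k y - l y) x = del σ v k x - del σ v l x := by
  simp only [del, fderiv_fun_sub hk hl, _root_.sub_apply]; ring

theorem del_sum {ι : Type*} {s : Finset ι} {σ : ℂ} {v : V} {k : ι → V → ℂ} {x : V}
    (hk : ∀ i ∈ s, DifferentiableAt ℝ (k i) x) :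
    del σ v (fun y => ∑ i ∈ s, k i y) x = ∑ i ∈ s, del σ v (k i) x := by
  simp only [del, fderiv_fun_sum hk, _root_.sum_apply, Finset.mul_sum,
    ← Finset.sum_add_distrib]

theorem del_mul {σ : ℂ} {v : V} {k l : V → ℂ} {x : V} (hk : DifferentiableAt ℝ k x)
    (hl : DifferentiableAt ℝ l x) :
    del σ v (fun y => k y * l y) x = k x * del σ v l x + del σ v k x * l x := by
  simp only [del, fderiv_fun_mul hk hl, _root_.add_apply,
    _root_.smul_apply, smul_eq_mul]; ring

theorem del_const {σ : ℂ} {v : V} (c : ℂ) (x : V) : del σ v (fun _ => c) x = 0 := by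
  simp [del]

theorem del_const_mul {σ : ℂ} {v : V} {k : V → ℂ} {x : V} (c : ℂ) (hk : DifferentiableAt ℝ k x) :
    del σ v (fun y => c * k y) x = c * del σ v k x := by
  rw [del_mul (differentiableAt_const c) hk, del_const]; ring

theorem del_conj {σ : ℂ} {v : V} {k : V → ℂ} {x : V} (hk : DifferentiableAt ℝ k x) :
    del σ v (fun y => conj (k y)) x = conj (del (- conj σ) v k x) := by
  have h : fderiv ℝ (fun y => conj (k y)) x
      = (Complex.conjCLE : ℂ →L[ℝ] ℂ).comp (fderiv ℝ k x) := by
    exact ((Complex.conjCLE : ℂ →L[ℝ] ℂ).hasFDerivAt.comp x hk.hasFDerivAt).fderiv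
  simp only [del, h, ContinuousLinearMap.comp_apply, map_mul, map_add, map_neg]
  simp [Complex.conj_ofNat]

theorem del_add_dir {σ : ℂ} {v w : V} {k : V → ℂ} {x : V} :
    del σ (v + w) k x = del σ v k x + del σ w k x := by
  simp only [del, smul_add, map_add]; ring

theorem del_sub_dir {σ : ℂ} {v w : V} {k : V → ℂ} {x : V} :
    del σ (v - w) k x = del σ v k x - del σ w k x := by
  simp only [del, smul_sub, map_sub]; ring

theorem del_zero_dir {σ : ℂ} {k : V → ℂ} {x : V} : del σ (0 : V) k x = 0 := by simp [del]

theorem contDiff_del {σ : ℂ} {v : V} {k : V → ℂ} (hk : ContDiff ℝ ∞ k) :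
    ContDiff ℝ ∞ (del σ v k) := by
  have h : ContDiff ℝ ∞ (fderiv ℝ k) := hk.fderiv_right (m := ∞) (by simp)
  unfold del
  exact contDiff_const.mul ((h.clm_apply contDiff_const).add
    (contDiff_const.mul (h.clm_apply contDiff_const)))

theorem tsupport_del_subset {σ : ℂ} {v : V} {k : V → ℂ} :
    tsupport (del σ v k) ⊆ tsupport k := by
  apply closure_minimal _ (isClosed_tsupport k)
  intro x hx
  apply support_fderiv_subset ℝ (f := k)
  intro h
  exact hx (by simp [del, h])

theorem del_eq_zero_of_notMem {σ : ℂ} {v : V} {k : V → ℂ} {x : V} (hx : x ∉ tsupport k) :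
    del σ v k x = 0 := by
  by_contra h
  exact hx (tsupport_del_subset (subset_tsupport _ h))

theorem del_comm {σ τ : ℂ} {v w : V} {k : V → ℂ} (hk : ContDiff ℝ ∞ k) (x : V) :
    del σ v (del τ w k) x = del τ w (del σ v k) x := by
  have h : ContDiff ℝ ∞ (fderiv ℝ k) := hk.fderiv_right (m := ∞) (by simp)
  have hd : DifferentiableAt ℝ (fderiv ℝ k) x := (h.differentiable (by simp)) x
  have key : ∀ (ρ : ℂ) (u y : V), fderiv ℝ (del ρ u k) x y =
      (1 / 2) * (fderiv ℝ (fderiv ℝ k) x y u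
        + ρ * Complex.I * fderiv ℝ (fderiv ℝ k) x y (Complex.I • u)) := by
    intro ρ u y
    have h1 : ∀ u : V, HasFDerivAt (fun z => fderiv ℝ k z u)
        ((fderiv ℝ (fderiv ℝ k) x).flip u) x := fun u => by
      have := hd.hasFDerivAt.clm_apply (hasFDerivAt_const u x)
      simpa using this
    have h2 := ((h1 u).add ((h1 (Complex.I • u)).const_mul (ρ * Complex.I))).const_mul (1 / 2)
    have h3 : fderiv ℝ (del ρ u k) x = _ := h2.fderiv
    rw [h3]
    simp
    ring
  have sym := (hk.contDiffAt (x := x)).isSymmSndFDerivAt (by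
    simpa using (WithTop.coe_le_coe.2 (le_top : (2 : ℕ∞) ≤ ⊤)))
  unfold del at key
  unfold del
  rw [key, key, key, key, sym v w, sym (Complex.I • v) w, sym v (Complex.I • w),
    sym (Complex.I • v) (Complex.I • w)]
  ring

namespace IsTest

variable {W : Set V} {k l : V → ℂ}

theorem mono {W' : Set V} (hk : IsTest W k) (h : W ⊆ W') : IsTest W' k :=
  ⟨hk.contDiff, hk.compact, hk.subset.trans h⟩

theorem mul_left {a : V → ℂ} (hk : IsTest W k) (ha : ContDiff ℝ ∞ a) :
    IsTest W (fun x => a x * k x) :=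
  ⟨ha.mul hk.contDiff, hk.compact.mul_left, (tsupport_mul_subset_right).trans hk.subset⟩

theorem del (hk : IsTest W k) (σ : ℂ) (v : V) : IsTest W (del σ v k) :=
  ⟨contDiff_del hk.contDiff, hk.compact.mono' ((subset_tsupport _).trans tsupport_del_subset),
    tsupport_del_subset.trans hk.subset⟩

theorem add (hk : IsTest W k) (hl : IsTest W l) : IsTest W (fun x => k x + l x) :=
  ⟨hk.contDiff.add hl.contDiff, hk.compact.add hl.compact,
    (tsupport_add k l).trans (union_subset hk.subset hl.subset)⟩

theorem const_mul (hk : IsTest W k) (c : ℂ) : IsTest W (fun x => c * k x) :=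
  hk.mul_left contDiff_const

theorem zero : IsTest W (fun _ : V => (0 : ℂ)) :=
  ⟨contDiff_const, HasCompactSupport.zero, by simp [tsupport, Function.support_fun_zero]⟩

protected theorem star (hk : IsTest W k) : IsTest W (fun x => conj (k x)) := by
  have hs : Function.support (fun x => (starRingEnd ℂ) (k x)) = Function.support k := by
    ext x; simp
  refine ⟨Complex.conjCLE.contDiff.comp hk.contDiff, ?_, ?_⟩
  · unfold HasCompactSupport tsupport; rw [hs]; exact hk.compact
  · unfold tsupport; rw [hs]; exact hk.subset

theorem continuous (hk : IsTest W k) : Continuous k := hk.contDiff.continuous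

theorem differentiableAt (hk : IsTest W k) (x : V) : DifferentiableAt ℝ k x :=
  hk.contDiff.differentiableAt_infty x

end IsTest

variable [FiniteDimensional ℂ V] [MeasureSpace V] [BorelSpace V]
  [(volume : Measure V).IsAddHaarMeasure]

theorem IsTest.integrable {W : Set V} {k : V → ℂ} (hk : IsTest W k) : Integrable k :=
  hk.continuous.integrable_of_hasCompactSupport hk.compact

theorem integral_mul_del {σ : ℂ} {v : V} {W : Set V} {a k : V → ℂ} (ha : ContDiff ℝ ∞ a)
    (hk : IsTest W k) :
    ∫ x, a x * del σ v k x = - ∫ x, del σ v a x * k x := by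
  have hfk : Continuous (fderiv ℝ k) := hk.contDiff.continuous_fderiv (by simp)
  have hfa : Continuous (fderiv ℝ a) := ha.continuous_fderiv (by simp)
  have i1 : ∀ u, Integrable (fun x => fderiv ℝ a x u * k x) := fun u =>
    ((hfa.clm_apply continuous_const).mul hk.continuous).integrable_of_hasCompactSupport
      hk.compact.mul_left
  have i2 : ∀ u, Integrable (fun x => a x * fderiv ℝ k x u) := fun u =>
    (ha.continuous.mul (hfk.clm_apply continuous_const)).integrable_of_hasCompactSupport
      (hk.compact.fderiv_apply ℝ u).mul_left
  have i3 : Integrable (fun x => a x * k x) :=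
    (ha.continuous.mul hk.continuous).integrable_of_hasCompactSupport hk.compact.mul_left
  have ibp : ∀ u, ∫ x, a x * fderiv ℝ k x u = - ∫ x, fderiv ℝ a x u * k x := fun u =>
    integral_mul_fderiv_eq_neg_fderiv_mul_of_integrable (i1 u) (i2 u) i3
      (fun x _ => ha.differentiableAt_infty x) (fun x _ => hk.differentiableAt x)
  calc ∫ x, a x * del σ v k x
      = ∫ x, ((1 / 2) * (a x * fderiv ℝ k x v)
        + (1 / 2 * σ * Complex.I) * (a x * fderiv ℝ k x (Complex.I • v))) := by
        congr 1; ext x; simp only [del]; ring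
    _ = (1 / 2) * (∫ x, a x * fderiv ℝ k x v)
        + (1 / 2 * σ * Complex.I) * ∫ x, a x * fderiv ℝ k x (Complex.I • v) := by
        rw [integral_add ((i2 _).const_mul _) ((i2 _).const_mul _), integral_const_mul,
          integral_const_mul]
    _ = -((1 / 2) * (∫ x, fderiv ℝ a x v * k x)
        + (1 / 2 * σ * Complex.I) * ∫ x, fderiv ℝ a x (Complex.I • v) * k x) := by
        rw [ibp, ibp]; ring
    _ = - ∫ x, ((1 / 2) * (fderiv ℝ a x v * k x)
        + (1 / 2 * σ * Complex.I) * (fderiv ℝ a x (Complex.I • v) * k x)) := by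
        rw [integral_add ((i1 _).const_mul _) ((i1 _).const_mul _), integral_const_mul,
          integral_const_mul]
    _ = - ∫ x, del σ v a x * k x := by
        congr 2; ext x; simp only [del]; ring

end FirstOrder

section MorreyKohn

variable {V : Type*} [NormedAddCommGroup V] [InnerProductSpace ℂ V]

/-- The complexification of a real weight. -/
def toC (φ : V → ℝ) (x : V) : ℂ := (φ x : ℂ)

/-- The weight `e^{-φ}`. -/
def expNeg (φ : V → ℝ) (x : V) : ℝ := Real.exp (- φ x)

/-- The formal adjoint of `-∂̄` for the weight `e^{-φ}`. -/
def wdel (φ : V → ℝ) (v : V) (k : V → ℂ) (x : V) : ℂ :=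
  del (-1) v k x - del (-1) v (toC φ) x * k x

/-- The Levi form of `φ` at `x` in the frame `e`. -/
def leviForm {ι : Type*} [Fintype ι] (e : ι → V) (φ : V → ℝ) (x : V) (ξ : ι → ℂ) : ℂ :=
  ∑ j, ∑ k, del 1 (e k) (del (-1) (e j) (toC φ)) x * ξ j * conj (ξ k)

variable {φ : V → ℝ}

theorem contDiff_toC (hφ : ContDiff ℝ ∞ φ) : ContDiff ℝ ∞ (toC φ) :=
  Complex.ofRealCLM.contDiff.comp hφ

theorem contDiff_expNeg (hφ : ContDiff ℝ ∞ φ) : ContDiff ℝ ∞ (expNeg φ) :=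
  Real.contDiff_exp.comp hφ.neg

theorem contDiff_toC_expNeg (hφ : ContDiff ℝ ∞ φ) : ContDiff ℝ ∞ (toC (expNeg φ)) :=
  contDiff_toC (contDiff_expNeg hφ)

theorem expNeg_pos (x : V) : 0 < expNeg φ x := Real.exp_pos _

theorem del_toC_expNeg (hφ : ContDiff ℝ ∞ φ) (σ : ℂ) (v x : V) :
    del σ v (toC (expNeg φ)) x = - del σ v (toC φ) x * toC (expNeg φ) x := by
  have hd : HasFDerivAt φ (fderiv ℝ φ x) x :=
    ((hφ.differentiable (by simp)) x).hasFDerivAt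
  have h1 : fderiv ℝ (toC φ) x = Complex.ofRealCLM.comp (fderiv ℝ φ x) :=
    (Complex.ofRealCLM.hasFDerivAt.comp x hd).fderiv
  have h2 : fderiv ℝ (toC (expNeg φ)) x
      = Complex.ofRealCLM.comp (Real.exp (-φ x) • (- fderiv ℝ φ x)) :=
    (Complex.ofRealCLM.hasFDerivAt.comp x (hd.neg.exp)).fderiv
  simp only [del, h1, h2, ContinuousLinearMap.comp_apply, toC, expNeg]
  simp
  ring

theorem del_toC_conj (hφ : ContDiff ℝ ∞ φ) (v x : V) :
    conj (del (-1) v (toC φ) x) = del 1 v (toC φ) x := by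
  have := del_conj (σ := 1) (v := v) ((contDiff_toC hφ).differentiableAt_infty x)
  simp only [map_one] at this
  rw [← this]
  congr 1
  ext y; simp [toC]

theorem IsTest.wdel {W : Set V} {k : V → ℂ} (hk : IsTest W k) (hφ : ContDiff ℝ ∞ φ) (v : V) :
    IsTest W (wdel φ v k) := by
  have h := (hk.del (-1) v).add
    ((hk.mul_left (contDiff_del (σ := -1) (v := v) (contDiff_toC hφ))).const_mul (-1))
  convert h using 2
  simp only [_root_.wdel]; ring

theorem del_wdel_comm (hφ : ContDiff ℝ ∞ φ) (v w : V) {k : V → ℂ} (hk : ContDiff ℝ ∞ k) (x : V) :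
    del 1 w (wdel φ v k) x = wdel φ v (del 1 w k) x - del 1 w (del (-1) v (toC φ)) x * k x := by
  have d1 := (contDiff_del (σ := -1) (v := v) hk).differentiableAt_infty x
  have d2 := (contDiff_del (σ := -1) (v := v) (contDiff_toC hφ)).differentiableAt_infty x
  have d3 := hk.differentiableAt_infty x
  have h : wdel φ v k = fun y => del (-1) v k y - del (-1) v (toC φ) y * k y := rfl
  rw [h, del_sub d1 (d2.fun_mul d3), del_mul d2 d3, del_comm hk]
  simp only [wdel]; ring

variable [FiniteDimensional ℂ V] [MeasureSpace V] [BorelSpace V]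
  [(volume : Measure V).IsAddHaarMeasure]

theorem integral_del_mul_conj (hφ : ContDiff ℝ ∞ φ) (v : V) {W : Set V} {a b : V → ℂ}
    (ha : ContDiff ℝ ∞ a) (hb : IsTest W b) :
    ∫ x, del 1 v a x * (conj (b x) * toC (expNeg φ) x)
      = - ∫ x, a x * (conj (wdel φ v b x) * toC (expNeg φ) x) := by
  have ht : IsTest W (fun x => conj (b x) * toC (expNeg φ) x) := by
    simpa only [mul_comm] using hb.star.mul_left (contDiff_toC_expNeg hφ)
  have h := integral_mul_del (σ := 1) (v := v) ha ht
  have h2 : ∀ x, del 1 v (fun x => conj (b x) * toC (expNeg φ) x) x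
      = conj (wdel φ v b x) * toC (expNeg φ) x := by
    intro x
    rw [del_mul (hb.star.differentiableAt x) ((contDiff_toC_expNeg hφ).differentiableAt_infty x),
      del_conj (hb.differentiableAt x), del_toC_expNeg hφ]
    simp only [wdel, map_sub, map_mul, del_toC_conj hφ, map_one]
    ring
  simp only [h2] at h
  rw [h]; simp

theorem integral_wdel_mul_conj (hφ : ContDiff ℝ ∞ φ) (v : V) {W : Set V} {a b : V → ℂ}
    (ha : ContDiff ℝ ∞ a) (hb : IsTest W b) :
    ∫ x, wdel φ v b x * (conj (a x) * toC (expNeg φ) x)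
      = - ∫ x, b x * (conj (del 1 v a x) * toC (expNeg φ) x) := by
  have h := congrArg (starRingEnd ℂ) (integral_del_mul_conj hφ v ha hb)
  rw [map_neg, ← integral_conj, ← integral_conj] at h
  have hc : ∀ x, conj (toC (expNeg φ) x) = toC (expNeg φ) x := fun x => by simp [toC]
  simp only [map_mul, Complex.conj_conj, hc] at h
  rw [eq_neg_iff_add_eq_zero] at h ⊢
  rw [← h, add_comm]
  congr 2 <;> ext x <;> ring

variable {ι : Type*} [Fintype ι] {e : ι → V}

theorem integral_wdel_mul_conj_wdel (hφ : ContDiff ℝ ∞ φ) (v w : V) {W : Set V} {a b : V → ℂ}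
    (ha : IsTest W a) (hb : IsTest W b) :
    ∫ x, wdel φ v a x * (conj (wdel φ w b x) * toC (expNeg φ) x)
      = (∫ x, del 1 w a x * (conj (del 1 v b x) * toC (expNeg φ) x))
        + ∫ x, del 1 w (del (-1) v (toC φ)) x * a x * (conj (b x) * toC (expNeg φ) x) := by
  have h1 := integral_del_mul_conj hφ w (ha.wdel hφ v).contDiff hb
  have h2 := integral_wdel_mul_conj hφ v hb.contDiff (ha.del 1 w)
  have t1 : IsTest W (fun x => wdel φ v (del 1 w a) x * (conj (b x) * toC (expNeg φ) x)) := by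
    have := (hb.star.mul_left (contDiff_toC_expNeg hφ)).mul_left ((ha.del 1 w).wdel hφ v).contDiff
    simpa only [mul_comm (toC (expNeg φ) _)] using this
  have t2 : IsTest W (fun x => del 1 w (del (-1) v (toC φ)) x * a x
      * (conj (b x) * toC (expNeg φ) x)) := by
    have := (hb.star.mul_left (contDiff_toC_expNeg hφ)).mul_left
      ((contDiff_del (σ := 1) (v := w) (contDiff_del (σ := -1) (v := v)
        (contDiff_toC hφ))).mul ha.contDiff)
    simpa only [mul_comm (toC (expNeg φ) _)] using this
  have h3 : ∫ x, del 1 w (wdel φ v a) x * (conj (b x) * toC (expNeg φ) x)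
      = (∫ x, wdel φ v (del 1 w a) x * (conj (b x) * toC (expNeg φ) x))
        - ∫ x, del 1 w (del (-1) v (toC φ)) x * a x * (conj (b x) * toC (expNeg φ) x) := by
    rw [← integral_sub t1.integrable t2.integrable]
    congr 1; ext x
    rw [del_wdel_comm hφ v w ha.contDiff]; ring
  rw [h3, h2] at h1
  linear_combination h1

/-- The Morrey-Kohn-Hörmander identity, as an inequality. -/
theorem morrey_kohn_hormander (hφ : ContDiff ℝ ∞ φ) {W : Set V} {g : ι → V → ℂ}
    (hg : ∀ i, IsTest W (g i)) :
    ∫ x, (leviForm e φ x (fun i => g i x)).re * expNeg φ x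
      ≤ (∫ x, ‖∑ j, wdel φ (e j) (g j) x‖ ^ 2 * expNeg φ x)
        + ∫ x, (∑ j, ∑ k, ‖del 1 (e j) (g k) x - del 1 (e k) (g j) x‖ ^ 2) * expNeg φ x := by
  have tt : ∀ {a b : V → ℂ}, ContDiff ℝ ∞ a → IsTest W b →
      Integrable (fun x => a x * (conj (b x) * toC (expNeg φ) x)) := by
    intro a b ha hb
    have := (hb.star.mul_left (contDiff_toC_expNeg hφ)).mul_left ha
    simpa only [mul_comm (toC (expNeg φ) _)] using this.integrable
  have iA : ∀ j k, Integrable (fun x => wdel φ (e j) (g j) x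
      * (conj (wdel φ (e k) (g k) x) * toC (expNeg φ) x)) := fun j k =>
    tt ((hg j).wdel hφ _).contDiff ((hg k).wdel hφ _)
  have iB : ∀ j k, Integrable (fun x => del 1 (e k) (g j) x
      * (conj (del 1 (e j) (g k) x) * toC (expNeg φ) x)) := fun j k =>
    tt ((hg j).del 1 _).contDiff ((hg k).del 1 _)
  have iB' : ∀ j k, Integrable (fun x => del 1 (e k) (g j) x
      * (conj (del 1 (e k) (g j) x) * toC (expNeg φ) x)) := fun j k =>
    tt ((hg j).del 1 _).contDiff ((hg j).del 1 _)
  have iC : ∀ j k, Integrable (fun x => del 1 (e k) (del (-1) (e j) (toC φ)) x * g j x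
      * (conj (g k x) * toC (expNeg φ) x)) := fun j k =>
    tt ((contDiff_del (contDiff_del (contDiff_toC hφ))).mul (hg j).contDiff) (hg k)
  have key : ∫ x, (∑ j, ∑ k, wdel φ (e j) (g j) x
        * (conj (wdel φ (e k) (g k) x) * toC (expNeg φ) x))
      = (∫ x, ∑ j, ∑ k, del 1 (e k) (g j) x
        * (conj (del 1 (e j) (g k) x) * toC (expNeg φ) x))
        + ∫ x, ∑ j, ∑ k, del 1 (e k) (del (-1) (e j) (toC φ)) x * g j x
          * (conj (g k x) * toC (expNeg φ) x) := by
    rw [integral_finsetSum _ fun j _ => integrable_finsetSum _ fun k _ => iA j k,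
      integral_finsetSum _ fun j _ => integrable_finsetSum _ fun k _ => iB j k,
      integral_finsetSum _ fun j _ => integrable_finsetSum _ fun k _ => iC j k,
      ← Finset.sum_add_distrib]
    refine Finset.sum_congr rfl fun j _ => ?_
    rw [integral_finsetSum _ fun k _ => iA j k,
      integral_finsetSum _ fun k _ => iB j k,
      integral_finsetSum _ fun k _ => iC j k, ← Finset.sum_add_distrib]
    refine Finset.sum_congr rfl fun k _ => ?_
    exact integral_wdel_mul_conj_wdel hφ (e j) (e k) (hg j) (hg k)
  have sq : ∀ z : ℂ, ‖z‖ ^ 2 = (z * conj z).re := fun z => by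
    rw [Complex.mul_conj, Complex.ofReal_re, Complex.normSq_eq_norm_sq]
  have eA : ∀ x, (∑ j, ∑ k, wdel φ (e j) (g j) x
      * (conj (wdel φ (e k) (g k) x) * toC (expNeg φ) x)).re
      = ‖∑ j, wdel φ (e j) (g j) x‖ ^ 2 * expNeg φ x := by
    intro x
    rw [sq, map_sum, Finset.sum_mul_sum, ← Complex.re_mul_ofReal, Finset.sum_mul]
    congr 1
    refine Finset.sum_congr rfl fun j _ => ?_
    rw [Finset.sum_mul]
    exact Finset.sum_congr rfl fun k _ => by rw [toC]; ring
  have eC : ∀ x, (∑ j, ∑ k, del 1 (e k) (del (-1) (e j) (toC φ)) x * g j x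
      * (conj (g k x) * toC (expNeg φ) x)).re
      = (leviForm e φ x (fun i => g i x)).re * expNeg φ x := by
    intro x
    rw [leviForm, ← Complex.re_mul_ofReal, Finset.sum_mul]
    congr 1
    refine Finset.sum_congr rfl fun j _ => ?_
    rw [Finset.sum_mul]
    exact Finset.sum_congr rfl fun k _ => by rw [toC]; ring
  have eB : ∀ x, - ((∑ j, ∑ k, ‖del 1 (e j) (g k) x - del 1 (e k) (g j) x‖ ^ 2) * expNeg φ x)
      ≤ (∑ j, ∑ k, del 1 (e k) (g j) x
        * (conj (del 1 (e j) (g k) x) * toC (expNeg φ) x)).re := by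
    intro x
    rw [Complex.re_sum, Finset.sum_mul, ← Finset.sum_neg_distrib]
    have hle : ∀ j k : ι, - (‖del 1 (e j) (g k) x - del 1 (e k) (g j) x‖ ^ 2 * expNeg φ x)
        + (‖del 1 (e j) (g k) x‖ ^ 2 * expNeg φ x + ‖del 1 (e k) (g j) x‖ ^ 2 * expNeg φ x)
        = 2 * (del 1 (e k) (g j) x * (conj (del 1 (e j) (g k) x) * toC (expNeg φ) x)).re := by
      intro j k
      have hc : (del 1 (e k) (g j) x * (conj (del 1 (e j) (g k) x) * toC (expNeg φ) x)).re
          = (del 1 (e k) (g j) x * conj (del 1 (e j) (g k) x)).re * expNeg φ x := by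
        rw [← Complex.re_mul_ofReal, toC]; ring_nf
      rw [hc, sq, sq, sq]
      simp only [map_sub, Complex.mul_re, Complex.sub_re, Complex.sub_im, Complex.conj_re,
        Complex.conj_im]
      ring
    refine Finset.sum_le_sum fun j _ => ?_
    rw [Complex.re_sum, Finset.sum_mul, ← Finset.sum_neg_distrib]
    refine Finset.sum_le_sum fun k _ => ?_
    have := hle j k
    have p := expNeg_pos (φ := φ) x
    have q1 : 0 ≤ ‖del 1 (e j) (g k) x‖ ^ 2 * expNeg φ x := by positivity
    have q2 : 0 ≤ ‖del 1 (e k) (g j) x‖ ^ 2 * expNeg φ x := by positivity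
    have q3 : 0 ≤ ‖del 1 (e j) (g k) x - del 1 (e k) (g j) x‖ ^ 2 * expNeg φ x := by positivity
    linarith
  have sumB : Integrable (fun x => ∑ j, ∑ k, del 1 (e k) (g j) x
        * (conj (del 1 (e j) (g k) x) * toC (expNeg φ) x)) :=
    integrable_finsetSum _ fun j _ => integrable_finsetSum _ fun k _ => iB j k
  have hre := congrArg Complex.re key
  rw [Complex.add_re] at hre
  have r1 := integral_re (integrable_finsetSum Finset.univ fun j _ =>
    integrable_finsetSum Finset.univ fun k _ => iA j k)
  have r2 := integral_re sumB
  have r3 := integral_re (integrable_finsetSum Finset.univ fun j _ =>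
    integrable_finsetSum Finset.univ fun k _ => iC j k)
  simp only [RCLike.re_to_complex] at r1 r2 r3
  rw [← r1, ← r2, ← r3] at hre
  simp only [eA, eC] at hre
  rw [hre]
  have hR : Integrable (fun x => (∑ j, ∑ k, ‖del 1 (e j) (g k) x - del 1 (e k) (g j) x‖ ^ 2)
      * expNeg φ x) := by
    apply Continuous.integrable_of_hasCompactSupport
    · refine Continuous.mul ?_ (contDiff_expNeg hφ).continuous
      refine continuous_finsetSum _ fun j _ => continuous_finsetSum _ fun k _ => ?_
      exact (((hg k).del 1 _).continuous.sub ((hg j).del 1 _).continuous).norm.pow 2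
    · refine HasCompactSupport.mul_right ?_
      refine HasCompactSupport.of_support_subset_isCompact
        (K := ⋃ i, tsupport (g i)) (isCompact_iUnion fun i => (hg i).compact) ?_
      intro x hx
      by_contra hn
      simp only [mem_iUnion, not_exists] at hn
      apply hx
      simp [del_eq_zero_of_notMem (hn _)]
  have hle : - ∫ x, (∑ j, ∑ k, ‖del 1 (e j) (g k) x - del 1 (e k) (g j) x‖ ^ 2) * expNeg φ x
      ≤ ∫ x, (∑ j, ∑ k, del 1 (e k) (g j) x
        * (conj (del 1 (e j) (g k) x) * toC (expNeg φ) x)).re := by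
    rw [← integral_neg]
    exact integral_mono hR.neg sumB.re eB
  linarith

end MorreyKohn

section Mollifier

variable {V : Type*} [NormedAddCommGroup V] [InnerProductSpace ℂ V]

/-- An unnormalized radial bump function supported in the unit ball. -/
def radialBump (x : V) : ℝ := Real.smoothTransition (1 - ‖x‖ ^ 2)

theorem contDiff_radialBump : ContDiff ℝ ∞ (radialBump : V → ℝ) :=
  Real.smoothTransition.contDiff.comp (contDiff_const.sub (contDiff_norm_sq ℂ))

theorem radialBump_nonneg (x : V) : 0 ≤ radialBump x := Real.smoothTransition.nonneg _

theorem radialBump_le_one (x : V) : radialBump x ≤ 1 := Real.smoothTransition.le_one _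

theorem radialBump_eq_zero {x : V} (hx : 1 ≤ ‖x‖) : radialBump x = 0 :=
  Real.smoothTransition.zero_of_nonpos (by nlinarith)

theorem radialBump_zero : radialBump (0 : V) = 1 := by simp [radialBump]

variable [FiniteDimensional ℂ V] [MeasureSpace V] [BorelSpace V]
  [(volume : Measure V).IsAddHaarMeasure]

/-- The standard radial mollifier at scale `r`. -/
def kern (r : ℝ) (x : V) : ℝ := radialBump (r⁻¹ • x) / ∫ y : V, radialBump (r⁻¹ • y)

theorem hasCompactSupport_radialBump : HasCompactSupport (radialBump : V → ℝ) :=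
  HasCompactSupport.intro (isCompact_closedBall 0 1) fun x hx => radialBump_eq_zero (by
    simp only [mem_closedBall, dist_zero_right, not_le] at hx; exact hx.le)

theorem integral_radialBump_pos : 0 < ∫ y : V, radialBump y := by
  refine Continuous.integral_pos_of_hasCompactSupport_nonneg_nonzero (x := 0)
    contDiff_radialBump.continuous hasCompactSupport_radialBump radialBump_nonneg ?_
  simp [radialBump_zero]

theorem integral_radialBump_smul {r : ℝ} (hr : 0 < r) :
    ∫ y : V, radialBump (r⁻¹ • y) = r ^ Module.finrank ℝ V * ∫ y : V, radialBump y := by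
  rw [Measure.integral_comp_inv_smul volume radialBump r, abs_of_pos (by positivity), smul_eq_mul]

theorem integral_radialBump_smul_pos {r : ℝ} (hr : 0 < r) :
    0 < ∫ y : V, radialBump (r⁻¹ • y) := by
  rw [integral_radialBump_smul hr]
  have := integral_radialBump_pos (V := V)
  positivity

theorem kern_nonneg {r : ℝ} (hr : 0 < r) (x : V) : 0 ≤ kern r x :=
  div_nonneg (radialBump_nonneg _) (integral_radialBump_smul_pos hr).le

theorem integral_kern {r : ℝ} (hr : 0 < r) : ∫ x : V, kern r x = 1 := by
  unfold kern
  rw [integral_div, div_self (integral_radialBump_smul_pos hr).ne']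

theorem contDiff_kern (r : ℝ) : ContDiff ℝ ∞ (kern r : V → ℝ) :=
  (contDiff_radialBump.comp (contDiff_const_smul _)).div_const _

theorem kern_eq_zero {r : ℝ} (hr : 0 < r) {x : V} (hx : r ≤ ‖x‖) : kern r x = 0 := by
  unfold kern
  rw [radialBump_eq_zero, zero_div]
  rw [norm_smul, norm_inv, Real.norm_of_nonneg hr.le, inv_mul_eq_div, le_div_iff₀ hr]
  simpa using hx

theorem kern_congr (r : ℝ) {x y : V} (h : ‖x‖ = ‖y‖) : kern r x = kern r y := by
  simp only [kern, radialBump, norm_smul, h]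

theorem hasCompactSupport_kern {r : ℝ} (hr : 0 < r) : HasCompactSupport (kern r : V → ℝ) :=
  HasCompactSupport.intro (isCompact_closedBall 0 r) fun x hx => kern_eq_zero hr (by
    simp only [mem_closedBall, dist_zero_right, not_le] at hx; exact hx.le)

theorem tsupport_kern_subset {r : ℝ} (hr : 0 < r) : tsupport (kern r : V → ℝ) ⊆ closedBall 0 r := by
  refine closure_minimal (fun x hx => ?_) isClosed_closedBall
  by_contra h
  simp only [mem_closedBall, dist_zero_right, not_le] at h
  exact hx (kern_eq_zero hr h.le)

theorem kern_integrable {r : ℝ} (hr : 0 < r) : Integrable (kern r : V → ℝ) :=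
  (contDiff_kern r).continuous.integrable_of_hasCompactSupport (hasCompactSupport_kern hr)

theorem exists_kern_le : ∃ C : ℝ, 0 < C ∧ ∀ r : ℝ, 0 < r → ∀ x : V,
    kern r x * r ^ Module.finrank ℝ V ≤ C := by
  refine ⟨(∫ y : V, radialBump y)⁻¹, inv_pos.2 integral_radialBump_pos, fun r hr x => ?_⟩
  have h := integral_radialBump_pos (V := V)
  rw [kern, integral_radialBump_smul hr, div_mul_eq_mul_div, div_le_iff₀ (by positivity)]
  rw [mul_comm (r ^ _) (∫ y : V, radialBump y), ← mul_assoc, inv_mul_cancel₀ h.ne', one_mul]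
  exact mul_le_of_le_one_left (by positivity) (radialBump_le_one _)

/-- Convolution with a kernel. -/
def moll (κ : V → ℝ) (F : V → ℂ) (x : V) : ℂ := ∫ y, F y * (κ (x - y) : ℂ)

theorem moll_eq_convolution (κ : V → ℝ) (F : V → ℂ) :
    moll κ F = convolution F (toC κ) (ContinuousLinearMap.mul ℝ ℂ) volume := rfl

variable {κ : V → ℝ} {F : V → ℂ}

theorem HasCompactSupport.toC (hc : HasCompactSupport κ) : HasCompactSupport (toC κ) :=
  hc.comp_left (g := fun t : ℝ => (t : ℂ)) (by simp)

theorem contDiff_moll (hκ : ContDiff ℝ ∞ κ) (hc : HasCompactSupport κ)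
    (hF : LocallyIntegrable F) : ContDiff ℝ ∞ (moll κ F) := by
  rw [moll_eq_convolution]
  exact hc.toC.contDiff_convolution_right _ hF (contDiff_toC hκ)

theorem del_moll (hκ : ContDiff ℝ ∞ κ) (hc : HasCompactSupport κ) (hF : LocallyIntegrable F)
    (σ : ℂ) (v x : V) :
    del σ v (moll κ F) x = ∫ y, F y * del σ v (toC κ) (x - y) := by
  have h1 := hc.toC.hasFDerivAt_convolution_right (ContinuousLinearMap.mul ℝ ℂ) hF
    ((contDiff_toC hκ).of_le (by simp)) x
  have hcont : Continuous (fderiv ℝ (toC κ)) := (contDiff_toC hκ).continuous_fderiv (by simp)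
  have hcs : HasCompactSupport (fderiv ℝ (toC κ)) := hc.toC.fderiv ℝ
  have h2 : ∀ u, fderiv ℝ (moll κ F) x u = ∫ y, F y * fderiv ℝ (toC κ) (x - y) u := by
    intro u
    rw [moll_eq_convolution, h1.fderiv, convolution_precompR_apply _ hF hcs hcont]
    rfl
  have hi : ∀ u, Integrable (fun y => F y * fderiv ℝ (toC κ) (x - y) u) := by
    intro u
    have := HasCompactSupport.convolutionExists_right (μ := volume) (ContinuousLinearMap.mul ℝ ℂ)
      (hc.toC.fderiv_apply ℝ u) hF (hcont.clm_apply continuous_const) x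
    exact this
  rw [del, h2, h2, ← integral_const_mul, ← integral_add (hi _) ((hi _).const_mul _),
    ← integral_const_mul]
  congr 1; ext y; simp only [del]; ring

theorem del_comp_const_sub {k : V → ℂ} (hk : ContDiff ℝ ∞ k) (σ : ℂ) (v x y : V) :
    del σ v (fun y => k (x - y)) y = - del σ v k (x - y) := by
  have : ∀ u, fderiv ℝ (fun y => k (x - y)) y u = - fderiv ℝ k (x - y) u := by
    intro u
    have h := ((hk.differentiable (by simp)) (x - y)).hasFDerivAt.comp y
      ((hasFDerivAt_id y).const_sub x)
    have h' : fderiv ℝ (fun y => k (x - y)) y = _ := h.fderiv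
    rw [h']; simp
  rw [del, this, this, del]; ring

theorem isTest_const_sub (hκ : ContDiff ℝ ∞ κ) (hc : HasCompactSupport κ) {W : Set V} {x : V}
    (hW : ∀ y, x - y ∈ tsupport κ → y ∈ W) : IsTest W (fun y => toC κ (x - y)) := by
  have hs : tsupport (fun y => toC κ (x - y)) ⊆ (fun y => x - y) ⁻¹' tsupport κ := by
    refine closure_minimal ?_ ((isClosed_tsupport κ).preimage (by fun_prop))
    intro y hy
    apply subset_tsupport
    intro h
    exact hy (by simp [toC, h])
  refine ⟨(contDiff_toC hκ).comp (contDiff_const.sub contDiff_id), ?_,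
    fun y hy => hW y (hs hy)⟩
  exact hc.toC.comp_homeomorph (Homeomorph.subLeft x)

/-- Mollification commutes with a weakly defined first-order operator. -/
theorem sum_del_moll {ι : Type*} [Fintype ι] (hκ : ContDiff ℝ ∞ κ) (hc : HasCompactSupport κ)
    {W : Set V} {x : V} (hW : ∀ y, x - y ∈ tsupport κ → y ∈ W) {σ : ℂ} {v : ι → V}
    {G : ι → V → ℂ} (hG : ∀ i, LocallyIntegrable (G i)) {D : V → ℂ}
    (hD : ∀ k, IsTest W k → ∫ x, ∑ i, G i x * del σ (v i) k x = - ∫ x, D x * k x) :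
    ∑ i, del σ (v i) (moll κ (G i)) x = moll κ D x := by
  have h := hD _ (isTest_const_sub hκ hc hW)
  have hi : ∀ i, Integrable (fun y => G i y * del σ (v i) (toC κ) (x - y)) := by
    intro i
    refine HasCompactSupport.convolutionExists_right (μ := volume) (ContinuousLinearMap.mul ℝ ℂ)
      (g := del σ (v i) (toC κ)) ?_ (hG i) (contDiff_del (contDiff_toC hκ)).continuous x
    exact hc.toC.mono' ((subset_tsupport _).trans tsupport_del_subset)
  simp only [del_moll hκ hc (hG _)]
  rw [← integral_finsetSum _ fun i _ => hi i, ← neg_inj, moll]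
  rw [show (fun y => D y * (κ (x - y) : ℂ)) = fun y => D y * toC κ (x - y) from rfl, ← h,
    ← integral_neg]
  congr 1; ext y
  rw [← Finset.sum_neg_distrib]
  refine Finset.sum_congr rfl fun i _ => ?_
  rw [del_comp_const_sub (contDiff_toC hκ)]; ring

theorem moll_eq_zero {r : ℝ} {K : Set V} (hκ : ∀ y, r < ‖y‖ → κ y = 0)
    (hF : ∀ x ∉ K, F x = 0) {x : V} (hx : x ∉ cthickening r K) : moll κ F x = 0 := by
  rw [moll, integral_eq_zero_of_ae]
  refine Eventually.of_forall fun y => ?_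
  by_cases hy : y ∈ K
  · have : κ (x - y) = 0 := by
      apply hκ
      by_contra h
      apply hx
      refine mem_cthickening_of_dist_le x y r K hy ?_
      rw [dist_eq_norm]; exact not_lt.1 h
    simp [this]
  · simp [hF y hy]

end Mollifier

section MollifierLTwo

variable {V : Type*} [NormedAddCommGroup V] [InnerProductSpace ℂ V]
  [FiniteDimensional ℂ V] [MeasureSpace V] [BorelSpace V]
  [(volume : Measure V).IsAddHaarMeasure] {F : V → ℂ}

theorem MemLp.locallyIntegrable_two (hF : MemLp F 2) : LocallyIntegrable F :=
  hF.locallyIntegrable (by norm_num)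

theorem eLpNorm_two_sq (f : V → ℂ) : eLpNorm f 2 volume ^ 2 = ∫⁻ x, ‖f x‖ₑ ^ 2 := by
  have h := eLpNorm_nnreal_pow_eq_lintegral (f := f) (μ := volume) (p := 2) (by norm_num)
  simp only [ENNReal.coe_ofNat, NNReal.coe_ofNat, ENNReal.rpow_ofNat] at h
  exact h

theorem eventually_eLpNorm_translate_le (hF : MemLp F 2) {ε : ℝ≥0∞} (hε : 0 < ε) :
    ∀ᶠ w in 𝓝 (0 : V), eLpNorm (fun x => F (x - w) - F x) 2 ≤ ε := by
  have hmem : ∀ w : V, MemLp (fun x => F (-w + x)) 2 := fun w =>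
    hF.comp_measurePreserving (measurePreserving_add_left volume (-w))
  have : Fact ((2 : ℝ≥0∞) ≠ ⊤) := ⟨by norm_num⟩
  have hc : Continuous fun w : V => (hmem w).toLp := by
    have h1 : Continuous fun w : V => DomAddAct.mk (-w) +ᵥ hF.toLp := by
      have : Continuous fun w : V => DomAddAct.mk (-w) :=
        DomAddAct.continuous_mk.comp continuous_neg
      exact this.vadd continuous_const
    exact h1
  have ht := hc.tendsto 0
  rw [Lp.tendsto_Lp_iff_tendsto_eLpNorm''] at ht
  filter_upwards [ht.eventually (ge_mem_nhds hε)] with w hw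
  refine le_trans (le_of_eq ?_) hw
  congr 1
  ext x
  simp [sub_eq_neg_add]

theorem enorm_moll_sub_sq_le (hF : MemLp F 2) (hm : Measurable F) {r : ℝ} (hr : 0 < r) (x : V) :
    ‖moll (kern r) F x - F x‖ₑ ^ 2
      ≤ ∫⁻ w, ENNReal.ofReal (kern r w) * ‖F (x - w) - F x‖ₑ ^ 2 := by
  set k : V → ℝ≥0∞ := fun w => ENNReal.ofReal (kern r w) with hk
  have hkm : Measurable k := (contDiff_kern r).continuous.measurable.ennreal_ofReal
  have hprob : IsProbabilityMeasure (volume.withDensity k) := by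
    constructor
    rw [withDensity_apply _ MeasurableSet.univ, Measure.restrict_univ,
      ← ofReal_integral_eq_lintegral_ofReal (kern_integrable hr)
        (Eventually.of_forall (kern_nonneg hr)), integral_kern hr, ENNReal.ofReal_one]
  have hfm : Measurable fun w => F (x - w) - F x :=
    (hm.comp (measurable_const.sub measurable_id)).sub measurable_const
  have h1 : moll (kern r) F x - F x = ∫ w : V, (F (x - w) - F x) * (kern r w : ℂ) := by
    have e1 : moll (kern r) F x = ∫ w : V, F (x - w) * (kern r w : ℂ) := by
      rw [moll, ← integral_sub_left_eq_self _ volume x]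
      simp
    have e2 : F x = ∫ w : V, F x * (kern r w : ℂ) := by
      rw [integral_const_mul, integral_complex_ofReal, integral_kern hr]; simp
    have i1 : Integrable fun w : V => F (x - w) * (kern r w : ℂ) := by
      have := HasCompactSupport.convolutionExists_right (μ := volume)
        (ContinuousLinearMap.mul ℝ ℂ) (hasCompactSupport_kern hr).toC
        (MemLp.locallyIntegrable_two hF) (contDiff_toC (contDiff_kern r)).continuous x
      have := (this : Integrable (fun y => F y * (kern r (x - y) : ℂ)) volume).comp_sub_left x
      simpa [toC] using this
    conv_lhs => rw [e1]; arg 2; rw [e2]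
    have i2 : Integrable (fun w : V => F x * (kern r w : ℂ)) :=
      (kern_integrable hr).ofReal.const_mul _
    rw [← integral_sub i1 i2]
    congr 1; ext w; ring
  have h2 : ‖moll (kern r) F x - F x‖ₑ
      ≤ eLpNorm (fun w => F (x - w) - F x) 1 (volume.withDensity k) := by
    rw [h1, eLpNorm_one_eq_lintegral_enorm, lintegral_withDensity_eq_lintegral_mul _ hkm
      hfm.enorm]
    refine (enorm_integral_le_lintegral_enorm _).trans (le_of_eq ?_)
    congr 1; ext w
    rw [Pi.mul_apply, enorm_mul, mul_comm]
    congr 1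
    rw [← ofReal_norm, Complex.norm_real, Real.norm_of_nonneg (kern_nonneg hr w)]
  have h3 := h2.trans (eLpNorm_le_eLpNorm_of_exponent_le (by norm_num : (1 : ℝ≥0∞) ≤ 2)
    hfm.aestronglyMeasurable)
  have h4 := eLpNorm_nnreal_pow_eq_lintegral (f := fun w => F (x - w) - F x)
    (μ := volume.withDensity k) (p := 2) (by norm_num)
  simp only [ENNReal.coe_ofNat, NNReal.coe_ofNat, ENNReal.rpow_ofNat] at h4
  calc _ ≤ _ := pow_le_pow_left' h3 2
    _ = _ := h4
    _ = _ := by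
      rw [lintegral_withDensity_eq_lintegral_mul _ hkm (hfm.enorm.pow_const 2)]
      rfl

theorem eLpNorm_moll_sub_le (hF : MemLp F 2) {r : ℝ} (hr : 0 < r) {ε : ℝ≥0∞}
    (h : ∀ w : V, ‖w‖ < r → eLpNorm (fun x => F (x - w) - F x) 2 ≤ ε) :
    eLpNorm (fun x => moll (kern r) F x - F x) 2 ≤ ε := by
  obtain ⟨F', hF'm, hFF'⟩ := hF.1
  have hF' : MemLp F' 2 := (memLp_congr_ae hFF').1 hF
  have hmoll : moll (kern r) F = moll (kern r) F' := by
    ext x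
    refine integral_congr_ae ?_
    filter_upwards [hFF'] with y hy
    rw [hy]
  have hs : ∀ w : V, (fun x => F (x - w)) =ᵐ[volume] fun x => F' (x - w) := fun w =>
    (measurePreserving_sub_right volume w).quasiMeasurePreserving.ae_eq_comp hFF'
  have h' : ∀ w : V, ‖w‖ < r → eLpNorm (fun x => F' (x - w) - F' x) 2 ≤ ε := by
    intro w hw
    refine le_trans (le_of_eq (eLpNorm_congr_ae ?_)) (h w hw)
    filter_upwards [hFF', hs w] with x h1 h2
    rw [h1, h2]
  have hm := hF'm.measurable
  rw [eLpNorm_congr_ae (g := fun x => moll (kern r) F' x - F' x) (by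
    filter_upwards [hFF'] with x hx; rw [hmoll, hx])]
  rw [← ENNReal.pow_le_pow_left_iff (n := 2) (by norm_num), eLpNorm_two_sq]
  have hkm : Measurable fun w : V => ENNReal.ofReal (kern r w) :=
    (contDiff_kern r).continuous.measurable.ennreal_ofReal
  have hmeas : Measurable fun p : V × V =>
      ENNReal.ofReal (kern r p.2) * ‖F' (p.1 - p.2) - F' p.1‖ₑ ^ 2 :=
    (hkm.comp measurable_snd).mul
      ((((hm.comp (measurable_fst.sub measurable_snd)).sub (hm.comp measurable_fst)).enorm).pow_const 2)
  calc ∫⁻ x, ‖moll (kern r) F' x - F' x‖ₑ ^ 2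
      ≤ ∫⁻ x, ∫⁻ w, ENNReal.ofReal (kern r w) * ‖F' (x - w) - F' x‖ₑ ^ 2 :=
        lintegral_mono fun x => enorm_moll_sub_sq_le hF' hm hr x
    _ = ∫⁻ w, ∫⁻ x, ENNReal.ofReal (kern r w) * ‖F' (x - w) - F' x‖ₑ ^ 2 :=
        lintegral_lintegral_swap hmeas.aemeasurable
    _ ≤ ∫⁻ w, ENNReal.ofReal (kern r w) * ε ^ 2 := by
        refine lintegral_mono fun w => ?_
        rw [lintegral_const_mul]
        · by_cases hw : ‖w‖ < r
          · rw [← eLpNorm_two_sq]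
            exact mul_le_mul_right (pow_le_pow_left' (h' w hw) 2) _
          · simp [kern_eq_zero hr (not_lt.1 hw)]
        · exact (((hm.comp (measurable_id.sub_const w)).sub hm).enorm).pow_const 2
    _ = ε ^ 2 := by
        rw [lintegral_mul_const _ hkm, ← ofReal_integral_eq_lintegral_ofReal (kern_integrable hr)
          (Eventually.of_forall (kern_nonneg hr)), integral_kern hr, ENNReal.ofReal_one, one_mul]

theorem tendsto_eLpNorm_moll_sub (hF : MemLp F 2) :
    Tendsto (fun r : ℝ => eLpNorm (fun x => moll (kern r) F x - F x) 2) (𝓝[>] 0) (𝓝 0) := by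
  rw [ENNReal.tendsto_nhds_zero]
  intro ε hε
  obtain ⟨δ, hδ, h⟩ := Metric.eventually_nhds_iff.1 (eventually_eLpNorm_translate_le hF hε)
  filter_upwards [Ioo_mem_nhdsGT hδ] with r hr
  refine eLpNorm_moll_sub_le hF hr.1 fun w hw => h ?_
  rw [dist_zero_right]
  exact hw.trans hr.2

/-- Mollification of a compactly supported function converges in `L²`, even after multiplication
by a continuous function. -/
theorem tendsto_eLpNorm_mul_moll_sub (hF : MemLp F 2) {K : Set V} (hK : IsCompact K)
    (hFK : ∀ x ∉ K, F x = 0) {b : V → ℂ} (hb : Continuous b) :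
    Tendsto (fun r : ℝ => eLpNorm (fun x => b x * moll (kern r) F x - b x * F x) 2)
      (𝓝[>] 0) (𝓝 0) := by
  obtain ⟨C, hC⟩ := (hK.cthickening (r := 1)).exists_bound_of_continuousOn hb.continuousOn
  have h0 : Tendsto (fun r : ℝ => ENNReal.ofReal (max C 0)
      * eLpNorm (fun x => moll (kern r) F x - F x) 2) (𝓝[>] 0) (𝓝 0) := by
    have := ENNReal.Tendsto.const_mul (a := ENNReal.ofReal (max C 0))
      (tendsto_eLpNorm_moll_sub hF) (Or.inr ENNReal.ofReal_ne_top)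
    simpa using this
  refine tendsto_of_tendsto_of_tendsto_of_le_of_le' tendsto_const_nhds h0
    (Eventually.of_forall fun _ => by simp) ?_
  filter_upwards [Ioo_mem_nhdsGT (zero_lt_one' ℝ)] with r hr
  refine eLpNorm_le_mul_eLpNorm_of_ae_le_mul (Eventually.of_forall fun x => ?_) 2
  rw [← mul_sub, norm_mul]
  by_cases hx : x ∈ cthickening 1 K
  · exact mul_le_mul_of_nonneg_right ((hC x hx).trans (le_max_left _ _)) (norm_nonneg _)
  · have h1 : F x = 0 := hFK x fun h => hx (self_subset_cthickening K h)
    have h2 : moll (kern r) F x = 0 :=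
      moll_eq_zero (r := 1) (fun y hy => kern_eq_zero hr.1 (hr.2.trans hy).le) hFK hx
    simp [h1, h2]

theorem integral_norm_sq_eq {f : V → ℂ} (hf : MemLp f 2) :
    ∫ x, ‖f x‖ ^ 2 = (eLpNorm f 2).toReal ^ 2 := by
  rw [← ENNReal.toReal_pow, eLpNorm_two_sq, integral_eq_lintegral_of_nonneg_ae
    (Eventually.of_forall fun x => by positivity) (by simpa using hf.1.norm.aemeasurable.pow_const 2 |>.aestronglyMeasurable)]
  congr 2; ext x
  rw [ENNReal.ofReal_pow (norm_nonneg _), ofReal_norm]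

theorem tendsto_integral_norm_sq {ι : Type*} {l : Filter ι} {f : ι → V → ℂ} {g : V → ℂ}
    (hf : ∀ᶠ i in l, MemLp (f i) 2) (hg : MemLp g 2)
    (h : Tendsto (fun i => eLpNorm (fun x => f i x - g x) 2) l (𝓝 0)) :
    Tendsto (fun i => ∫ x, ‖f i x‖ ^ 2) l (𝓝 (∫ x, ‖g x‖ ^ 2)) := by
  have h1 : Tendsto (fun i => (eLpNorm (f i) 2).toReal) l (𝓝 (eLpNorm g 2).toReal) := by
    rw [tendsto_iff_norm_sub_tendsto_zero]
    have h2 : Tendsto (fun i => (eLpNorm (fun x => f i x - g x) 2).toReal) l (𝓝 0) := by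
      exact (ENNReal.tendsto_toReal ENNReal.zero_ne_top).comp h
    refine tendsto_of_tendsto_of_tendsto_of_le_of_le' tendsto_const_nhds h2
      (Eventually.of_forall fun _ => norm_nonneg _) ?_
    filter_upwards [hf] with i hi
    have e1 := Lp.norm_toLp (f i) hi
    have e2 := Lp.norm_toLp g hg
    have e3 := Lp.norm_toLp _ (hi.sub hg)
    rw [MemLp.toLp_sub hi hg] at e3
    rw [← e1, ← e2]
    refine (abs_norm_sub_norm_le _ _).trans (le_of_eq e3)
  refine ((h1.pow 2).congr' ?_).trans (le_of_eq ?_)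
  · filter_upwards [hf] with i hi
    rw [integral_norm_sq_eq hi]
  · rw [integral_norm_sq_eq hg]

end MollifierLTwo

section WeakEstimate

variable {V : Type*} [NormedAddCommGroup V] [InnerProductSpace ℂ V]
  [FiniteDimensional ℂ V] [MeasureSpace V] [BorelSpace V]
  [(volume : Measure V).IsAddHaarMeasure]

theorem MemLp.continuous_mul {F : V → ℂ} (hF : MemLp F 2) {K : Set V} (hK : IsCompact K)
    (hFK : ∀ x ∉ K, F x = 0) {b : V → ℂ} (hb : Continuous b) : MemLp (fun x => b x * F x) 2 := by
  obtain ⟨C, hC⟩ := hK.exists_bound_of_continuousOn hb.continuousOn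
  refine hF.of_le_mul (c := C) (hb.aestronglyMeasurable.mul hF.1) (Eventually.of_forall fun x => ?_)
  by_cases hx : x ∈ K
  · rw [norm_mul]; exact mul_le_mul_of_nonneg_right (hC x hx) (norm_nonneg _)
  · simp [hFK x hx]

theorem integrable_norm_sq {F : V → ℂ} (hF : MemLp F 2) : Integrable fun x => ‖F x‖ ^ 2 :=
  hF.integrable_norm_pow (by norm_num)

/-- The square root of the weight `e^{-φ}`, as a complex-valued function. -/
def halfWeight (φ : V → ℝ) (x : V) : ℂ := (Real.exp (-(φ x / 2)) : ℂ)

theorem norm_halfWeight_mul_sq (φ : V → ℝ) (x : V) (z : ℂ) :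
    ‖halfWeight φ x * z‖ ^ 2 = ‖z‖ ^ 2 * expNeg φ x := by
  rw [norm_mul, mul_pow, halfWeight, Complex.norm_real, Real.norm_of_nonneg (Real.exp_pos _).le,
    expNeg, ← Real.exp_nat_mul, mul_comm]
  congr 2; push_cast; ring

theorem continuous_halfWeight {φ : V → ℝ} (hφ : Continuous φ) : Continuous (halfWeight φ) := by
  unfold halfWeight; fun_prop

variable {ι : Type*} [Fintype ι] {e : ι → V} {φ : V → ℝ}

theorem continuous_leviForm (hφ : ContDiff ℝ ∞ φ) {g : ι → V → ℂ} (hg : ∀ i, Continuous (g i)) :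
    Continuous fun x => leviForm e φ x (fun i => g i x) := by
  unfold leviForm
  refine continuous_finsetSum _ fun j _ => continuous_finsetSum _ fun k _ => ?_
  exact ((contDiff_del (contDiff_del (contDiff_toC hφ))).continuous.mul (hg j)).mul
    (Complex.continuous_conj.comp (hg k))

theorem sum_sum_integral {f : ι → ι → V → ℝ} (hf : ∀ j k, Integrable (f j k)) :
    ∑ j, ∑ k, ∫ x, f j k x = ∫ x, ∑ j, ∑ k, f j k x := by
  rw [integral_finsetSum _ fun j _ => integrable_finsetSum _ fun k _ => hf j k]
  exact Finset.sum_congr rfl fun j _ => (integral_finsetSum _ fun k _ => hf j k).symm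

/-- The Morrey-Kohn-Hörmander estimate for compactly supported forms in the weak domain. -/
theorem weak_estimate (hφ : ContDiff ℝ ∞ φ) {W K : Set V} (hW : IsOpen W) (hK : IsCompact K)
    (hKW : K ⊆ W) {G : ι → V → ℂ} {D : V → ℂ} {R : ι → ι → V → ℂ}
    (hG : ∀ i, MemLp (G i) 2) (hD : MemLp D 2) (hR : ∀ j k, MemLp (R j k) 2)
    (hGK : ∀ i, ∀ x ∉ K, G i x = 0) (hDK : ∀ x ∉ K, D x = 0) (hRK : ∀ j k, ∀ x ∉ K, R j k x = 0)
    (hGD : ∀ κ, IsTest univ κ → ∫ x, ∑ i, G i x * del (-1) (e i) κ x = - ∫ x, D x * κ x)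
    (hGR : ∀ j k κ, IsTest univ κ →
      ∫ x, (G k x * del 1 (e j) κ x - G j x * del 1 (e k) κ x) = - ∫ x, R j k x * κ x)
    {m : V → ℝ} (hm : Continuous m) (hm0 : ∀ x, 0 ≤ m x)
    (hlevi : ∀ x ∈ W, ∀ ξ : ι → ℂ, m x * ∑ i, ‖ξ i‖ ^ 2 ≤ (leviForm e φ x ξ).re) :
    ∫ x, m x * (∑ i, ‖G i x‖ ^ 2) * expNeg φ x
      ≤ (∫ x, ‖D x - ∑ i, del (-1) (e i) (toC φ) x * G i x‖ ^ 2 * expNeg φ x)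
        + ∫ x, (∑ j, ∑ k, ‖R j k x‖ ^ 2) * expNeg φ x := by
  have hb := continuous_halfWeight hφ.continuous
  set s : V → ℂ := fun x => (Real.sqrt (m x) : ℂ) * halfWeight φ x with hs
  have hsc : Continuous s := (Complex.continuous_ofReal.comp hm.sqrt).mul hb
  have s_sq : ∀ x (z : ℂ), ‖s x * z‖ ^ 2 = m x * ‖z‖ ^ 2 * expNeg φ x := by
    intro x z
    rw [hs, mul_assoc, norm_mul, mul_pow, norm_halfWeight_mul_sq, Complex.norm_real,
      Real.norm_of_nonneg (Real.sqrt_nonneg _), Real.sq_sqrt (hm0 x)]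
    ring
  set a : ι → V → ℂ := fun i x => halfWeight φ x * del (-1) (e i) (toC φ) x with ha
  have hac : ∀ i, Continuous (a i) := fun i =>
    hb.mul (contDiff_del (contDiff_toC hφ)).continuous
  obtain ⟨δ, hδ, hδW⟩ := hK.exists_cthickening_subset_open hW hKW
  have moll_test : ∀ r, 0 < r → r ≤ δ → ∀ F : V → ℂ, MemLp F 2 → (∀ x ∉ K, F x = 0) →
      IsTest W (moll (kern r) F) := by
    intro r hr hrδ F hF hFK
    have hsup : tsupport (moll (kern r) F) ⊆ cthickening r K := by
      refine closure_minimal (fun x hx => ?_) isClosed_cthickening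
      by_contra h
      exact hx (moll_eq_zero (fun y hy => kern_eq_zero hr hy.le) hFK h)
    exact ⟨contDiff_moll (contDiff_kern r) (hasCompactSupport_kern hr)
      (MemLp.locallyIntegrable_two hF), hK.cthickening.of_isClosed_subset (isClosed_tsupport _) hsup,
      (hsup.trans (cthickening_mono hrδ K)).trans hδW⟩
  have test_memLp : ∀ {F : V → ℂ} {c : V → ℂ}, Continuous c → IsTest W F →
      MemLp (fun x => c x * F x) 2 := fun hc hF =>
    (hc.mul hF.continuous).memLp_of_hasCompactSupport hF.compact.mul_left
  have ev : ∀ᶠ r : ℝ in 𝓝[>] 0, 0 < r ∧ r ≤ δ := by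
    filter_upwards [Ioo_mem_nhdsGT hδ] with r hr using ⟨hr.1, hr.2.le⟩
  have lim : ∀ (F : V → ℂ), MemLp F 2 → (∀ x ∉ K, F x = 0) → ∀ c : V → ℂ, Continuous c →
      Tendsto (fun r => ∫ x, ‖c x * moll (kern r) F x‖ ^ 2) (𝓝[>] 0)
        (𝓝 (∫ x, ‖c x * F x‖ ^ 2)) := by
    intro F hF hFK c hc
    refine tendsto_integral_norm_sq ?_ (MemLp.continuous_mul hF hK hFK hc)
      (tendsto_eLpNorm_mul_moll_sub hF hK hFK hc)
    filter_upwards [ev] with r hr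
    exact test_memLp hc (moll_test r hr.1 hr.2 F hF hFK)
  have limL := tendsto_finsetSum Finset.univ fun i _ => lim (G i) (hG i) (hGK i) s hsc
  have limR := tendsto_finsetSum Finset.univ fun j _ => tendsto_finsetSum Finset.univ fun k _ =>
    lim (R j k) (hR j k) (hRK j k) _ hb
  have limA : Tendsto (fun r => ∫ x, ‖halfWeight φ x * moll (kern r) D x
        - ∑ i, a i x * moll (kern r) (G i) x‖ ^ 2) (𝓝[>] 0)
      (𝓝 (∫ x, ‖halfWeight φ x * D x - ∑ i, a i x * G i x‖ ^ 2)) := by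
    refine tendsto_integral_norm_sq ?_ ((MemLp.continuous_mul hD hK hDK hb).sub
      (memLp_finsetSum _ fun i _ => MemLp.continuous_mul (hG i) hK (hGK i) (hac i))) ?_
    · filter_upwards [ev] with r hr
      exact (test_memLp hb (moll_test r hr.1 hr.2 D hD hDK)).sub
        (memLp_finsetSum _ fun i _ => test_memLp (hac i) (moll_test r hr.1 hr.2 _ (hG i) (hGK i)))
    · have h0 : Tendsto (fun r => eLpNorm (fun x => halfWeight φ x * moll (kern r) D x
            - halfWeight φ x * D x) 2 + ∑ i, eLpNorm (fun x => a i x * moll (kern r) (G i) x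
            - a i x * G i x) 2) (𝓝[>] 0) (𝓝 (0 + ∑ _i : ι, 0)) :=
        (tendsto_eLpNorm_mul_moll_sub hD hK hDK hb).add (tendsto_finsetSum _ fun i _ =>
          tendsto_eLpNorm_mul_moll_sub (hG i) hK (hGK i) (hac i))
      simp only [Finset.sum_const_zero, add_zero] at h0
      refine tendsto_of_tendsto_of_tendsto_of_le_of_le' tendsto_const_nhds h0
        (Eventually.of_forall fun _ => by simp) ?_
      filter_upwards [ev] with r hr
      have m1 := (test_memLp hb (moll_test r hr.1 hr.2 D hD hDK)).sub
        (MemLp.continuous_mul hD hK hDK hb)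
      have m2 := fun i => (test_memLp (hac i) (moll_test r hr.1 hr.2 _ (hG i) (hGK i))).sub
        (MemLp.continuous_mul (hG i) hK (hGK i) (hac i))
      have e0 : (fun x => (halfWeight φ x * moll (kern r) D x
          - ∑ i, a i x * moll (kern r) (G i) x) - (halfWeight φ x * D x - ∑ i, a i x * G i x))
          = (fun x => halfWeight φ x * moll (kern r) D x - halfWeight φ x * D x)
            - ∑ i, fun x => a i x * moll (kern r) (G i) x - a i x * G i x := by
        ext x
        simp only [Pi.sub_apply, Finset.sum_apply, Finset.sum_sub_distrib]
        ring
      rw [e0]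
      refine (eLpNorm_sub_le m1.1 (memLp_finsetSum' _ fun i _ => m2 i).1 (by norm_num)).trans ?_
      refine add_le_add le_rfl ?_
      exact eLpNorm_sum_le (fun i _ => (m2 i).1) (by norm_num)
  have main : ∀ᶠ r in 𝓝[>] (0 : ℝ), ∑ i, ∫ x, ‖s x * moll (kern r) (G i) x‖ ^ 2
      ≤ (∫ x, ‖halfWeight φ x * moll (kern r) D x
        - ∑ i, a i x * moll (kern r) (G i) x‖ ^ 2)
        + ∑ j, ∑ k, ∫ x, ‖halfWeight φ x * moll (kern r) (R j k) x‖ ^ 2 := by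
    filter_upwards [ev] with r hr
    have hg := fun i => moll_test r hr.1 hr.2 (G i) (hG i) (hGK i)
    have hgR := fun j k => moll_test r hr.1 hr.2 (R j k) (hR j k) (hRK j k)
    have mkh := morrey_kohn_hormander (e := e) hφ hg
    have d1 : ∀ x, ∑ i, del (-1) (e i) (moll (kern r) (G i)) x = moll (kern r) D x := fun x =>
      sum_del_moll (contDiff_kern r) (hasCompactSupport_kern hr.1) (W := univ)
        (fun _ _ => mem_univ _) (fun i => MemLp.locallyIntegrable_two (hG i)) hGD
    have d2 : ∀ j k x, del 1 (e j) (moll (kern r) (G k)) x - del 1 (e k) (moll (kern r) (G j)) x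
        = moll (kern r) (R j k) x := by
      intro j k x
      have h := sum_del_moll (contDiff_kern r) (hasCompactSupport_kern hr.1) (W := univ)
        (x := x) (fun _ _ => mem_univ _) (σ := 1) (v := ![e j, - e k]) (G := ![G k, G j])
        (D := R j k) (by
          intro i; fin_cases i
          · exact MemLp.locallyIntegrable_two (hG k)
          · exact MemLp.locallyIntegrable_two (hG j)) (by
          intro κ hκ
          rw [← hGR j k κ hκ]
          congr 1; ext y
          have : del 1 (-e k) κ y = - del 1 (e k) κ y := by
            have := del_sub_dir (σ := 1) (v := 0) (w := e k) (k := κ) (x := y)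
            simpa [del_zero_dir] using this
          simp [Fin.sum_univ_two, this, sub_eq_add_neg])
      have hneg : del 1 (-e k) (moll (kern r) (G j)) x = - del 1 (e k) (moll (kern r) (G j)) x := by
        have := del_sub_dir (σ := 1) (v := 0) (w := e k) (k := moll (kern r) (G j)) (x := x)
        simpa [del_zero_dir] using this
      rw [← h]
      simp [Fin.sum_univ_two, hneg, sub_eq_add_neg]
    have eL : ∑ i, ∫ x, ‖s x * moll (kern r) (G i) x‖ ^ 2
        ≤ ∫ x, (leviForm e φ x (fun i => moll (kern r) (G i) x)).re * expNeg φ x := by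
      rw [← integral_finsetSum _ fun i _ => integrable_norm_sq (test_memLp hsc (hg i))]
      refine integral_mono (integrable_finsetSum _ fun i _ =>
        integrable_norm_sq (test_memLp hsc (hg i))) ?_ fun x => ?_
      · refine Continuous.integrable_of_hasCompactSupport ((Complex.continuous_re.comp
          (continuous_leviForm hφ fun i => (hg i).continuous)).mul
          (contDiff_expNeg hφ).continuous) (HasCompactSupport.mul_right ?_)
        refine HasCompactSupport.of_support_subset_isCompact
          (K := ⋃ i, tsupport (moll (kern r) (G i)))
          (isCompact_iUnion fun i => (hg i).compact) fun x hx => ?_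
        by_contra hn
        simp only [mem_iUnion, not_exists] at hn
        apply hx
        simp [leviForm, image_eq_zero_of_notMem_tsupport (hn _)]
      · simp only [s_sq]
        rw [← Finset.sum_mul, ← Finset.mul_sum]
        refine mul_le_mul_of_nonneg_right ?_ (expNeg_pos x).le
        by_cases hx : x ∈ W
        · exact hlevi x hx _
        · have : ∀ i, moll (kern r) (G i) x = 0 := fun i =>
            image_eq_zero_of_notMem_tsupport fun h => hx ((hg i).subset h)
          simp [this, leviForm]
    refine (eL.trans mkh).trans (le_of_eq ?_)
    congr 1
    · congr 1; ext x
      rw [← norm_halfWeight_mul_sq]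
      congr 2
      simp only [wdel, Finset.sum_sub_distrib, d1, ha, mul_sub, Finset.mul_sum, mul_assoc]
    · rw [sum_sum_integral fun j k => integrable_norm_sq (test_memLp hb (hgR j k))]
      · congr 1; ext x
        simp only [Finset.sum_mul, d2, norm_halfWeight_mul_sq]
  have fin := le_of_tendsto_of_tendsto limL (limA.add limR) main
  have mR := fun j k => integrable_norm_sq (MemLp.continuous_mul (hR j k) hK (hRK j k) hb)
  rw [← integral_finsetSum _ fun i _ =>
    integrable_norm_sq (MemLp.continuous_mul (hG i) hK (hGK i) hsc)] at fin
  rw [sum_sum_integral mR] at fin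
  refine (le_of_eq ?_).trans (fin.trans (le_of_eq ?_))
  · congr 1; ext x
    simp only [s_sq, Finset.mul_sum, Finset.sum_mul]
  · congr 1
    · congr 1; ext x
      rw [← norm_halfWeight_mul_sq]
      congr 2
      simp only [ha, mul_sub, Finset.mul_sum, mul_assoc]
    · congr 1; ext x
      simp only [Finset.sum_mul, norm_halfWeight_mul_sq]

end WeakEstimate

section Projection

variable {V : Type*} [NormedAddCommGroup V] [InnerProductSpace ℂ V]
  [FiniteDimensional ℂ V] [MeasureSpace V] [BorelSpace V]
  [(volume : Measure V).IsAddHaarMeasure]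

variable {ι : Type*} [Fintype ι]

theorem memLp_toLp {u : ι → V → ℂ} (hu : ∀ i, MemLp (u i) 2) :
    MemLp (fun x => (WithLp.toLp 2 (fun i => u i x) : EuclideanSpace ℂ ι)) 2 := by
  classical
  have h : (fun x => (WithLp.toLp 2 (fun i => u i x) : EuclideanSpace ℂ ι))
      = fun x => ∑ i, u i x • EuclideanSpace.single i (1 : ℂ) := by
    ext x j
    simp [Pi.single_apply]
  rw [h]
  refine memLp_finsetSum _ fun i _ => ?_
  refine (hu i).of_le_mul (c := 1) ((hu i).1.smul_const _) (Eventually.of_forall fun x => ?_)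
  simp [norm_smul]

/-- The square-integrable form with the given components. -/
def lpForm (u : ι → V → ℂ) (hu : ∀ i, MemLp (u i) 2) : Lp (EuclideanSpace ℂ ι) 2 (volume : Measure V) :=
  (memLp_toLp hu).toLp _

theorem inner_lpForm {u : ι → V → ℂ} (hu : ∀ i, MemLp (u i) 2)
    (F : Lp (EuclideanSpace ℂ ι) 2 (volume : Measure V)) :
    inner ℂ (lpForm u hu) F = ∫ x, ∑ i, conj (u i x) * F x i := by
  rw [L2.inner_def]
  refine integral_congr_ae ?_
  filter_upwards [(memLp_toLp hu).coeFn_toLp] with x hx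
  change inner ℂ (((memLp_toLp hu).toLp _ : Lp (EuclideanSpace ℂ ι) 2 (volume : Measure V)) x) _ = _
  rw [hx, PiLp.inner_apply]
  exact Finset.sum_congr rfl fun i _ => by simp [mul_comm]

theorem norm_lpForm_sq {u : ι → V → ℂ} (hu : ∀ i, MemLp (u i) 2) :
    ‖lpForm u hu‖ ^ 2 = ∫ x, ∑ i, ‖u i x‖ ^ 2 := by
  have h2 : ∫ x, ∑ i, conj (u i x) * (lpForm u hu) x i = ((∫ x, ∑ i, ‖u i x‖ ^ 2 : ℝ) : ℂ) := by
    rw [← integral_complex_ofReal]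
    refine integral_congr_ae ?_
    filter_upwards [(memLp_toLp hu).coeFn_toLp] with x hx
    change ∑ i, conj (u i x) * (((memLp_toLp hu).toLp _ : Lp (EuclideanSpace ℂ ι) 2 (volume : Measure V)) x) i = _
    rw [hx]
    push_cast
    exact Finset.sum_congr rfl fun i _ => by
      simp [← Complex.normSq_eq_conj_mul_self, Complex.normSq_eq_norm_sq]
  rw [@norm_sq_eq_re_inner ℂ, inner_lpForm, h2]
  rfl

theorem memLp_coord (F : Lp (EuclideanSpace ℂ ι) 2 (volume : Measure V)) (i : ι) :
    MemLp (fun x => F x i) 2 := by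
  refine (Lp.memLp F).of_le_mul (c := 1) ?_ (Eventually.of_forall fun x => ?_)
  · exact (EuclideanSpace.proj (𝕜 := ℂ) i).continuous.comp_aestronglyMeasurable (Lp.memLp F).1
  · simpa using PiLp.norm_apply_le (F x) i

theorem norm_lp_sq (F : Lp (EuclideanSpace ℂ ι) 2 (volume : Measure V)) :
    ‖F‖ ^ 2 = ∫ x, ∑ i, ‖F x i‖ ^ 2 := by
  have h2 : inner ℂ F F = ((∫ x, ∑ i, ‖F x i‖ ^ 2 : ℝ) : ℂ) := by
    rw [L2.inner_def, ← integral_complex_ofReal]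
    congr 1; ext x
    rw [PiLp.inner_apply]
    push_cast
    exact Finset.sum_congr rfl fun i _ => inner_self_eq_norm_sq_to_K (𝕜 := ℂ) _
  rw [@norm_sq_eq_re_inner ℂ, h2]
  rfl

theorem IsTest.memLp_mul {W : Set V} {k c : V → ℂ} (hk : IsTest W k) (hc : Continuous c) :
    MemLp (fun x => c x * k x) 2 :=
  (hc.mul hk.continuous).memLp_of_hasCompactSupport hk.compact.mul_left

theorem norm_starProjection_sq_le {H : Type*} [NormedAddCommGroup H] [InnerProductSpace ℂ H]
    (S : Submodule ℂ H) [S.HasOrthogonalProjection] (v : H) : ‖S.starProjection v‖ ^ 2 ≤ ‖v‖ ^ 2 := by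
  gcongr; exact Submodule.norm_starProjection_apply_le _ _

/-- Projection of `e^φ h` onto the `∂̄`-closed forms in the space weighted by `e^{-φ}`. -/
theorem exists_projection {φ : V → ℝ} (hφ : ContDiff ℝ ∞ φ) (e : ι → V) {W : Set V}
    {h : ι → V → ℂ} (hh : ∀ i, IsTest W (h i)) :
    ∃ G : ι → V → ℂ, (∀ i, MemLp (fun x => halfWeight φ x * G i x) 2) ∧
      (∀ j k κ, IsTest W κ →
        ∫ x, (G k x * del 1 (e j) κ x - G j x * del 1 (e k) κ x) = 0) ∧
      (∫ x, (∑ i, ‖G i x‖ ^ 2) * expNeg φ x ≤ ∫ x, (∑ i, ‖h i x‖ ^ 2) * Real.exp (φ x)) ∧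
      ∀ χ, IsTest W χ → ∫ x, ∑ i, conj (del 1 (e i) χ x) * G i x * (expNeg φ x : ℂ)
        = ∫ x, ∑ i, conj (del 1 (e i) χ x) * h i x := by
  classical
  set p : V → ℂ := fun x => (Real.exp (φ x / 2) : ℂ) with hp
  have hpc : Continuous p := by have := hφ.continuous; fun_prop
  have hbc := continuous_halfWeight hφ.continuous
  have hbp : ∀ x, halfWeight φ x * p x = 1 := by
    intro x
    simp only [halfWeight, hp, ← Complex.ofReal_mul, ← Real.exp_add]; simp
  have hpconj : ∀ x, conj (p x) = p x := fun x => Complex.conj_ofReal _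
  have hbconj : ∀ x, conj (halfWeight φ x) = halfWeight φ x := fun x => Complex.conj_ofReal _
  have hbb : ∀ x, halfWeight φ x * halfWeight φ x = (expNeg φ x : ℂ) := by
    intro x
    simp only [halfWeight, expNeg, ← Complex.ofReal_mul, ← Real.exp_add]; ring_nf
  let m : (V → ℂ) → ι → ι → ι → V → ℂ := fun κ j k i x =>
    p x * ((if i = k then conj (del 1 (e j) κ x) else 0)
      - (if i = j then conj (del 1 (e k) κ x) else 0))
  have hm : ∀ κ, IsTest W κ → ∀ j k i, MemLp (m κ j k i) 2 := by
    intro κ hκ j k i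
    have t1 := (hκ.del 1 (e j)).star
    have t2 := (hκ.del 1 (e k)).star
    have t : ∀ (P : Prop) [Decidable P] (u : V → ℂ), IsTest W u →
        IsTest W (fun x => if P then u x else 0) := by
      intro P _ u hu
      by_cases hP : P <;> simp [hP, hu, IsTest.zero]
    have := ((t (i = k) _ t1).add ((t (i = j) _ t2).const_mul (-1))).memLp_mul hpc
    refine this.ae_eq (Eventually.of_forall fun x => ?_)
    simp only [m]; ring
  let T : Set (Lp (EuclideanSpace ℂ ι) 2 (volume : Measure V)) :=
    {F | ∃ κ, ∃ hκ : IsTest W κ, ∃ j k, F = lpForm (m κ j k) (hm κ hκ j k)}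
  let Z : Submodule ℂ (Lp (EuclideanSpace ℂ ι) 2 (volume : Measure V)) := (Submodule.span ℂ T)ᗮ
  have m_inner : ∀ κ j k x (z : ι → ℂ), ∑ i, conj (m κ j k i x) * z i
      = p x * (z k * del 1 (e j) κ x - z j * del 1 (e k) κ x) := by
    intro κ j k x z
    simp only [m, map_mul, map_sub, hpconj, apply_ite (starRingEnd ℂ), Complex.conj_conj, map_zero,
      mul_sub, sub_mul, Finset.sum_sub_distrib, mul_ite, ite_mul, mul_zero, zero_mul,
      Finset.sum_ite_eq', Finset.mem_univ, if_true]
    ring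
  have hgm : ∀ i, MemLp (fun x => p x * h i x) 2 := fun i => (hh i).memLp_mul hpc
  set g := lpForm (fun i x => p x * h i x) hgm
  set F := Z.starProjection g with hF
  have hFZ : F ∈ Z := Submodule.starProjection_apply_mem _ _
  refine ⟨fun i x => p x * F x i, fun i => ?_, fun j k κ hκ => ?_, ?_, fun χ hχ => ?_⟩
  · refine (memLp_coord F i).ae_eq (Eventually.of_forall fun x => ?_)
    simp only [← mul_assoc, hbp, one_mul]
  · have := (Submodule.mem_orthogonal _ _).1 hFZ _ (Submodule.subset_span ⟨κ, hκ, j, k, rfl⟩)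
    rw [inner_lpForm] at this
    rw [← this]
    congr 1; ext x
    rw [m_inner]; ring
  · have h1 := norm_starProjection_sq_le Z g
    rw [← hF, norm_lp_sq, norm_lpForm_sq] at h1
    refine (le_of_eq ?_).trans (h1.trans (le_of_eq ?_))
    · congr 1; ext x
      rw [Finset.sum_mul]
      refine Finset.sum_congr rfl fun i _ => ?_
      rw [← norm_halfWeight_mul_sq, ← mul_assoc, hbp, one_mul]
    · congr 1; ext x
      rw [Finset.sum_mul]
      refine Finset.sum_congr rfl fun i _ => ?_
      rw [norm_mul, mul_pow, hp, Complex.norm_real, Real.norm_of_nonneg (Real.exp_pos _).le,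
        ← Real.exp_nat_mul, mul_comm]
      congr 2; push_cast; ring
  · have hfm : ∀ i, MemLp (fun x => halfWeight φ x * del 1 (e i) χ x) 2 := fun i =>
      (hχ.del 1 (e i)).memLp_mul hbc
    set f := lpForm (fun i x => halfWeight φ x * del 1 (e i) χ x) hfm with hf
    have hfZ : f ∈ Z := by
      rw [Submodule.mem_orthogonal]
      intro u hu
      induction hu using Submodule.span_induction with
      | mem u hu =>
        obtain ⟨κ, hκ, j, k, rfl⟩ := hu
        rw [inner_lpForm]
        have e1 : ∀ᵐ x, ∑ i, conj (m κ j k i x) * f x i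
            = del 1 (e k) χ x * del 1 (e j) κ x - del 1 (e j) χ x * del 1 (e k) κ x := by
          filter_upwards [(memLp_toLp hfm).coeFn_toLp] with x hx
          have hx' : ∀ i, f x i = halfWeight φ x * del 1 (e i) χ x := by
            intro i
            rw [hf]
            change (((memLp_toLp hfm).toLp _ : Lp (EuclideanSpace ℂ ι) 2 (volume : Measure V)) x) i = _
            rw [hx]
          rw [m_inner κ j k x (fun i => f x i), hx', hx']
          have := hbp x
          linear_combination (del 1 (e k) χ x * del 1 (e j) κ x
            - del 1 (e j) χ x * del 1 (e k) κ x) * this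
        rw [integral_congr_ae e1, integral_sub
          ((hκ.del 1 (e j)).mul_left (contDiff_del hχ.contDiff)).integrable
          ((hκ.del 1 (e k)).mul_left (contDiff_del hχ.contDiff)).integrable,
          integral_mul_del (contDiff_del hχ.contDiff) hκ,
          integral_mul_del (contDiff_del hχ.contDiff) hκ]
        simp only [del_comm (v := e j) (w := e k) hχ.contDiff, sub_self]
      | zero => simp
      | add u v _ _ hu hv => rw [inner_add_left, hu, hv, add_zero]
      | smul a u _ hu => rw [inner_smul_left, hu, mul_zero]
    have h1 : inner ℂ f F = inner ℂ f g := by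
      rw [hF, ← Submodule.inner_starProjection_left_eq_right,
        Submodule.starProjection_eq_self_iff.mpr hfZ]
    rw [hf, inner_lpForm, inner_lpForm] at h1
    have e2 : ∀ᵐ x, ∑ i, conj (halfWeight φ x * del 1 (e i) χ x) * g x i
        = ∑ i, conj (del 1 (e i) χ x) * h i x := by
      filter_upwards [(memLp_toLp hgm).coeFn_toLp] with x hx
      refine Finset.sum_congr rfl fun i _ => ?_
      change _ * (((memLp_toLp hgm).toLp _ : Lp (EuclideanSpace ℂ ι) 2 (volume : Measure V)) x) i = _
      rw [hx, map_mul, hbconj]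
      change _ * (p x * h i x) = _
      linear_combination conj (del 1 (e i) χ x) * h i x * hbp x
    rw [integral_congr_ae e2] at h1
    rw [← h1]
    congr 1; ext x
    refine Finset.sum_congr rfl fun i _ => ?_
    rw [map_mul, hbconj, ← hbb]
    linear_combination halfWeight φ x * conj (del 1 (e i) χ x) * F x i * hbp x

end Projection

section Cutoff

variable {V : Type*} [NormedAddCommGroup V] [InnerProductSpace ℂ V]
  [FiniteDimensional ℂ V] [MeasureSpace V] [BorelSpace V]
  [(volume : Measure V).IsAddHaarMeasure]

variable {ι : Type*} [Fintype ι] {e : ι → V} {φ : V → ℝ} {W : Set V} {G : ι → V → ℂ} {d : V → ℂ}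

/-- The squared length of the `∂̄`-gradient of a real function in the frame `e`. -/
def gradSq (e : ι → V) (η : V → ℝ) (x : V) : ℝ := ∑ i, ‖del 1 (e i) (toC η) x‖ ^ 2

theorem gradSq_eq {η : V → ℝ} (hη : ContDiff ℝ ∞ η) (x : V) :
    gradSq e η x = ∑ i, ‖del (-1) (e i) (toC η) x‖ ^ 2 := by
  unfold gradSq
  refine Finset.sum_congr rfl fun i _ => ?_
  rw [← del_toC_conj hη, Complex.norm_conj]

theorem continuous_gradSq {η : V → ℝ} (hη : ContDiff ℝ ∞ η) : Continuous (gradSq e η) :=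
  continuous_finsetSum _ fun _ _ => (contDiff_del (contDiff_toC hη)).continuous.norm.pow 2

theorem gradSq_nonneg (η : V → ℝ) (x : V) : 0 ≤ gradSq e η x :=
  Finset.sum_nonneg fun _ _ => by positivity

theorem hasCompactSupport_gradSq {η : V → ℝ} (hη : IsTest W (toC η)) :
    HasCompactSupport (gradSq e η) := by
  refine hη.compact.mono' fun x hx => ?_
  by_contra h
  exact hx (by simp [gradSq, del_eq_zero_of_notMem h])

theorem locL2 (hφ : Continuous φ) (hG : ∀ i, MemLp (fun x => halfWeight φ x * G i x) 2)
    {c : V → ℂ} (hc : Continuous c) (hcs : HasCompactSupport c) (i : ι) :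
    MemLp (fun x => c x * G i x) 2 := by
  have hp : Continuous fun x => c x * (Real.exp (φ x / 2) : ℂ) := by fun_prop
  obtain ⟨C, hC⟩ := (hcs.mul_right (f' := fun x => (Real.exp (φ x / 2) : ℂ))).exists_bound_of_continuous hp
  have e1 : (fun x => c x * G i x)
      = fun x => (c x * (Real.exp (φ x / 2) : ℂ)) * (halfWeight φ x * G i x) := by
    ext x
    have : (Real.exp (φ x / 2) : ℂ) * halfWeight φ x = 1 := by
      simp only [halfWeight, ← Complex.ofReal_mul, ← Real.exp_add]; simp
    linear_combination -(c x * G i x) * this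
  rw [e1]
  refine (hG i).of_le_mul (c := C) (hp.aestronglyMeasurable.mul (hG i).1)
    (Eventually.of_forall fun x => ?_)
  rw [norm_mul]
  exact mul_le_mul_of_nonneg_right (hC x) (norm_nonneg _)

theorem integrable_weighted (hG : ∀ i, MemLp (fun x => halfWeight φ x * G i x) 2)
    {c : V → ℝ} (hc : Continuous c) {C : ℝ} (hC : ∀ x, ‖c x‖ ≤ C) :
    Integrable fun x => c x * (∑ i, ‖G i x‖ ^ 2) * expNeg φ x := by
  have h := Integrable.bdd_mul (integrable_finsetSum Finset.univ fun i _ => integrable_norm_sq (hG i))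
    hc.aestronglyMeasurable (Eventually.of_forall hC)
  refine h.congr (Eventually.of_forall fun x => ?_)
  simp only [norm_halfWeight_mul_sq, ← Finset.sum_mul]
  ring

theorem norm_sum_mul_sq_le (a b : ι → ℂ) :
    ‖∑ i, a i * b i‖ ^ 2 ≤ (∑ i, ‖a i‖ ^ 2) * ∑ i, ‖b i‖ ^ 2 := by
  calc ‖∑ i, a i * b i‖ ^ 2 ≤ (∑ i, ‖a i‖ * ‖b i‖) ^ 2 := by
        gcongr
        exact (norm_sum_le _ _).trans (le_of_eq (by simp))
    _ ≤ _ := Finset.sum_mul_sq_le_sq_mul_sq _ _ _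

theorem sum_norm_cross_sq_le (a b : ι → ℂ) :
    ∑ j, ∑ k, ‖b k * a j - b j * a k‖ ^ 2 ≤ 4 * ((∑ i, ‖a i‖ ^ 2) * ∑ i, ‖b i‖ ^ 2) := by
  have h : ∀ j k, ‖b k * a j - b j * a k‖ ^ 2
      ≤ 2 * (‖a j‖ ^ 2 * ‖b k‖ ^ 2) + 2 * (‖b j‖ ^ 2 * ‖a k‖ ^ 2) := by
    intro j k
    have h1 := norm_sub_le (b k * a j) (b j * a k)
    rw [norm_mul, norm_mul] at h1
    have h2 := norm_nonneg (b k * a j - b j * a k)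
    nlinarith [sq_nonneg (‖b k‖ * ‖a j‖ - ‖b j‖ * ‖a k‖)]
  calc _ ≤ ∑ j, ∑ k, (2 * (‖a j‖ ^ 2 * ‖b k‖ ^ 2) + 2 * (‖b j‖ ^ 2 * ‖a k‖ ^ 2)) :=
        Finset.sum_le_sum fun j _ => Finset.sum_le_sum fun k _ => h j k
    _ = _ := by
        simp only [Finset.sum_add_distrib, ← Finset.mul_sum, ← Finset.sum_mul]
        ring

/-- The a priori estimate for a weakly `∂̄`-closed form `G` with `∂̄* G` prescribed, cut off by
`η`. -/
theorem cutoff_estimate (hφ : ContDiff ℝ ∞ φ) (hW : IsOpen W)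
    (hG : ∀ i, MemLp (fun x => halfWeight φ x * G i x) 2)
    (hclosed : ∀ j k κ, IsTest W κ →
        ∫ x, (G k x * del 1 (e j) κ x - G j x * del 1 (e k) κ x) = 0)
    (hd : IsTest W d)
    (hweak : ∀ κ, IsTest W κ → ∫ x, (∑ i, G i x * del (-1) (e i) κ x) * (expNeg φ x : ℂ)
      = - ∫ x, d x * κ x)
    {η : V → ℝ} (hη : ContDiff ℝ ∞ η) (hηt : IsTest W (toC η))
    (hη1 : ∀ x, d x ≠ 0 → η x = 1 ∧ ∀ i, del (-1) (e i) (toC η) x = 0)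
    {m : V → ℝ} (hm : Continuous m) (hm0 : ∀ x, 0 ≤ m x)
    (hlevi : ∀ x ∈ W, ∀ ξ : ι → ℂ, m x * ∑ i, ‖ξ i‖ ^ 2 ≤ (leviForm e φ x ξ).re) :
    ∫ x, (m x * η x ^ 2) * (∑ i, ‖G i x‖ ^ 2) * expNeg φ x
      ≤ (∫ x, ‖d x‖ ^ 2 * Real.exp (φ x))
        + 5 * ∫ x, gradSq e η x * (∑ i, ‖G i x‖ ^ 2) * expNeg φ x := by
  have hL : ∀ {c : V → ℂ}, Continuous c → HasCompactSupport c → ∀ i,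
      MemLp (fun x => c x * G i x) 2 := fun hc hcs i => locL2 hφ.continuous hG hc hcs i
  have hI : ∀ {c κ : V → ℂ}, Continuous c → HasCompactSupport c → IsTest univ κ → ∀ i,
      Integrable fun x => (c x * G i x) * κ x := fun hc hcs hκ i =>
    (hL hc hcs i).integrable_mul 
      (hκ.continuous.memLp_of_hasCompactSupport hκ.compact : MemLp _ 2)
  have hηc := hηt.continuous
  have hdη := fun (σ : ℂ) i => hηt.del σ (e i)
  have hdφ := fun (σ : ℂ) i => contDiff_del (σ := σ) (v := e i) (contDiff_toC hφ)
  set K := tsupport (toC η) with hKdef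
  have hKz : ∀ x ∉ K, toC η x = 0 := fun x hx => image_eq_zero_of_notMem_tsupport hx
  have hKd : ∀ x ∉ K, ∀ σ i, del σ (e i) (toC η) x = 0 := fun x hx σ i => del_eq_zero_of_notMem hx
  set q : V → ℂ := fun x => (Real.exp (φ x) : ℂ) with hq
  have hqs : ContDiff ℝ ∞ q := by
    have := contDiff_toC (Real.contDiff_exp.comp hφ)
    exact this
  have hqe : ∀ x, q x * (expNeg φ x : ℂ) = 1 := by
    intro x
    simp only [hq, expNeg, ← Complex.ofReal_mul, ← Real.exp_add]; simp
  have hdq : ∀ σ i x, del σ (e i) q x = del σ (e i) (toC φ) x * q x := by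
    intro σ i x
    have h0 : q = toC (expNeg (fun y => - φ y)) := by ext y; simp [hq, toC, expNeg]
    rw [h0, del_toC_expNeg hφ.neg]
    have h1 : toC (fun y => - φ y) = fun y => (-1 : ℂ) * toC φ y := by ext y; simp [toC]
    rw [h1, del_const_mul _ ((contDiff_toC hφ).differentiableAt_infty x)]
    ring
  let D : V → ℂ := fun x => toC η x * q x * d x + ∑ i, del (-1) (e i) (toC η) x * G i x
    + ∑ i, (toC η x * del (-1) (e i) (toC φ) x) * G i x
  have hDL : MemLp D 2 := by
    refine MemLp.add (MemLp.add ?_ (memLp_finsetSum _ fun i _ => ?_)) (memLp_finsetSum _ fun i _ => ?_)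
    · exact hd.memLp_mul (hηc.mul hqs.continuous)
    · exact hL (hdη _ i).continuous (hdη _ i).compact i
    · exact hL (hηc.mul (hdφ _ i).continuous) hηt.compact.mul_right i
  have est := weak_estimate (e := e) hφ (K := K) hW hηt.compact hηt.subset
    (G := fun i x => toC η x * G i x) (D := D)
    (R := fun j k x => del 1 (e j) (toC η) x * G k x - del 1 (e k) (toC η) x * G j x)
    (fun i => hL hηc hηt.compact i) hDL
    (fun j k => (hL (hdη _ j).continuous (hdη _ j).compact k).sub
      (hL (hdη _ k).continuous (hdη _ k).compact j))
    (fun i x hx => by simp [hKz x hx])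
    (fun x hx => by simp [D, hKz x hx, hKd x hx])
    (fun j k x hx => by simp [hKd x hx]) ?_ ?_ hm hm0 hlevi
  · have b1 : Integrable fun x => ‖d x‖ ^ 2 * Real.exp (φ x) := by
      refine Continuous.integrable_of_hasCompactSupport ?_ (HasCompactSupport.mul_right ?_)
      · exact (hd.continuous.norm.pow 2).mul (Real.continuous_exp.comp hφ.continuous)
      · exact hd.compact.comp_left (g := fun z : ℂ => ‖z‖ ^ 2) (by simp)
    obtain ⟨C, hC⟩ := (hasCompactSupport_gradSq (e := e) hηt).exists_bound_of_continuous
      (continuous_gradSq hη)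
    have b2 := integrable_weighted hG (continuous_gradSq (e := e) hη) hC
    refine (le_of_eq ?_).trans (est.trans ?_)
    · congr 1; ext x
      simp only [norm_mul, mul_pow, toC, Complex.norm_real, Real.norm_eq_abs, sq_abs,
        ← Finset.mul_sum]
      ring
    · rw [show (5 : ℝ) = 1 + 4 by norm_num, add_mul, one_mul, ← add_assoc, ← integral_add b1 b2,
        ← integral_const_mul]
      refine add_le_add ?_ ?_
      · refine integral_mono_of_nonneg (Eventually.of_forall fun x => ?_) (b1.add b2)
          (Eventually.of_forall fun x => ?_)
        · have := (expNeg_pos (φ := φ) x).le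
          positivity
        · have e1 : D x - ∑ i, del (-1) (e i) (toC φ) x * (toC η x * G i x)
              = toC η x * q x * d x + ∑ i, del (-1) (e i) (toC η) x * G i x := by
            simp only [D]
            rw [add_sub_assoc, ← Finset.sum_sub_distrib]
            simp only [show ∀ i, toC η x * del (-1) (e i) (toC φ) x * G i x
              - del (-1) (e i) (toC φ) x * (toC η x * G i x) = 0 from fun i => by ring,
              Finset.sum_const_zero, add_zero]
          have hpos := (expNeg_pos (φ := φ) x).le
          dsimp only
          rw [e1]
          by_cases hx : d x = 0
          · rw [hx, mul_zero, zero_add]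
            have := norm_sum_mul_sq_le (fun i => del (-1) (e i) (toC η) x) (fun i => G i x)
            rw [← gradSq_eq hη] at this
            simpa using mul_le_mul_of_nonneg_right this hpos
          · obtain ⟨h1, h2⟩ := hη1 x hx
            have : toC η x = 1 := by simp [toC, h1]
            simp only [h2, zero_mul, Finset.sum_const_zero, add_zero, this, one_mul]
            rw [norm_mul, mul_pow, hq, Complex.norm_real, Real.norm_of_nonneg (Real.exp_pos _).le]
            have h3 : Real.exp (φ x) * expNeg φ x = 1 := by
              rw [expNeg, ← Real.exp_add]; simp
            have h4 : 0 ≤ gradSq e η x * (∑ i, ‖G i x‖ ^ 2) * expNeg φ x :=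
              mul_nonneg (mul_nonneg (gradSq_nonneg _ _)
                (Finset.sum_nonneg fun _ _ => by positivity)) hpos
            calc Real.exp (φ x) ^ 2 * ‖d x‖ ^ 2 * expNeg φ x
                = ‖d x‖ ^ 2 * Real.exp (φ x) * (Real.exp (φ x) * expNeg φ x) := by ring
              _ ≤ _ := by rw [h3]; linarith
      · refine integral_mono_of_nonneg (Eventually.of_forall fun x => ?_) (b2.const_mul 4)
          (Eventually.of_forall fun x => ?_)
        · exact mul_nonneg (Finset.sum_nonneg fun _ _ => Finset.sum_nonneg fun _ _ => by positivity)
            (expNeg_pos x).le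
        · have := sum_norm_cross_sq_le (fun i => del 1 (e i) (toC η) x) (fun i => G i x)
          have := mul_le_mul_of_nonneg_right this (expNeg_pos (φ := φ) x).le
          simp only [mul_comm (del 1 _ _ _)]
          refine this.trans (le_of_eq ?_)
          simp only [gradSq]; ring
  · intro κ hκ
    have ht : IsTest W (fun x => κ x * (q x * toC η x)) := (hηt.mul_left hqs).mul_left hκ.contDiff
    have h1 := hweak _ ht
    have i1 : ∀ i, Integrable fun x => toC η x * G i x * del (-1) (e i) κ x := fun i =>
      hI hηc hηt.compact (hκ.del _ _) i
    have i2 : Integrable fun x => ∑ i, toC η x * G i x * del (-1) (e i) κ x :=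
      integrable_finsetSum _ fun i _ => i1 i
    have i3 : Integrable fun x => (∑ i, del (-1) (e i) (toC η) x * G i x
        + ∑ i, (toC η x * del (-1) (e i) (toC φ) x) * G i x) * κ x := by
      simp only [add_mul, Finset.sum_mul]
      exact (integrable_finsetSum _ fun i _ => hI (hdη _ i).continuous (hdη _ i).compact hκ i).add
        (integrable_finsetSum _ fun i _ => hI (hηc.mul (hdφ _ i).continuous)
          hηt.compact.mul_right hκ i)
    have i4 : Integrable fun x => d x * (κ x * (q x * toC η x)) :=
      (ht.mul_left hd.contDiff).integrable
    have e1 : ∀ x, (∑ i, G i x * del (-1) (e i) (fun x => κ x * (q x * toC η x)) x)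
          * (expNeg φ x : ℂ)
        = ∑ i, toC η x * G i x * del (-1) (e i) κ x
          + (∑ i, del (-1) (e i) (toC η) x * G i x
            + ∑ i, (toC η x * del (-1) (e i) (toC φ) x) * G i x) * κ x := by
      intro x
      rw [← Finset.sum_add_distrib, Finset.sum_mul, Finset.sum_mul, ← Finset.sum_add_distrib]
      refine Finset.sum_congr rfl fun i _ => ?_
      rw [del_mul (hκ.differentiableAt x) ((hηt.mul_left hqs).differentiableAt x),
        del_mul (hqs.differentiableAt_infty x) (hηt.differentiableAt x), hdq]
      linear_combination G i x * (κ x * (del (-1) (e i) (toC η) x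
        + del (-1) (e i) (toC φ) x * toC η x) + del (-1) (e i) κ x * toC η x) * hqe x
    simp only [e1] at h1
    rw [integral_add i2 i3] at h1
    have e2 : ∫ x, D x * κ x = (∫ x, d x * (κ x * (q x * toC η x)))
        + ∫ x, (∑ i, del (-1) (e i) (toC η) x * G i x
        + ∑ i, (toC η x * del (-1) (e i) (toC φ) x) * G i x) * κ x := by
      rw [← integral_add i4 i3]
      congr 1; ext x
      simp only [D]; ring
    rw [e2]
    linear_combination h1
  · intro j k κ hκ
    have h1 := hclosed j k _ (hηt.mul_left hκ.contDiff)
    have i1 := (hI hηc hηt.compact (hκ.del 1 (e j)) k).sub (hI hηc hηt.compact (hκ.del 1 (e k)) j)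
    have i2 := (hI (hdη 1 j).continuous (hdη 1 j).compact hκ k).sub
      (hI (hdη 1 k).continuous (hdη 1 k).compact hκ j)
    have h2 := integral_add i1 i2
    rw [eq_neg_iff_add_eq_zero, ← h1]
    simp only [sub_mul]
    refine Eq.trans h2.symm ?_
    congr 1; ext x
    simp only [Pi.sub_apply]
    rw [del_mul (hκ.differentiableAt x) (hηt.differentiableAt x),
      del_mul (hκ.differentiableAt x) (hηt.differentiableAt x)]
    ring

end Cutoff

section Shell

variable {V : Type*} [NormedAddCommGroup V] [InnerProductSpace ℂ V]
  [FiniteDimensional ℂ V] [MeasureSpace V] [BorelSpace V]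
  [(volume : Measure V).IsAddHaarMeasure]

variable {ι : Type*} [Fintype ι] {e : ι → V}

theorem norm_integral_sum_conj_mul_sq_le {u v : ι → V → ℂ} (hu : ∀ i, MemLp (u i) 2)
    (hv : ∀ i, MemLp (v i) 2) :
    ‖∫ x, ∑ i, conj (u i x) * v i x‖ ^ 2
      ≤ (∫ x, ∑ i, ‖u i x‖ ^ 2) * ∫ x, ∑ i, ‖v i x‖ ^ 2 := by
  have h : ∫ x, ∑ i, conj (u i x) * v i x = inner ℂ (lpForm u hu) (lpForm v hv) := by
    rw [inner_lpForm]
    refine integral_congr_ae ?_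
    filter_upwards [(memLp_toLp hv).coeFn_toLp] with x hx
    refine Finset.sum_congr rfl fun i _ => ?_
    change _ = _ * (((memLp_toLp hv).toLp _ : Lp (EuclideanSpace ℂ ι) 2 (volume : Measure V)) x) i
    rw [hx]
  rw [h, ← norm_lpForm_sq, ← norm_lpForm_sq, ← mul_pow]
  gcongr
  exact norm_inner_le_norm _ _

theorem leviForm_add_const_mul {ψ Λ : V → ℝ} (hψ : ContDiff ℝ ∞ ψ) (hΛ : ContDiff ℝ ∞ Λ) (M : ℝ)
    (x : V) (ξ : ι → ℂ) :
    leviForm e (fun y => ψ y + M * Λ y) x ξ = leviForm e ψ x ξ + M * leviForm e Λ x ξ := by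
  have h1 : toC (fun y => ψ y + M * Λ y) = fun y => toC ψ y + (M : ℂ) * toC Λ y := by
    ext y; simp [toC]
  have hψ' := contDiff_toC hψ
  have hΛ' := contDiff_toC hΛ
  have h2 : ∀ j, del (-1) (e j) (toC fun y => ψ y + M * Λ y)
      = fun y => del (-1) (e j) (toC ψ) y + (M : ℂ) * del (-1) (e j) (toC Λ) y := by
    intro j; ext y
    rw [h1, del_add (hψ'.differentiableAt_infty y)
      ((hΛ'.differentiableAt_infty y).const_mul _), del_const_mul _ (hΛ'.differentiableAt_infty y)]
  have h3 : ∀ j k, del 1 (e k) (del (-1) (e j) (toC fun y => ψ y + M * Λ y)) x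
      = del 1 (e k) (del (-1) (e j) (toC ψ)) x
        + (M : ℂ) * del 1 (e k) (del (-1) (e j) (toC Λ)) x := by
    intro j k
    rw [h2, del_add ((contDiff_del hψ').differentiableAt_infty x)
      (((contDiff_del hΛ').differentiableAt_infty x).const_mul _),
      del_const_mul _ ((contDiff_del hΛ').differentiableAt_infty x)]
  simp only [leviForm, h3, Finset.mul_sum, ← Finset.sum_add_distrib]
  refine Finset.sum_congr rfl fun j _ => Finset.sum_congr rfl fun k _ => ?_
  ring

/-- The basic estimate on `O` for the weight `ψ`, obtained by adding to `ψ` large multiples of a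
plurisubharmonic function vanishing on `O`. -/
theorem basic_estimate {ψ Λ τ η₀ η₁ : V → ℝ} (hψ : ContDiff ℝ ∞ ψ) (hΛ : ContDiff ℝ ∞ Λ)
    {W O : Set V} (hW : IsOpen W) (hO : IsOpen O) (hOW : O ⊆ W)
    (hτ : Continuous τ) (hτ0 : ∀ x, 0 ≤ τ x)
    (hψL : ∀ x ∈ W, ∀ ξ : ι → ℂ, ∑ i, ‖ξ i‖ ^ 2 ≤ (leviForm e ψ x ξ).re)
    (hΛL : ∀ x ∈ W, ∀ ξ : ι → ℂ, τ x * ∑ i, ‖ξ i‖ ^ 2 ≤ (leviForm e Λ x ξ).re)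
    (hη₀ : ContDiff ℝ ∞ η₀) (hη₁ : ContDiff ℝ ∞ η₁)
    (hη₀t : IsTest W (toC η₀)) (hη₁t : IsTest W (toC η₁))
    (hη₀O : ∀ x ∈ O, η₀ x = 1) (hη₁O : ∀ x ∈ O, η₁ x = 1) (hΛO : ∀ x ∈ O, Λ x = 0)
    {C₀ : ℝ} (hC₀ : 0 ≤ C₀) (hshell : ∀ x, gradSq e η₀ x ≤ C₀ * (τ x * η₁ x ^ 2))
    {χ : V → ℂ} (hχ : IsTest O χ) {h : ι → V → ℂ} (hh : ∀ i, IsTest O (h i)) :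
    ‖∫ x, ∑ i, conj (del 1 (e i) χ x) * h i x‖ ^ 2
      ≤ (∫ x, (∑ i, ‖del 1 (e i) χ x‖ ^ 2) * expNeg ψ x)
        * ∫ x, ‖∑ i, del (-1) (e i) (h i) x‖ ^ 2 * Real.exp (ψ x) := by
  set d : V → ℂ := fun x => ∑ i, del (-1) (e i) (h i) x with hd_def
  have hd : IsTest O d := by
    have : ∀ s : Finset ι, IsTest O fun x => ∑ i ∈ s, del (-1) (e i) (h i) x := by
      intro s
      classical
      induction s using Finset.induction_on with
      | empty => simpa using IsTest.zero
      | insert a s ha ih => simpa [Finset.sum_insert ha] using ((hh a).del (-1) (e a)).add ih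
    exact this _
  have out : ∀ {k : V → ℂ}, IsTest O k → ∀ x ∉ O, k x = 0 := fun hk x hx =>
    image_eq_zero_of_notMem_tsupport fun h => hx (hk.subset h)
  have cutoff : ∀ {η : V → ℝ}, (∀ x ∈ O, η x = 1) →
      ∀ x, d x ≠ 0 → η x = 1 ∧ ∀ i, del (-1) (e i) (toC η) x = 0 := by
    intro η hη x hx
    have hxO : x ∈ O := by by_contra hn; exact hx (out hd x hn)
    refine ⟨hη x hxO, fun i => ?_⟩
    have : toC η =ᶠ[𝓝 x] fun _ => 1 := by
      filter_upwards [hO.mem_nhds hxO] with y hy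
      simp [toC, hη y hy]
    rw [del_congr this, del_const]
  set A := ∫ x, ‖d x‖ ^ 2 * Real.exp (ψ x) with hA
  set B := ∫ x, (∑ i, ‖h i x‖ ^ 2) * Real.exp (ψ x) with hB
  set F := ∫ x, (∑ i, ‖del 1 (e i) χ x‖ ^ 2) * expNeg ψ x with hF
  obtain ⟨C₁, hC₁⟩ := (hasCompactSupport_gradSq (e := e) hη₁t).exists_bound_of_continuous
    (continuous_gradSq hη₁)
  have hC₁0 : 0 ≤ C₁ := (norm_nonneg _).trans (hC₁ 0)
  have hA0 : 0 ≤ A := integral_nonneg fun x => by positivity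
  have hB0 : 0 ≤ B := integral_nonneg fun x => by positivity
  have hF0 : 0 ≤ F := integral_nonneg fun x =>
    mul_nonneg (Finset.sum_nonneg fun _ _ => by positivity) (expNeg_pos x).le
  have main : ∀ M : ℝ, 0 < M → ‖∫ x, ∑ i, conj (del 1 (e i) χ x) * h i x‖ ^ 2
      ≤ F * (A + 5 * (C₀ * ((A + 5 * (C₁ * B)) / M))) := by
    intro M hM
    set φ : V → ℝ := fun y => ψ y + M * Λ y with hφdef
    have hφ : ContDiff ℝ ∞ φ := hψ.add (contDiff_const.mul hΛ)
    have hφO : ∀ x ∈ O, φ x = ψ x := fun x hx => by simp [hφdef, hΛO x hx]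
    obtain ⟨G, hG, hclosed, hGB, hGf⟩ := exists_projection hφ e (W := W) fun i => (hh i).mono hOW
    have hweak : ∀ κ, IsTest W κ → ∫ x, (∑ i, G i x * del (-1) (e i) κ x) * (expNeg φ x : ℂ)
        = - ∫ x, d x * κ x := by
      intro κ hκ
      have h1 := hGf _ hκ.star
      have h2 : ∀ i x, conj (del 1 (e i) (fun x => conj (κ x)) x) = del (-1) (e i) κ x := by
        intro i x
        rw [del_conj (hκ.differentiableAt x)]; simp
      simp only [h2] at h1
      calc _ = ∫ x, ∑ i, del (-1) (e i) κ x * G i x * (expNeg φ x : ℂ) := by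
            congr 1; ext x
            rw [Finset.sum_mul]
            exact Finset.sum_congr rfl fun i _ => by ring
        _ = ∑ i, ∫ x, h i x * del (-1) (e i) κ x := by
            rw [h1, ← integral_finsetSum _ fun i _ =>
              ((hκ.del (-1) (e i)).mul_left (hh i).contDiff).integrable]
            congr 1; ext x
            exact Finset.sum_congr rfl fun i _ => by ring
        _ = ∑ i, - ∫ x, del (-1) (e i) (h i) x * κ x :=
            Finset.sum_congr rfl fun i _ => integral_mul_del (hh i).contDiff hκ
        _ = _ := by
            rw [Finset.sum_neg_distrib, ← integral_finsetSum _ fun i _ =>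
              (hκ.mul_left (contDiff_del (hh i).contDiff)).integrable]
            simp only [hd_def, Finset.sum_mul]
    set m : V → ℝ := fun x => 1 + M * τ x with hm
    have hmc : Continuous m := by fun_prop
    have hm0 : ∀ x, 0 ≤ m x := fun x => by have := mul_nonneg hM.le (hτ0 x); simp only [hm]; linarith
    have hlevi : ∀ x ∈ W, ∀ ξ : ι → ℂ, m x * ∑ i, ‖ξ i‖ ^ 2 ≤ (leviForm e φ x ξ).re := by
      intro x hx ξ
      have h1 := hψL x hx ξ
      have h2 := mul_le_mul_of_nonneg_left (hΛL x hx ξ) hM.le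
      rw [hφdef, leviForm_add_const_mul hψ hΛ, Complex.add_re, Complex.re_ofReal_mul]
      simp only [hm]; linarith
    have E₀ := cutoff_estimate hφ hW hG hclosed (hd.mono hOW) hweak hη₀ hη₀t (cutoff hη₀O) hmc hm0
      hlevi
    have E₁ := cutoff_estimate hφ hW hG hclosed (hd.mono hOW) hweak hη₁ hη₁t (cutoff hη₁O) hmc hm0
      hlevi
    have eA : ∫ x, ‖d x‖ ^ 2 * Real.exp (φ x) = A := by
      rw [hA]; congr 1; ext x
      by_cases hx : x ∈ O
      · rw [hφO x hx]
      · simp [out hd x hx]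
    have eB : ∫ x, (∑ i, ‖h i x‖ ^ 2) * Real.exp (φ x) = B := by
      rw [hB]; congr 1; ext x
      by_cases hx : x ∈ O
      · rw [hφO x hx]
      · simp [out (hh _) x hx]
    rw [eA] at E₀ E₁
    rw [eB] at hGB
    have bdd : ∀ {c : V → ℝ}, Continuous c → HasCompactSupport c → ∃ C, ∀ x, ‖c x‖ ≤ C :=
      fun hc hs => hs.exists_bound_of_continuous hc
    have cs : ∀ {η : V → ℝ} (k : V → ℝ), IsTest W (toC η) →
        HasCompactSupport fun x => k x * η x ^ 2 := by
      intro η k hη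
      refine hη.compact.mono fun x hx hn => hx ?_
      have : η x = 0 := by simpa [toC] using hn
      simp [this]
    have I : ∀ {c : V → ℝ}, Continuous c → HasCompactSupport c →
        Integrable fun x => c x * (∑ i, ‖G i x‖ ^ 2) * expNeg φ x := fun hc hs =>
      (bdd hc hs).elim fun _ hC => integrable_weighted hG hc hC
    have mono : ∀ {c c' : V → ℝ}, Continuous c → HasCompactSupport c → Continuous c' →
        HasCompactSupport c' → (∀ x, c x ≤ c' x) →
        ∫ x, c x * (∑ i, ‖G i x‖ ^ 2) * expNeg φ x ≤ ∫ x, c' x * (∑ i, ‖G i x‖ ^ 2) * expNeg φ x :=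
      fun hc hs hc' hs' hle => integral_mono (I hc hs) (I hc' hs') fun x =>
        mul_le_mul_of_nonneg_right (mul_le_mul_of_nonneg_right (hle x)
          (Finset.sum_nonneg fun _ _ => by positivity)) (expNeg_pos x).le
    have hηc₀ := hη₀.continuous
    have hηc₁ := hη₁.continuous
    have s1 : ∫ x, gradSq e η₁ x * (∑ i, ‖G i x‖ ^ 2) * expNeg φ x ≤ C₁ * B := by
      refine le_trans ?_ (mul_le_mul_of_nonneg_left hGB hC₁0)
      rw [← integral_const_mul]
      have h1 := integrable_weighted hG (continuous_const (y := (1 : ℝ))) (C := 1) (by simp)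
      simp only [one_mul] at h1
      refine integral_mono (I (continuous_gradSq hη₁) (hasCompactSupport_gradSq hη₁t))
        (h1.const_mul _) fun x => ?_
      simp only [mul_assoc]
      refine mul_le_mul_of_nonneg_right ((le_abs_self _).trans (hC₁ x))
        (mul_nonneg (Finset.sum_nonneg fun _ _ => by positivity) (expNeg_pos x).le)
    have s2 : M * ∫ x, (τ x * η₁ x ^ 2) * (∑ i, ‖G i x‖ ^ 2) * expNeg φ x ≤ A + 5 * (C₁ * B) := by
      refine le_trans ?_ (E₁.trans (by linarith))
      rw [← integral_const_mul]
      have := mono (c := fun x => (M * τ x) * η₁ x ^ 2) (c' := fun x => m x * η₁ x ^ 2)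
        (by fun_prop) (cs _ hη₁t) (by fun_prop) (cs _ hη₁t) (fun x => by
          simp only [hm]; nlinarith [sq_nonneg (η₁ x)])
      simpa only [mul_assoc] using this
    have s3 : ∫ x, gradSq e η₀ x * (∑ i, ‖G i x‖ ^ 2) * expNeg φ x
        ≤ C₀ * ((A + 5 * (C₁ * B)) / M) := by
      have h1 := mono (c := gradSq e η₀) (c' := fun x => (C₀ * τ x) * η₁ x ^ 2)
        (continuous_gradSq hη₀) (hasCompactSupport_gradSq hη₀t) (by fun_prop) (cs _ hη₁t)
        (fun x => by rw [mul_assoc]; exact hshell x)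
      refine h1.trans ?_
      have h2 : ∫ x, (τ x * η₁ x ^ 2) * (∑ i, ‖G i x‖ ^ 2) * expNeg φ x
          ≤ (A + 5 * (C₁ * B)) / M := by rw [le_div_iff₀ hM]; linarith
      refine le_trans (le_of_eq ?_) (mul_le_mul_of_nonneg_left h2 hC₀)
      rw [← integral_const_mul]
      simp only [mul_assoc]
    have s4 : ∫ x, (1 * η₀ x ^ 2) * (∑ i, ‖G i x‖ ^ 2) * expNeg φ x
        ≤ A + 5 * (C₀ * ((A + 5 * (C₁ * B)) / M)) := by
      refine (mono (c' := fun x => m x * η₀ x ^ 2) (by fun_prop) (cs _ hη₀t) (by fun_prop)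
        (cs _ hη₀t) fun x => ?_).trans (E₀.trans (by linarith))
      have := mul_nonneg hM.le (hτ0 x)
      simp only [hm]
      nlinarith [sq_nonneg (η₀ x)]
    rw [← hGf χ (hχ.mono hOW)]
    have hbc := continuous_halfWeight hφ.continuous
    have hbconj : ∀ x, conj (halfWeight φ x) = halfWeight φ x := fun x => Complex.conj_ofReal _
    have hbb : ∀ x, halfWeight φ x * halfWeight φ x = (expNeg φ x : ℂ) := by
      intro x
      simp only [halfWeight, expNeg, ← Complex.ofReal_mul, ← Real.exp_add]; ring_nf
    have hηG : ∀ i, MemLp (fun x => (halfWeight φ x * toC η₀ x) * G i x) 2 := fun i =>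
      locL2 hφ.continuous hG (hbc.mul hη₀t.continuous) hη₀t.compact.mul_left i
    have CS := norm_integral_sum_conj_mul_sq_le
      (fun i => (hχ.del 1 (e i)).memLp_mul hbc) hηG
    have t1 : ∫ x, ∑ i, conj (halfWeight φ x * del 1 (e i) χ x)
          * (halfWeight φ x * toC η₀ x * G i x)
        = ∫ x, ∑ i, conj (del 1 (e i) χ x) * G i x * (expNeg φ x : ℂ) := by
      congr 1; ext x
      refine Finset.sum_congr rfl fun i _ => ?_
      by_cases hx : x ∈ O
      · have : toC η₀ x = 1 := by simp [toC, hη₀O x hx]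
        rw [this, map_mul, hbconj, ← hbb]; ring
      · simp [out (hχ.del 1 (e i)) x hx]
    have t2 : ∫ x, ∑ i, ‖halfWeight φ x * del 1 (e i) χ x‖ ^ 2 = F := by
      rw [hF]; congr 1; ext x
      rw [Finset.sum_mul]
      refine Finset.sum_congr rfl fun i _ => ?_
      rw [norm_halfWeight_mul_sq]
      by_cases hx : x ∈ O
      · simp only [expNeg, hφO x hx]
      · simp [out (hχ.del 1 (e i)) x hx]
    have t3 : ∫ x, ∑ i, ‖halfWeight φ x * toC η₀ x * G i x‖ ^ 2
        = ∫ x, (1 * η₀ x ^ 2) * (∑ i, ‖G i x‖ ^ 2) * expNeg φ x := by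
      congr 1; ext x
      rw [Finset.mul_sum, Finset.sum_mul]
      refine Finset.sum_congr rfl fun i _ => ?_
      rw [mul_assoc, norm_halfWeight_mul_sq, norm_mul, mul_pow, toC, Complex.norm_real,
        Real.norm_eq_abs, sq_abs, one_mul]
    rw [t1, t2, t3] at CS
    exact CS.trans (mul_le_mul_of_nonneg_left s4 hF0)
  refine le_of_forall_pos_le_add fun ε hε => ?_
  set K := F * (5 * (C₀ * (A + 5 * (C₁ * B)))) with hK
  have hK0 : 0 ≤ K := by positivity
  refine (main ((K + 1) / ε) (by positivity)).trans ?_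
  have : F * (A + 5 * (C₀ * ((A + 5 * (C₁ * B)) / ((K + 1) / ε)))) = F * A + K / (K + 1) * ε := by
    rw [hK]; field_simp
  rw [this]
  have : K / (K + 1) ≤ 1 := by rw [div_le_one (by positivity)]; linarith
  nlinarith

end Shell

section LeviDir

variable {V : Type*} [NormedAddCommGroup V] [InnerProductSpace ℂ V]

/-- The Levi form of `φ` at `x` in the direction `X`, i.e. a quarter of the Laplacian of
`w ↦ φ (x + w X)` at `0`. -/
def leviDir (φ : V → ℝ) (x X : V) : ℝ :=
  (1 / 4) * (fderiv ℝ (fderiv ℝ φ) x X X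
    + fderiv ℝ (fderiv ℝ φ) x (Complex.I • X) (Complex.I • X))

theorem real_smul_add_I_smul (c : ℂ) (v : V) :
    c • v = c.re • v + c.im • (Complex.I • v) := by
  conv_lhs => rw [← Complex.re_add_im c]
  rw [add_smul, mul_smul, Complex.coe_smul, Complex.coe_smul]

theorem I_smul_smul (c : ℂ) (v : V) :
    Complex.I • (c • v) = c.re • (Complex.I • v) - c.im • v := by
  rw [smul_smul, real_smul_add_I_smul (Complex.I * c)]
  simp [sub_eq_neg_add]

theorem del_neg_one_smul_dir (c : ℂ) (v : V) (k : V → ℂ) (x : V) :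
    del (-1) (c • v) k x = c * del (-1) v k x := by
  simp only [del, I_smul_smul]
  rw [real_smul_add_I_smul c v]
  simp only [map_add, map_sub, map_smul, Complex.real_smul]
  conv_rhs => rw [← Complex.re_add_im c]
  linear_combination (1 / 2 * (c.im : ℂ) * fderiv ℝ k x (Complex.I • v)) * Complex.I_sq

theorem del_one_smul_dir (c : ℂ) (v : V) (k : V → ℂ) (x : V) :
    del 1 (c • v) k x = conj c * del 1 v k x := by
  simp only [del, I_smul_smul]
  rw [real_smul_add_I_smul c v]
  simp only [map_add, map_sub, map_smul, Complex.real_smul]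
  have : conj c = c.re - c.im * Complex.I := by
    apply Complex.ext <;> simp
  rw [this]
  linear_combination (1 / 2 * (c.im : ℂ) * fderiv ℝ k x (Complex.I • v)) * Complex.I_sq

theorem del_sum_dir {ι : Type*} (s : Finset ι) (σ : ℂ) (v : ι → V) (k : V → ℂ) (x : V) :
    del σ (∑ i ∈ s, v i) k x = ∑ i ∈ s, del σ (v i) k x := by
  classical
  induction s using Finset.induction_on with
  | empty => simp [del_zero_dir]
  | insert a s ha ih => rw [Finset.sum_insert ha, Finset.sum_insert ha, del_add_dir, ih]

theorem fderiv_toC {φ : V → ℝ} (hφ : ContDiff ℝ ∞ φ) (x : V) :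
    fderiv ℝ (toC φ) x = Complex.ofRealCLM.comp (fderiv ℝ φ x) :=
  (Complex.ofRealCLM.hasFDerivAt.comp x ((hφ.differentiable (by simp)) x).hasFDerivAt).fderiv

theorem del_one_del_neg_one {φ : V → ℝ} (hφ : ContDiff ℝ ∞ φ) (x X : V) :
    del 1 X (del (-1) X (toC φ)) x = leviDir φ x X := by
  have h : ContDiff ℝ ∞ (fderiv ℝ φ) := hφ.fderiv_right (m := ∞) (by simp)
  have hd : DifferentiableAt ℝ (fderiv ℝ φ) x := (h.differentiable (by simp)) x
  have h0 : del (-1) X (toC φ) = fun y => (1 / 2 : ℂ) * ((fderiv ℝ φ y X : ℂ)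
      + (-1) * Complex.I * (fderiv ℝ φ y (Complex.I • X) : ℂ)) := by
    ext y; simp [del, fderiv_toC hφ]
  have h1 : ∀ u : V, HasFDerivAt (fun y => (fderiv ℝ φ y u : ℂ))
      (Complex.ofRealCLM.comp ((fderiv ℝ (fderiv ℝ φ) x).flip u)) x := by
    intro u
    have := hd.hasFDerivAt.clm_apply (hasFDerivAt_const u x)
    refine Complex.ofRealCLM.hasFDerivAt.comp x (f := fun y => fderiv ℝ φ y u) ?_
    simpa using this
  have h2 := ((h1 X).add ((h1 (Complex.I • X)).const_mul ((-1) * Complex.I))).const_mul (1 / 2)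
  have sym := (hφ.contDiffAt (x := x)).isSymmSndFDerivAt (by
    simpa using (WithTop.coe_le_coe.2 (le_top : (2 : ℕ∞) ≤ ⊤)))
  rw [h0, del, leviDir]
  erw [h2.fderiv]
  simp
  rw [sym X (Complex.I • X)]
  linear_combination (-(1 / 4) * ((fderiv ℝ (fderiv ℝ φ) x (Complex.I • X) (Complex.I • X) : ℝ) : ℂ)) * Complex.I_sq

variable {ι : Type*} [Fintype ι]

theorem leviForm_eq {φ : V → ℝ} (hφ : ContDiff ℝ ∞ φ) (e : ι → V) (x : V) (ξ : ι → ℂ) :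
    (leviForm e φ x ξ).re = leviDir φ x (∑ i, ξ i • e i) := by
  have h : leviForm e φ x ξ = (leviDir φ x (∑ i, ξ i • e i) : ℂ) := by
    rw [← del_one_del_neg_one hφ]
    have h1 : del (-1) (∑ i, ξ i • e i) (toC φ)
        = fun y => ∑ i, ξ i * del (-1) (e i) (toC φ) y := by
      ext y; simp only [del_sum_dir, del_neg_one_smul_dir]
    have hs := fun i => contDiff_del (σ := -1) (v := e i) (contDiff_toC hφ)
    rw [h1, del_sum fun i _ => ((hs i).differentiableAt_infty x).const_mul _, leviForm]
    refine Finset.sum_congr rfl fun j _ => ?_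
    rw [del_const_mul _ ((hs j).differentiableAt_infty x), del_sum_dir, Finset.mul_sum]
    refine Finset.sum_congr rfl fun k _ => ?_
    rw [del_one_smul_dir]; ring
  rw [h, Complex.ofReal_re]

theorem leviDir_add {φ ψ : V → ℝ} (hφ : ContDiff ℝ ∞ φ) (hψ : ContDiff ℝ ∞ ψ) (x X : V) :
    leviDir (fun y => φ y + ψ y) x X = leviDir φ x X + leviDir ψ x X := by
  have h : ∀ {φ : V → ℝ}, ContDiff ℝ ∞ φ → Differentiable ℝ (fderiv ℝ φ) := fun hφ =>
    (hφ.fderiv_right (m := ∞) (by simp)).differentiable (by simp)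
  have h1 : fderiv ℝ (fun y => φ y + ψ y) = fun y => fderiv ℝ φ y + fderiv ℝ ψ y := by
    ext1 y
    exact fderiv_fun_add (hφ.differentiable (by simp) y) (hψ.differentiable (by simp) y)
  simp only [leviDir, h1, fderiv_fun_add (h hφ x) (h hψ x), _root_.add_apply]
  ring

theorem leviDir_comp {φ : V → ℝ} (hφ : ContDiff ℝ ∞ φ) {l l₁ l₂ : ℝ → ℝ}
    (h₁ : ∀ x, HasDerivAt l (l₁ (φ x)) (φ x)) (h₂ : ∀ x, HasDerivAt l₁ (l₂ (φ x)) (φ x))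
    (x X : V) :
    leviDir (fun y => l (φ y)) x X = l₁ (φ x) * leviDir φ x X
      + l₂ (φ x) * ((1 / 4) * (fderiv ℝ φ x X ^ 2 + fderiv ℝ φ x (Complex.I • X) ^ 2)) := by
  have hd : DifferentiableAt ℝ (fderiv ℝ φ) x :=
    (hφ.fderiv_right (m := ∞) (by simp)).differentiable (by simp) x
  have hf : ∀ y, HasFDerivAt φ (fderiv ℝ φ y) y := fun y =>
    (hφ.differentiable (by simp) y).hasFDerivAt
  have e1 : fderiv ℝ (fun y => l (φ y)) = fun y => l₁ (φ y) • fderiv ℝ φ y := by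
    ext1 y
    exact ((h₁ y).comp_hasFDerivAt y (hf y)).fderiv
  have e2 := (((h₂ x).comp_hasFDerivAt x (hf x)).smul hd.hasFDerivAt).fderiv
  rw [leviDir, e1]
  erw [e2]
  rw [leviDir]
  simp
  ring

theorem leviDir_comp_ge {φ : V → ℝ} (hφ : ContDiff ℝ ∞ φ) {l l₁ l₂ : ℝ → ℝ}
    (h₁ : ∀ x, HasDerivAt l (l₁ (φ x)) (φ x)) (h₂ : ∀ x, HasDerivAt l₁ (l₂ (φ x)) (φ x))
    (x X : V) (hl₂ : 0 ≤ l₂ (φ x)) :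
    l₁ (φ x) * leviDir φ x X ≤ leviDir (fun y => l (φ y)) x X := by
  rw [leviDir_comp hφ h₁ h₂]
  have : 0 ≤ l₂ (φ x) * ((1 / 4) * (fderiv ℝ φ x X ^ 2 + fderiv ℝ φ x (Complex.I • X) ^ 2)) := by
    positivity
  linarith

theorem leviDir_const_mul {φ : V → ℝ} (hφ : ContDiff ℝ ∞ φ) (c : ℝ) (x X : V) :
    leviDir (fun y => c * φ y) x X = c * leviDir φ x X := by
  have := leviDir_comp hφ (l := fun t => c * t) (l₁ := fun _ => c) (l₂ := fun _ => 0)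
    (fun x => by simpa using (hasDerivAt_id (φ x)).const_mul c) (fun x => hasDerivAt_const _ _) x X
  simpa using this

/-- The real part of the inner product, as a continuous real bilinear form. -/
def reInner : V →L[ℝ] V →L[ℝ] ℝ :=
  letI := InnerProductSpace.rclikeToReal ℂ V
  innerSL ℝ

theorem reInner_apply (x y : V) : reInner x y = (inner ℂ x y).re := rfl

theorem reInner_self (x : V) : reInner x x = ‖x‖ ^ 2 := by
  rw [reInner_apply, inner_self_eq_norm_sq_to_K]
  norm_cast

theorem hasFDerivAt_norm_sub_sq (p x : V) :
    HasFDerivAt (fun z : V => ‖z - p‖ ^ 2) ((2 : ℝ) • reInner (x - p)) x := by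
  let _ := InnerProductSpace.rclikeToReal ℂ V
  have := ((hasFDerivAt_id (𝕜 := ℝ) x).sub_const p).norm_sq
  refine this.congr_fderiv ?_
  ext y; rw [two_smul, two_smul]; rfl

theorem contDiff_norm_sub_sq (p : V) : ContDiff ℝ ∞ fun z : V => ‖z - p‖ ^ 2 := by
  let _ := InnerProductSpace.rclikeToReal ℂ V
  exact (contDiff_id.sub contDiff_const).norm_sq ℝ

theorem leviDir_norm_sub_sq (p x X : V) : leviDir (fun z : V => ‖z - p‖ ^ 2) x X = ‖X‖ ^ 2 := by
  have e1 : fderiv ℝ (fun z : V => ‖z - p‖ ^ 2) = fun z => (2 : ℝ) • reInner (z - p) := by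
    ext1 z; exact (hasFDerivAt_norm_sub_sq p z).fderiv
  have e2 : HasFDerivAt (fun z : V => (2 : ℝ) • reInner (z - p))
      ((2 : ℝ) • (reInner : V →L[ℝ] V →L[ℝ] ℝ)) x :=
    ((reInner : V →L[ℝ] V →L[ℝ] ℝ).hasFDerivAt.comp x
      ((hasFDerivAt_id (𝕜 := ℝ) x).sub_const p)).const_smul (2 : ℝ)
  rw [leviDir, e1, e2.fderiv]
  simp only [_root_.smul_apply, reInner_self, norm_smul, Complex.norm_I, smul_eq_mul]
  ring

theorem leviDir_log_nonneg (p : V) {ε : ℝ} (hε : 0 < ε) (x X : V) :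
    0 ≤ leviDir (fun z : V => Real.log (‖z - p‖ ^ 2 + ε)) x X := by
  have hpos : ∀ z : V, ‖z - p‖ ^ 2 + ε ≠ 0 := fun z => by positivity
  rw [leviDir_comp (contDiff_norm_sub_sq p) (l := fun t => Real.log (t + ε))
    (l₁ := fun t => (t + ε)⁻¹) (l₂ := fun t => - 1 / (t + ε) ^ 2)
    (fun z => by simpa using ((hasDerivAt_id (‖z - p‖ ^ 2)).add_const ε).log (hpos z))
    (fun z => ((hasDerivAt_id (‖z - p‖ ^ 2)).add_const ε).inv (hpos z)),
    leviDir_norm_sub_sq, (hasFDerivAt_norm_sub_sq p x).fderiv]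
  set c : ℂ := inner ℂ (x - p) X
  have h1 : (1 / 4 : ℝ) * ((((2 : ℝ) • reInner (x - p)) X) ^ 2
      + (((2 : ℝ) • reInner (x - p)) (Complex.I • X)) ^ 2) = ‖c‖ ^ 2 := by
    rw [Complex.sq_norm, Complex.normSq_apply]
    simp [reInner_apply, c]
    ring
  rw [h1]
  have h2 : ‖c‖ ^ 2 ≤ ‖x - p‖ ^ 2 * ‖X‖ ^ 2 := by
    rw [← mul_pow]; gcongr; exact norm_inner_le_norm _ _
  set t := ‖x - p‖ ^ 2
  have ht : 0 < t + ε := by positivity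
  have h3 : (t + ε)⁻¹ * ‖X‖ ^ 2 + -1 / (t + ε) ^ 2 * ‖c‖ ^ 2
      = ((t + ε) * ‖X‖ ^ 2 - ‖c‖ ^ 2) / (t + ε) ^ 2 := by field_simp; ring
  rw [h3]
  apply div_nonneg _ (by positivity)
  nlinarith [sq_nonneg ‖X‖]

theorem contDiff_log_norm_sub_sq (p : V) {ε : ℝ} (hε : 0 < ε) :
    ContDiff ℝ ∞ fun z : V => Real.log (‖z - p‖ ^ 2 + ε) :=
  ((contDiff_norm_sub_sq p).add contDiff_const).log fun z => by positivity

end LeviDir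

section CircleMean

open Real (circleAverage)

theorem exists_polynomial_re_near {u : ℂ → ℝ} (hu : ContinuousOn u (sphere 0 1)) {ε : ℝ}
    (hε : 0 < ε) : ∃ P : Polynomial ℂ, ∀ z ∈ sphere (0 : ℂ) 1, |u z - (P.eval z).re| < ε := by
  have hc : Continuous fun x : AddCircle (1 : ℝ) => u (AddCircle.toCircle x) :=
    hu.comp_continuous (by have := AddCircle.continuous_toCircle (T := (1 : ℝ)); fun_prop)
      (fun x => by rw [mem_sphere_zero_iff_norm]; exact Circle.norm_coe _)
  let g : C(AddCircle (1 : ℝ), ℂ) := ⟨fun x => (u (AddCircle.toCircle x) : ℂ),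
    Complex.continuous_ofReal.comp hc⟩
  have hg : g ∈ (Submodule.span ℂ (range (fourier (T := (1 : ℝ))))).topologicalClosure := by
    rw [span_fourier_closure_eq_top]; trivial
  obtain ⟨q, hq, hqg⟩ := Metric.mem_closure_iff.1 hg ε hε
  have key : ∀ c : ℂ, ∃ P : Polynomial ℂ, ∀ x : AddCircle (1 : ℝ),
      (c * q x).re = (P.eval (AddCircle.toCircle x : ℂ)).re := by
    refine Submodule.span_induction ?_ ?_ ?_ ?_ hq
    · rintro _ ⟨n, rfl⟩ c
      obtain ⟨m, rfl | rfl⟩ := n.eq_nat_or_neg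
      · refine ⟨Polynomial.C c * Polynomial.X ^ m, fun x => ?_⟩
        simp [AddCircle.toCircle_nsmul]
      · refine ⟨Polynomial.C (conj c) * Polynomial.X ^ m, fun x => ?_⟩
        rw [fourier_neg, ← Complex.conj_re]
        simp [AddCircle.toCircle_nsmul]
    · exact fun c => ⟨0, by simp⟩
    · intro a b _ _ ha hb c
      obtain ⟨P, hP⟩ := ha c
      obtain ⟨Q, hQ⟩ := hb c
      exact ⟨P + Q, fun x => by simp [mul_add, ← hP, ← hQ]⟩
    · intro d a _ ha c
      obtain ⟨P, hP⟩ := ha (c * d)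
      exact ⟨P, fun x => by rw [← hP]; simp only [ContinuousMap.smul_apply, smul_eq_mul, mul_assoc]⟩
  obtain ⟨P, hP⟩ := key 1
  refine ⟨P, fun z hz => ?_⟩
  obtain ⟨x, hx⟩ := (AddCircle.homeomorphCircle (T := (1 : ℝ)) one_ne_zero).surjective
    (⟨z, by simpa [Submonoid.unitSphere] using hz⟩ : Circle)
  have hx' : (AddCircle.toCircle x : ℂ) = z := by
    rw [AddCircle.homeomorphCircle_apply] at hx; rw [hx]
  have h1 := hP x
  rw [one_mul, hx'] at h1
  rw [← h1]
  have h2 : dist (g x) (q x) < ε := (ContinuousMap.dist_apply_le_dist x).trans_lt hqg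
  have h3 : u z - (q x).re = (g x - q x).re := by simp [g, hx']
  rw [h3]
  exact (Complex.abs_re_le_norm _).trans_lt (by rwa [dist_eq_norm] at h2)

theorem Polynomial.circleAverage_re (P : Polynomial ℂ) :
    circleAverage (fun z => (P.eval z).re) 0 1 = (P.eval 0).re := by
  have h1 : circleAverage (fun z => P.eval z) 0 1 = P.eval 0 :=
    DiffContOnCl.circleAverage P.differentiable.diffContOnCl
  have h2 := Complex.reCLM.circleAverage_comp_comm (f := fun z => P.eval z) (c := 0) (R := 1)
    (P.continuous.continuousOn.circleIntegrable zero_le_one)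
  rw [h1] at h2
  exact h2

theorem le_circleAverage_of_forall_polynomial {u : ℂ → ℝ} (hu : ContinuousOn u (sphere 0 1))
    {c : ℝ} (h : ∀ P : Polynomial ℂ, (∀ z ∈ sphere (0 : ℂ) 1, u z ≤ (P.eval z).re) →
      c ≤ (P.eval 0).re) : c ≤ circleAverage u 0 1 := by
  refine le_of_forall_pos_le_add fun ε hε => ?_
  obtain ⟨P, hP⟩ := exists_polynomial_re_near hu (half_pos hε)
  have h1 := h (P + Polynomial.C ((ε / 2 : ℝ) : ℂ)) fun z hz => by
    have := (abs_lt.1 (hP z hz)).2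
    rw [Polynomial.eval_add, Polynomial.eval_C, Complex.add_re, Complex.ofReal_re]; linarith
  rw [Polynomial.eval_add, Polynomial.eval_C, Complex.add_re, Complex.ofReal_re,
    ← Polynomial.circleAverage_re] at h1
  have hi : CircleIntegrable (fun z => (P.eval z).re) 0 1 :=
    (Complex.continuous_re.comp P.continuous).continuousOn.circleIntegrable zero_le_one
  have hc : CircleIntegrable (fun _ : ℂ => ε / 2) 0 1 := circleIntegrable_const _ _ _
  have hui : CircleIntegrable u 0 1 := hu.circleIntegrable zero_le_one
  have h2 : circleAverage (fun z => (P.eval z).re) 0 1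
      ≤ circleAverage (fun z => u z + ε / 2) 0 1 := by
    refine Real.circleAverage_mono hi (hui.add hc) fun z hz => ?_
    rw [abs_one] at hz
    have := (abs_lt.1 (hP z hz)).1
    linarith
  rw [Real.circleAverage_fun_add hui hc, Real.circleAverage_const] at h2
  linarith

variable {V : Type*} [NormedAddCommGroup V] [InnerProductSpace ℂ V] [FiniteDimensional ℂ V]
  [MeasureSpace V] [BorelSpace V] [(volume : Measure V).IsAddHaarMeasure]

theorem measurePreserving_unit_smul {w : ℂ} (hw : ‖w‖ = 1) :
    MeasurePreserving (fun x : V => w • x) := by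
  have : FiniteDimensional ℝ V := FiniteDimensional.complexToReal V
  have hw0 : w ≠ 0 := fun h => by simp [h] at hw
  refine ⟨(continuous_const_smul w).measurable, ?_⟩
  let L : V ≃L[ℝ] V := (ContinuousLinearEquiv.smulLeft (R₁ := ℂ) (M₁ := V) (Units.mk0 w hw0)).restrictScalars ℝ
  have hL : ∀ x, L x = w • x := fun x => rfl
  have hmap : (volume.map fun x : V => w • x) = volume.map L := rfl
  have hH : (volume.map L : Measure V).IsAddHaarMeasure := L.isAddHaarMeasure_map _
  have h1 := Measure.isAddLeftInvariant_eq_smul (volume.map L : Measure V) (volume : Measure V)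
  set c := Measure.addHaarScalarFactor (volume.map L : Measure V) (volume : Measure V)
  have h2 : (volume.map L) (ball (0 : V) 1) = volume (ball (0 : V) 1) := by
    rw [Measure.map_apply L.continuous.measurable measurableSet_ball]
    congr 1; ext x
    simp [hL, norm_smul, hw]
  rw [h1, Measure.smul_apply] at h2
  have hc : c = 1 := by
    have h3 : volume (ball (0 : V) 1) ≠ 0 := (measure_ball_pos _ _ one_pos).ne'
    have h4 : volume (ball (0 : V) 1) ≠ ⊤ := measure_ball_lt_top.ne
    have h5 : (c : ℝ≥0∞) * volume (ball (0 : V) 1) = 1 * volume (ball (0 : V) 1) := by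
      rw [one_mul]; exact h2
    exact_mod_cast (ENNReal.mul_left_inj h3 h4).1 h5
  rw [hmap, h1, hc, one_smul]

theorem integral_unit_smul {F : Type*} [NormedAddCommGroup F] [NormedSpace ℝ F] {w : ℂ}
    (hw : ‖w‖ = 1) (g : V → F) : ∫ x, g (w • x) = ∫ x, g x := by
  have hw0 : w ≠ 0 := fun h => by simp [h] at hw
  exact (measurePreserving_unit_smul hw).integral_comp
    (Homeomorph.smulOfNeZero w hw0).measurableEmbedding g

theorem integrable_circle_smul {F : Type*} [NormedAddCommGroup F] [NormedSpace ℝ F]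
    {g : V → F} (hg : StronglyMeasurable g) (hi : Integrable g) :
    Integrable (fun q : ℝ × V => g (circleMap 0 1 q.1 • q.2))
      ((volume.restrict (Ioc 0 (2 * Real.pi))).prod volume) := by
  have hn : ∀ θ : ℝ, ‖circleMap 0 1 θ‖ = 1 := fun θ => by simp
  have hm : StronglyMeasurable fun q : ℝ × V => g (circleMap 0 1 q.1 • q.2) :=
    hg.comp_measurable (by
      have : Continuous fun q : ℝ × V => circleMap 0 1 q.1 • q.2 := by fun_prop
      exact this.measurable)
  rw [integrable_prod_iff hm.aestronglyMeasurable]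
  constructor
  · refine Eventually.of_forall fun θ => ?_
    exact ((measurePreserving_unit_smul (V := V) (hn θ)).integrable_comp
      hi.aestronglyMeasurable).2 hi
  · simp only [fun θ => integral_unit_smul (hn θ) (fun x => ‖g x‖)]
    exact integrable_const _

theorem integrable_circleAverage_smul {F : Type*} [NormedAddCommGroup F] [NormedSpace ℝ F]
    {g : V → F} (hg : StronglyMeasurable g) (hi : Integrable g) :
    Integrable fun x => circleAverage (fun w => g (w • x)) 0 1 := by
  simp only [Real.circleAverage_def]
  simp only [intervalIntegral.integral_of_le Real.two_pi_pos.le]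
  exact ((integrable_circle_smul hg hi).integral_prod_right).smul _

/-- Averaging over rotations does not change an integral. -/
theorem integral_circleAverage_smul {F : Type*} [NormedAddCommGroup F] [NormedSpace ℝ F]
    [CompleteSpace F] {g : V → F} (hg : StronglyMeasurable g) (hi : Integrable g) :
    ∫ x, circleAverage (fun w => g (w • x)) 0 1 = ∫ x, g x := by
  have hn : ∀ θ : ℝ, ‖circleMap 0 1 θ‖ = 1 := fun θ => by simp
  simp only [Real.circleAverage_def, integral_smul]
  simp only [intervalIntegral.integral_of_le Real.two_pi_pos.le]
  rw [← integral_integral_swap (integrable_circle_smul hg hi)]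
  simp only [fun θ => integral_unit_smul (hn θ) g]
  rw [integral_const, smul_smul]
  have : (volume.restrict (Ioc 0 (2 * Real.pi))).real univ = 2 * Real.pi := by
    simp [Real.pi_pos.le]
  rw [this, inv_mul_cancel₀ Real.two_pi_pos.ne', one_smul]

theorem integral_mono_circleAverage {g : V → ℝ} (hg : StronglyMeasurable g) (hi : Integrable g)
    {h : V → ℝ} (hh : Integrable h) (hle : ∀ x, h x ≤ circleAverage (fun w => g (w • x)) 0 1) :
    ∫ x, h x ≤ ∫ x, g x := by
  rw [← integral_circleAverage_smul hg hi]
  exact integral_mono hh (integrable_circleAverage_smul hg hi) hle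

theorem le_setAverage_of_le_circleAverage {f : V → ℝ} {z : V} {r : ℝ} (hr : 0 < r)
    (hf : ContinuousOn f (closedBall z r))
    (h : ∀ y ∈ ball (0 : V) r, f z ≤ circleAverage (fun w => f (z + w • y)) 0 1) :
    f z ≤ ⨍ y in ball z r, f y := by
  have : FiniteDimensional ℝ V := FiniteDimensional.complexToReal V
  have hvol : 0 < volume.real (ball z r) :=
    ENNReal.toReal_pos (measure_ball_pos _ _ hr).ne' measure_ball_lt_top.ne
  have hio : IntegrableOn f (ball z r) :=
    (hf.integrableOn_compact (isCompact_closedBall z r)).mono_set ball_subset_closedBall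
  have hsm : StronglyMeasurable ((ball z r).indicator f) := by
    classical
    rw [← piecewise_eq_indicator]
    exact (ContinuousOn.measurable_piecewise (hf.mono ball_subset_closedBall)
      continuousOn_const measurableSet_ball).stronglyMeasurable
  have h1 : ∫ y in ball z r, f y = ∫ y, (ball z r).indicator f (z + y) := by
    rw [integral_add_left_eq_self (fun y => (ball z r).indicator f y),
      integral_indicator measurableSet_ball]
  have hmem : ∀ y, z + y ∈ ball z r ↔ y ∈ ball (0 : V) r := fun y => by simp
  have h2 : ∫ y, (ball (0 : V) r).indicator (fun _ => f z) y ≤ ∫ y in ball z r, f y := by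
    rw [h1]
    refine integral_mono_circleAverage (hsm.comp_measurable (measurable_const_add z))
      ((hio.integrable_indicator measurableSet_ball).comp_add_left z)
      (((integrableOn_const_iff).2 (Or.inr measure_ball_lt_top)).integrable_indicator
        measurableSet_ball) fun y => ?_
    by_cases hy : y ∈ ball (0 : V) r
    · rw [indicator_of_mem hy]
      refine (h y hy).trans_eq (Real.circleAverage_congr_sphere fun w hw => ?_)
      have hw1 : ‖w‖ = 1 := by simpa using hw
      refine (indicator_of_mem ?_ f).symm
      rw [hmem]; simpa [norm_smul, hw1] using hy
    · rw [indicator_of_notMem hy]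
      refine Real.circleAverage_nonneg_of_nonneg fun w hw => ?_
      have hw1 : ‖w‖ = 1 := by simpa using hw
      refine (indicator_of_notMem ?_ f).ge
      rw [hmem]; simpa [norm_smul, hw1] using hy
  have hv : volume.real (ball (0 : V) r) = volume.real (ball z r) := by
    simp only [measureReal_def, Measure.addHaar_ball_center]
  rw [integral_indicator measurableSet_ball, setIntegral_const, hv, smul_eq_mul] at h2
  rw [setAverage_eq, smul_eq_mul, inv_mul_eq_div, le_div_iff₀ hvol, mul_comm]
  exact h2

theorem Polynomial.setAverage_re (P : Polynomial ℂ) (z : ℂ) {r : ℝ} (hr : 0 < r) :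
    ⨍ y in ball z r, (P.eval y).re = (P.eval z).re := by
  have key : ∀ Q : Polynomial ℂ, (Q.eval z).re ≤ ⨍ y in ball z r, (Q.eval y).re := fun Q => by
    have hc : Continuous fun y => (Q.eval y).re := Complex.continuous_re.comp Q.continuous
    refine le_setAverage_of_le_circleAverage (f := fun y => (Q.eval y).re) hr hc.continuousOn
      fun y _ => ?_
    have := Polynomial.circleAverage_re
      (Q.comp (Polynomial.C z + Polynomial.X * Polynomial.C y))
    simp only [Polynomial.eval_comp, Polynomial.eval_add, Polynomial.eval_mul, Polynomial.eval_C,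
      Polynomial.eval_X, zero_mul, add_zero] at this
    exact this.ge
  refine le_antisymm ?_ (key P)
  have := key (-P)
  simp only [Polynomial.eval_neg, Complex.neg_re, setAverage_eq, integral_neg, smul_neg] at this ⊢
  linarith

/-- A continuous function with the local area sub-mean value property is at most the real part of
a polynomial on the closed unit disc as soon as this holds on the unit circle. -/
theorem le_re_polynomial_of_area_submean {u : ℂ → ℝ} (hu : ContinuousOn u (closedBall 0 1))
    (h : ∀ z ∈ ball (0 : ℂ) 1, ∃ R > 0, ∀ r, 0 < r → r < R → closedBall z r ⊆ ball 0 1 →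
      u z ≤ ⨍ y in ball z r, u y) (P : Polynomial ℂ)
    (hP : ∀ z ∈ sphere (0 : ℂ) 1, u z ≤ (P.eval z).re) {z : ℂ} (hz : z ∈ closedBall (0 : ℂ) 1) :
    u z ≤ (P.eval z).re := by
  set g : ℂ → ℝ := fun z => u z - (P.eval z).re with hg
  have hPc : Continuous fun z => (P.eval z).re := Complex.continuous_re.comp P.continuous
  have hgc : ContinuousOn g (closedBall 0 1) := hu.sub hPc.continuousOn
  obtain ⟨m, hm, hmax⟩ := (isCompact_closedBall (0 : ℂ) 1).exists_isMaxOn ⟨z, hz⟩ hgc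
  by_contra! hcon
  have hM : 0 < g m := (sub_pos.2 hcon).trans_le (hmax hz)
  have hS : IsCompact (closedBall (0 : ℂ) 1 ∩ g ⁻¹' {g m}) :=
    (isCompact_closedBall (0 : ℂ) 1).of_isClosed_subset
      (hgc.preimage_isClosed_of_isClosed isClosed_closedBall isClosed_singleton)
      inter_subset_left
  obtain ⟨a, ⟨ha1, ha2⟩, hamax⟩ := hS.exists_isMaxOn ⟨m, hm, rfl⟩ continuous_norm.continuousOn
  have ha2 : g a = g m := ha2
  have hab : a ∈ ball (0 : ℂ) 1 := by
    rcases (mem_closedBall.1 ha1).lt_or_eq with hlt | heq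
    · exact hlt
    · have := hP a heq
      have h3 : g a ≤ 0 := sub_nonpos.2 this
      linarith
  obtain ⟨R, hR, hsub⟩ := h a hab
  obtain ⟨r₀, hr₀, hr₀s⟩ := Metric.isOpen_iff.1 isOpen_ball a hab
  obtain ⟨r, hr, hrlt⟩ := exists_between (lt_min hR hr₀)
  have hcb : closedBall a r ⊆ ball 0 1 :=
    (closedBall_subset_ball (hrlt.trans_le (min_le_right _ _))).trans hr₀s
  have hcb' : ball a r ⊆ closedBall 0 1 :=
    ball_subset_closedBall.trans (hcb.trans ball_subset_closedBall)
  have hav := hsub r hr (hrlt.trans_le (min_le_left _ _)) hcb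
  have hvol : 0 < volume.real (ball a r) :=
    ENNReal.toReal_pos (measure_ball_pos _ _ hr).ne' measure_ball_lt_top.ne
  have hui : IntegrableOn u (ball a r) :=
    ((hu.mono (hcb.trans ball_subset_closedBall)).integrableOn_compact
      (isCompact_closedBall a r)).mono_set ball_subset_closedBall
  have hPi : IntegrableOn (fun z => (P.eval z).re) (ball a r) :=
    (hPc.continuousOn.integrableOn_compact (isCompact_closedBall a r)).mono_set
      ball_subset_closedBall
  have hgm : IntegrableOn (fun _ : ℂ => g m) (ball a r) :=
    (integrableOn_const_iff).2 (Or.inr measure_ball_lt_top)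
  have hint : ∫ y in ball a r, (g m - g y) = 0 := by
    refine le_antisymm ?_ (setIntegral_nonneg measurableSet_ball fun y hy =>
      sub_nonneg.2 (hmax (hcb' hy)))
    have e1 := Polynomial.setAverage_re P a hr
    rw [setAverage_eq, smul_eq_mul, inv_mul_eq_div] at e1 hav
    rw [le_div_iff₀ hvol] at hav
    rw [div_eq_iff hvol.ne'] at e1
    have e2 : ∫ y in ball a r, (g m - g y) = g m * volume.real (ball a r)
        - ((∫ y in ball a r, u y) - ∫ y in ball a r, (P.eval y).re) := by
      rw [← integral_sub hui hPi, mul_comm, ← smul_eq_mul, ← setIntegral_const, ← integral_sub hgm]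
      exact hui.sub hPi
    rw [e2, e1, ← ha2]
    simp only [hg]
    linarith
  have hae : (fun y => g m - g y) =ᵐ[volume.restrict (ball a r)] fun _ => 0 := by
    refine (setIntegral_eq_zero_iff_of_nonneg_ae ?_ ?_).1 hint
    · exact (ae_restrict_mem measurableSet_ball).mono fun y hy => sub_nonneg.2 (hmax (hcb' hy))
    · exact hgm.sub (hui.sub hPi)
  have heq : EqOn (fun y => g m - g y) (fun _ => 0) (ball a r) :=
    Measure.eqOn_open_of_ae_eq hae isOpen_ball
      (continuousOn_const.sub (hgc.mono hcb')) continuousOn_const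
  obtain ⟨y, hy, hya⟩ : ∃ y ∈ ball a r, ‖a‖ < ‖y‖ := by
    by_cases h0 : a = 0
    · refine ⟨((r / 2 : ℝ) : ℂ), ?_, ?_⟩
      · simp [h0, abs_of_pos hr]; linarith
      · simp [h0, hr.ne']
    · have hna : 0 < ‖a‖ := norm_pos_iff.2 h0
      refine ⟨((1 + r / 2 / ‖a‖ : ℝ) : ℂ) * a, ?_, ?_⟩
      · rw [mem_ball, dist_eq_norm]
        have : ((1 + r / 2 / ‖a‖ : ℝ) : ℂ) * a - a = ((r / 2 / ‖a‖ : ℝ) : ℂ) * a := by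
          push_cast; ring
        rw [this, norm_mul, Complex.norm_real, Real.norm_of_nonneg (by positivity),
          div_mul_cancel₀ _ hna.ne']
        linarith
      · rw [norm_mul, Complex.norm_real, Real.norm_of_nonneg (by positivity), add_mul,
          div_mul_cancel₀ _ hna.ne']
        linarith
  have hyS : y ∈ closedBall (0 : ℂ) 1 ∩ g ⁻¹' {g m} :=
    ⟨hcb' hy, by have := heq hy; simp only at this; exact (sub_eq_zero.1 this).symm⟩
  exact absurd (hamax hyS) (not_le.2 hya)

end CircleMean

section Submean

open Real (circleAverage)

theorem erealBallAvg_coe {f : ℂ → ℝ} {x : ℂ} {r : ℝ} (hr : 0 < r)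
    (hf : IntegrableOn f (ball x r)) :
    erealBallAvg (fun y => (f y : EReal)) x r = ((⨍ y in ball x r, f y : ℝ) : EReal) := by
  have h1 : ∀ t : ℝ, erealToENNReal (t : EReal) = ENNReal.ofReal t := fun t => by
    simp [erealToENNReal]
  have h2 : ∀ t : ℝ, erealToENNReal (-(t : EReal)) = ENNReal.ofReal (-t) := fun t => by
    rw [← EReal.coe_neg, h1]
  have hv0 : volume (ball x r) ≠ 0 := (measure_ball_pos _ _ hr).ne'
  have hA : ∫⁻ y in ball x r, ENNReal.ofReal (f y) ≠ ⊤ := hf.lintegral_lt_top.ne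
  have hB : ∫⁻ y in ball x r, ENNReal.ofReal (-f y) ≠ ⊤ := hf.neg.lintegral_lt_top.ne
  simp only [erealBallAvg, h1, h2]
  rw [← EReal.coe_ennreal_toReal (ENNReal.div_lt_top hA hv0).ne,
    ← EReal.coe_ennreal_toReal (ENNReal.div_lt_top hB hv0).ne, ← EReal.coe_sub, setAverage_eq,
    integral_eq_lintegral_pos_part_sub_lintegral_neg_part hf, ENNReal.toReal_div,
    ENNReal.toReal_div, smul_eq_mul, measureReal_def]
  congr 1
  ring

variable {V : Type*} [NormedAddCommGroup V] [InnerProductSpace ℂ V]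

/-- The sub-mean value inequality of `u` over the boundary of every closed complex disc
contained in `s`. -/
def CircleSubmean (u : V → ℝ) (s : Set V) : Prop :=
  ∀ a b : V, (∀ w : ℂ, ‖w‖ ≤ 1 → a + w • b ∈ s) →
    u a ≤ circleAverage (fun w => u (a + w • b)) 0 1

theorem CircleSubmean.submeanOn {u : V → ℝ} {s : Set V} (hu : ContinuousOn u s)
    (h : CircleSubmean u s) (a b : V) :
    SubmeanOn (fun w : ℂ => ((u (a + w • b) : ℝ) : EReal)) {w : ℂ | a + w • b ∈ s} := by
  refine fun x _ => ⟨1, one_pos, fun r hr _ hsub => ?_⟩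
  have hc : ContinuousOn (fun w : ℂ => u (a + w • b)) (closedBall x r) :=
    hu.comp (by fun_prop) hsub
  rw [erealBallAvg_coe hr ((hc.integrableOn_compact (isCompact_closedBall x r)).mono_set
    ball_subset_closedBall), EReal.coe_le_coe_iff]
  refine le_setAverage_of_le_circleAverage (f := fun w : ℂ => u (a + w • b)) hr hc fun y hy => ?_
  have := h (a + x • b) (y • b) fun w hw => by
    have h1 : x + w * y ∈ closedBall x r := by
      rw [mem_closedBall, dist_eq_norm, add_sub_cancel_left, norm_mul]
      have hy : ‖y‖ < r := by simpa using hy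
      nlinarith [norm_nonneg w, norm_nonneg y]
    have h2 : a + (x + w * y) • b ∈ s := hsub h1
    rwa [add_smul, mul_smul, ← add_assoc] at h2
  refine this.trans_eq (congrArg (fun f => circleAverage f 0 1) ?_)
  ext w
  simp only [smul_eq_mul, add_smul, mul_smul, add_assoc]

theorem circleSubmean_of_submeanOn {u : V → ℝ} {s : Set V} (hu : ContinuousOn u s)
    (h : ∀ a b : V,
      SubmeanOn (fun w : ℂ => ((u (a + w • b) : ℝ) : EReal)) {w : ℂ | a + w • b ∈ s}) :
    CircleSubmean u s := by
  intro a b hab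
  have hc : ContinuousOn (fun w : ℂ => u (a + w • b)) (closedBall 0 1) :=
    hu.comp (by fun_prop) fun w hw => hab w (by simpa using hw)
  refine le_circleAverage_of_forall_polynomial (hc.mono sphere_subset_closedBall) fun P hP => ?_
  have := le_re_polynomial_of_area_submean hc ?_ P hP (z := 0) (by simp)
  · simpa using this
  intro z hz
  obtain ⟨R, hR, hsub⟩ := h a b z (hab z (by simpa using (mem_ball.1 hz).le))
  refine ⟨R, hR, fun r hr hrR hzr => ?_⟩
  have hin : closedBall z r ⊆ closedBall (0 : ℂ) 1 := hzr.trans ball_subset_closedBall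
  have := hsub r hr hrR fun w hw => hab w (by simpa using hin hw)
  rwa [erealBallAvg_coe hr (((hc.mono hin).integrableOn_compact (isCompact_closedBall z r)).mono_set
    ball_subset_closedBall), EReal.coe_le_coe_iff] at this

end Submean

section BoundaryDistance

variable {V : Type*} [NormedAddCommGroup V] [NormedSpace ℝ V] {Ω : Set V}

theorem nonempty_frontier_of_ne_univ (hn : Ω.Nonempty) (hne : Ω ≠ univ) :
    (frontier Ω).Nonempty := by
  rw [nonempty_frontier_iff]
  exact ⟨hn, hne⟩

theorem ball_infDist_frontier_subset (hΩ : IsOpen Ω) {z : V} (hz : z ∈ Ω) :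
    ball z (infDist z (frontier Ω)) ⊆ Ω := by
  by_cases hd : 0 < infDist z (frontier Ω)
  · refine (convex_ball z _).isPreconnected.subset_left_of_subset_union (v := interior Ωᶜ) hΩ
      isOpen_interior ?_ ?_ ⟨z, mem_ball_self hd, hz⟩
    · exact disjoint_left.2 fun x hx hx' => interior_subset hx' hx
    · intro x hx
      by_contra hcon
      rw [mem_union, not_or, interior_compl, mem_compl_iff, not_not] at hcon
      have hf : x ∈ frontier Ω := by
        rw [frontier, hΩ.interior_eq]; exact ⟨hcon.2, hcon.1⟩
      have := infDist_le_dist_of_mem (x := z) hf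
      rw [mem_ball, dist_comm] at hx
      linarith
  · rw [ball_eq_empty.2 (not_lt.1 hd)]; exact empty_subset _

theorem le_infDist_frontier (hΩ : IsOpen Ω) (hf : (frontier Ω).Nonempty) {z : V} {r : ℝ}
    (h : ball z r ⊆ Ω) : r ≤ infDist z (frontier Ω) := by
  rw [le_infDist hf]
  intro y hy
  by_contra! hcon
  rw [frontier, hΩ.interior_eq] at hy
  exact hy.2 (h (by rwa [mem_ball, dist_comm]))

theorem infDist_frontier_pos (hΩ : IsOpen Ω) (hf : (frontier Ω).Nonempty) {z : V} (hz : z ∈ Ω) :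
    0 < infDist z (frontier Ω) := by
  obtain ⟨r, hr, hs⟩ := Metric.isOpen_iff.1 hΩ z hz
  exact hr.trans_le (le_infDist_frontier hΩ hf hs)

theorem continuousOn_neg_log_infDist (hΩ : IsOpen Ω) (hf : (frontier Ω).Nonempty) :
    ContinuousOn (fun z => -Real.log (infDist z (frontier Ω))) Ω :=
  ((continuous_infDist_pt _).continuousOn.log fun _ hz =>
    (infDist_frontier_pos hΩ hf hz).ne').neg

end BoundaryDistance

section HolomorphicConvexity

variable {n : ℕ} {Ω : Set (EuclideanSpace ℂ (Fin n))}

theorem norm_le_sSup_image {V : Type*} [TopologicalSpace V] {f : V → ℂ} {K : Set V}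
    (hK : IsCompact K) (hf : ContinuousOn f K) {z : V} (hz : z ∈ K) :
    ‖f z‖ ≤ sSup ((fun w => ‖f w‖) '' K) :=
  le_csSup (hK.image_of_continuousOn hf.norm).bddAbove ⟨z, hz, rfl⟩

/-- A continuous family of closed holomorphic discs whose boundaries stay in a holomorphically
convex set and whose initial member is contained in it stays in it. -/
theorem HolomorphicallyConvex.disc_subset (h : HolomorphicallyConvex Ω) (hΩ : IsOpen Ω)
    {φ : ℝ → ℂ → EuclideanSpace ℂ (Fin n)} (hφc : Continuous fun q : ℝ × ℂ => φ q.1 q.2)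
    (hφd : ∀ t, Differentiable ℂ (φ t)) {t₀ : ℝ} (ht₀ : 0 ≤ t₀)
    (hinit : ∀ w ∈ closedBall (0 : ℂ) 1, φ 0 w ∈ Ω)
    (hbd : ∀ t ∈ Icc 0 t₀, ∀ w ∈ sphere (0 : ℂ) 1, φ t w ∈ Ω) :
    ∀ w ∈ closedBall (0 : ℂ) 1, φ t₀ w ∈ Ω := by
  set K := (fun q : ℝ × ℂ => φ q.1 q.2) '' (Icc 0 t₀ ×ˢ sphere (0 : ℂ) 1)
  have hK : IsCompact K := (isCompact_Icc.prod (isCompact_sphere _ _)).image hφc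
  have hKΩ : K ⊆ Ω := by
    rintro _ ⟨⟨t, w⟩, ⟨ht, hw⟩, rfl⟩
    exact hbd t ht w hw
  have hH := h K hKΩ hK
  have hull : ∀ t ∈ Icc 0 t₀, (∀ w ∈ closedBall (0 : ℂ) 1, φ t w ∈ Ω) →
      ∀ w ∈ closedBall (0 : ℂ) 1, φ t w ∈ holomorphicHull Ω K := by
    refine fun t ht hin w hw => ⟨hin w hw, fun f hf => ?_⟩
    have hd : DifferentiableOn ℂ (fun w => f (φ t w)) (closedBall (0 : ℂ) 1) :=
      hf.comp (hφd t).differentiableOn hin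
    refine Complex.norm_le_of_forall_mem_frontier_norm_le (f := fun w => f (φ t w))
      (U := ball (0 : ℂ) 1) isBounded_ball ?_ ?_ ?_
    · exact DifferentiableOn.diffContOnCl (by rwa [closure_ball _ one_ne_zero])
    · intro w hw
      rw [frontier_ball _ one_ne_zero] at hw
      exact norm_le_sSup_image hK (hf.continuousOn.mono hKΩ) ⟨(t, w), ⟨ht, hw⟩, rfl⟩
    · rwa [closure_ball _ one_ne_zero]
  have hT : Icc 0 t₀ ⊆ {t | ∀ w ∈ closedBall (0 : ℂ) 1, φ t w ∈ holomorphicHull Ω K} := by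
    refine IsClosed.Icc_subset_of_forall_exists_gt ?_ (hull 0 (left_mem_Icc.2 ht₀) hinit) ?_
    · refine IsClosed.inter ?_ isClosed_Icc
      simp only [ofPred_forall]
      exact isClosed_biInter fun w _ => hH.isClosed.preimage
        (f := fun t => φ t w) (hφc.comp (by fun_prop : Continuous fun t : ℝ => (t, w)))
    · rintro x ⟨hx, hx0⟩ y hy
      have hev : ∀ᶠ t in 𝓝 x, ∀ w ∈ closedBall (0 : ℂ) 1, φ t w ∈ Ω := by
        refine (isCompact_closedBall (0 : ℂ) 1).eventually_forall_of_forall_eventually fun w hw => ?_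
        exact hφc.continuousAt.eventually (hΩ.mem_nhds (hx w hw).1)
      have hev' : ∀ᶠ t in 𝓝[>] x, t ∈ Ioc x (min y t₀) :=
        Ioc_mem_nhdsGT (lt_min hy hx0.2)
      obtain ⟨t, ht1, ht2⟩ := ((hev.filter_mono nhdsWithin_le_nhds).and hev').exists
      refine ⟨t, hull t ⟨hx0.1.trans ht2.1.le, ht2.2.trans (min_le_right _ _)⟩ ht1,
        ht2.1, ht2.2.trans (min_le_left _ _)⟩
  exact fun w hw => (hT (right_mem_Icc.2 ht₀) w hw).1

theorem HolomorphicallyConvex.circleSubmean (h : HolomorphicallyConvex Ω) (hΩ : IsOpen Ω)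
    (hf : (frontier Ω).Nonempty) :
    CircleSubmean (fun z => -Real.log (infDist z (frontier Ω))) Ω := by
  intro a b hab
  have hc : ContinuousOn (fun w : ℂ => -Real.log (infDist (a + w • b) (frontier Ω)))
      (closedBall 0 1) :=
    (continuousOn_neg_log_infDist hΩ hf).comp (by fun_prop) fun w hw => hab w (by simpa using hw)
  refine le_circleAverage_of_forall_polynomial (hc.mono sphere_subset_closedBall) fun P hP => ?_
  have hexp : ∀ w : ℂ, ‖Complex.exp (-P.eval w)‖ = Real.exp (-(P.eval w).re) := fun w => by
    rw [Complex.norm_exp, Complex.neg_re]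
  have ha : a ∈ Ω := by simpa using hab 0 (by simp)
  have key : ball a (Real.exp (-(P.eval 0).re)) ⊆ Ω := by
    intro y hy
    set s := ‖y - a‖ / Real.exp (-(P.eval 0).re) with hs
    have hs1 : s < 1 := by
      rw [hs, div_lt_one (Real.exp_pos _)]
      rwa [mem_ball, dist_eq_norm] at hy
    have hs0 : 0 ≤ s := by positivity
    set v := Complex.exp (P.eval 0) • (y - a)
    have hv : ‖v‖ = s := by
      rw [norm_smul, Complex.norm_exp, hs, Real.exp_neg, div_inv_eq_mul, mul_comm]
    have := h.disc_subset hΩ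
      (φ := fun t w => a + w • b + (t * Complex.exp (-P.eval w)) • v)
      (by have := P.continuous; fun_prop)
      (fun t => by have := P.differentiable; fun_prop) zero_le_one
      (fun w hw => by simpa using hab w (by simpa using hw))
      (fun t ht w hw => ?_) 0 (by simp)
    · have e : a + (0 : ℂ) • b + (((1 : ℝ) : ℂ) * Complex.exp (-P.eval 0)) • v = y := by
        rw [smul_smul, Complex.ofReal_one, one_mul, ← Complex.exp_add]
        simp
      rwa [e] at this
    · have hw1 : ‖w‖ = 1 := by simpa using hw
      have hin := hab w hw1.le
      refine ball_infDist_frontier_subset hΩ hin ?_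
      have h1 := hP w hw
      have hd := infDist_frontier_pos hΩ hf hin
      rw [mem_ball, dist_eq_norm, add_sub_cancel_left, norm_smul, norm_mul, hexp, hv,
        Complex.norm_real, Real.norm_of_nonneg ht.1]
      calc t * Real.exp (-(P.eval w).re) * s ≤ 1 * Real.exp (-(P.eval w).re) * s := by
            gcongr; exact ht.2
        _ < 1 * Real.exp (-(P.eval w).re) * 1 := by gcongr
        _ ≤ infDist (a + w • b) (frontier Ω) := by
            rw [one_mul, mul_one, ← Real.le_log_iff_exp_le hd]; linarith
  have h2 := le_infDist_frontier hΩ hf key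
  rw [← Real.le_log_iff_exp_le (infDist_frontier_pos hΩ hf ha)] at h2
  dsimp only
  linarith

theorem HolomorphicallyConvex.isPlurisubharmonicOn (h : HolomorphicallyConvex Ω) (hΩ : IsOpen Ω)
    (hn : Ω.Nonempty) (hf : (frontier Ω).Nonempty) :
    IsPlurisubharmonicOn (fun z => ((-Real.log (infDist z (frontier Ω)) : ℝ) : EReal)) Ω := by
  have hc := continuousOn_neg_log_infDist hΩ hf
  refine ⟨(continuous_coe_real_ereal.comp_continuousOn hc).upperSemicontinuousOn, fun hcon => ?_,
    fun z _ => EReal.coe_lt_top _, (h.circleSubmean hΩ hf).submeanOn hc⟩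
  obtain ⟨z, hz⟩ := hn
  exact EReal.coe_ne_bot _ (hcon z hz)

end HolomorphicConvexity

section Regularization

open Real (circleAverage)

variable {V : Type*} [NormedAddCommGroup V] [InnerProductSpace ℂ V] [FiniteDimensional ℂ V]

theorem exists_smooth_cutoff {K U : Set V} (hK : IsCompact K) (hU : IsOpen U) (hKU : K ⊆ U) :
    ∃ η : V → ℝ, ContDiff ℝ ∞ η ∧ HasCompactSupport η ∧ tsupport η ⊆ U ∧ (∀ x, 0 ≤ η x) ∧
      (∀ x, η x ≤ 1) ∧ ∀ x ∈ K, η x = 1 := by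
  let _ := FiniteDimensional.complexToReal V
  let _ := FiniteDimensional.proper_real V
  obtain ⟨K', hK', hKK', hK'U⟩ := exists_compact_between hK hU hKU
  obtain ⟨f, hf, hr, hs, h1⟩ := exists_contMDiff_support_eq_eq_one_iff (n := (⊤ : ℕ∞))
    (modelWithCornersSelf ℝ V) isOpen_interior hK.isClosed hKK'
  have hsub : tsupport f ⊆ K' := by
    rw [tsupport, hs]
    exact closure_minimal interior_subset hK'.isClosed
  exact ⟨f, hf.contDiff, hK'.of_isClosed_subset (isClosed_tsupport f) hsub, hsub.trans hK'U,
    fun x => (hr ⟨x, rfl⟩).1, fun x => (hr ⟨x, rfl⟩).2, fun x hx => (h1 x).1 hx⟩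

variable [MeasureSpace V] [BorelSpace V] [(volume : Measure V).IsAddHaarMeasure]

theorem moll_toC (κ F : V → ℝ) (x : V) :
    moll κ (toC F) x = ((∫ y, κ y * F (x - y) : ℝ) : ℂ) := by
  rw [← integral_sub_left_eq_self _ _ x]
  simp only [moll, toC, sub_sub_cancel]
  rw [← integral_complex_ofReal]
  simp only [Complex.ofReal_mul, mul_comm]

theorem integral_mul_comp_le_circleAverage {κ F : V → ℝ} (hκ : Continuous κ)
    (hκc : HasCompactSupport κ) (hκ0 : ∀ y, 0 ≤ κ y) (hF : Continuous F)
    {a b : V} (h : ∀ y, κ y ≠ 0 → F (a - y) ≤ circleAverage (fun w => F (a - y + w • b)) 0 1) :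
    ∫ y, κ y * F (a - y) ≤ circleAverage (fun w => ∫ y, κ y * F (a + w • b - y)) 0 1 := by
  let _ := FiniteDimensional.complexToReal V
  let _ := FiniteDimensional.proper_real V
  have hi : ∀ g : V → ℝ, Continuous g → Integrable fun y => κ y * g y := fun g hg =>
    (hκ.mul hg).integrable_of_hasCompactSupport (μ := volume) hκc.mul_right
  obtain ⟨M, hM⟩ : ∃ M, ∀ q ∈ Icc (0 : ℝ) (2 * Real.pi) ×ˢ tsupport κ,
      ‖F (a + circleMap 0 1 q.1 • b - q.2)‖ ≤ M :=
    (isCompact_Icc.prod hκc.isCompact).exists_bound_of_continuousOn (by fun_prop)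
  have hint : Integrable (Function.uncurry fun (θ : ℝ) (y : V) =>
      κ y * F (a + circleMap 0 1 θ • b - y))
      ((volume.restrict (Ioc 0 (2 * Real.pi))).prod volume) := by
    have h1 : Integrable (fun _ : ℝ => M) (volume.restrict (Ioc 0 (2 * Real.pi))) := by
      exact integrable_const M
    have h2 := h1.mul_prod (g := κ) (hκ.integrable_of_hasCompactSupport (μ := volume) hκc)
    refine h2.mono' ?_ ?_
    · refine Continuous.aestronglyMeasurable ?_
      have : Continuous fun q : ℝ × V => κ q.2 * F (a + circleMap 0 1 q.1 • b - q.2) := by fun_prop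
      exact this
    · have hr : (volume.restrict (Ioc 0 (2 * Real.pi))).prod (volume : Measure V)
          = (volume.prod volume).restrict (Ioc 0 (2 * Real.pi) ×ˢ univ) := by
        rw [← Measure.prod_restrict, Measure.restrict_univ]
      rw [hr]
      filter_upwards [ae_restrict_mem (measurableSet_Ioc.prod MeasurableSet.univ)] with q hq
      by_cases hy : q.2 ∈ tsupport κ
      · have := hM q ⟨Ioc_subset_Icc_self hq.1, hy⟩
        simp only [Function.uncurry, norm_mul, Real.norm_of_nonneg (hκ0 _)]
        rw [mul_comm]
        exact mul_le_mul_of_nonneg_right this (hκ0 _)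
      · simp [Function.uncurry, image_eq_zero_of_notMem_tsupport hy]
  calc ∫ y, κ y * F (a - y)
      ≤ ∫ y, κ y * circleAverage (fun w => F (a - y + w • b)) 0 1 := by
        refine integral_mono (hi _ (by fun_prop)) (hi _ ?_) fun y => ?_
        · simp only [Real.circleAverage_def, smul_eq_mul]
          refine continuous_const.mul ?_
          refine intervalIntegral.continuous_parametric_intervalIntegral_of_continuous' ?_ _ _
          simp only [Function.uncurry_def]
          fun_prop
        · by_cases hy : κ y = 0
          · simp [hy]
          · exact mul_le_mul_of_nonneg_left (h y hy) (hκ0 y)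
    _ = _ := by
        simp only [Real.circleAverage_def]
        simp only [intervalIntegral.integral_of_le Real.two_pi_pos.le]
        rw [integral_integral_swap hint, smul_eq_mul, ← integral_const_mul]
        refine integral_congr_ae (Eventually.of_forall fun y => ?_)
        dsimp only
        rw [integral_const_mul, smul_eq_mul]
        simp only [sub_add_eq_add_sub]
        ring


theorem leviDir_nonneg_of_circleSubmean {v : V → ℝ} (hv : ContDiff ℝ ∞ v) {s : Set V}
    (h : CircleSubmean v s) {x : V} (hs : s ∈ 𝓝 x) (X : V) : 0 ≤ leviDir v x X := by
  have hd : ∀ y, HasFDerivAt v (fderiv ℝ v y) y := fun y =>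
    (hv.differentiable (by simp) y).hasFDerivAt
  have hv1 : ContDiff ℝ ∞ (fderiv ℝ v) := hv.fderiv_right (by simp)
  set Q := fderiv ℝ (fderiv ℝ v) x with hQ
  have hQd : HasFDerivAt (fderiv ℝ v) Q x := (hv1.differentiable (by simp) x).hasFDerivAt
  have hsym : ∀ Y Z, Q Y Z = Q Z Y := fun Y Z =>
    second_derivative_symmetric (f := v) hd hQd Y Z
  have taylor : ∀ ε > 0, ∃ δ > 0, ∀ Y : V, ‖Y‖ < δ →
      v (x + Y) ≤ v x + fderiv ℝ v x Y + (1 / 2) * Q Y Y + ε * ‖Y‖ ^ 2 := by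
    intro ε hε
    obtain ⟨δ, hδ, hδQ⟩ := Metric.eventually_nhds_iff.1
      (hasFDerivAt_iff_isLittleO_nhds_zero.1 hQd |>.def hε)
    refine ⟨δ, hδ, fun Y hY => ?_⟩
    have hG : ∀ Z, HasFDerivAt (fun Z => v (x + Z) - fderiv ℝ v x Z - (1 / 2) * Q Z Z)
        (fderiv ℝ v (x + Z) - fderiv ℝ v x - Q Z) Z := by
      intro Z
      have h1 : HasFDerivAt (fun Z => v (x + Z)) (fderiv ℝ v (x + Z)) Z := by
        have := (hd (x + Z)).comp Z ((hasFDerivAt_id Z).const_add x)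
        rwa [ContinuousLinearMap.comp_id] at this
      have h2 := (Q.hasFDerivAt (x := Z)).clm_apply (hasFDerivAt_id Z)
      refine ((h1.sub (fderiv ℝ v x).hasFDerivAt).sub (h2.const_mul (1 / 2))).congr_fderiv ?_
      ext T
      simp [hsym T Z]
      ring
    have hb := (convex_closedBall (0 : V) ‖Y‖).norm_image_sub_le_of_norm_hasFDerivWithin_le
      (fun Z _ => (hG Z).hasFDerivWithinAt) (C := ε * ‖Y‖) (fun Z hZ => ?_)
      (mem_closedBall_self (norm_nonneg Y)) (y := Y) (by simp)
    · have := (abs_le.1 hb).2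
      simp only [add_zero, map_zero, sub_zero, mul_zero] at this
      nlinarith
    · have hZ' : ‖Z‖ ≤ ‖Y‖ := by simpa using hZ
      refine (hδQ (by simpa using hZ'.trans_lt hY)).trans ?_
      exact mul_le_mul_of_nonneg_left hZ' hε.le
  refine le_of_forall_pos_le_add fun ε hε => ?_
  obtain ⟨δ, hδ, ht⟩ := taylor (ε / (‖X‖ ^ 2 + 1)) (by positivity)
  obtain ⟨ρ, hρ, hρs⟩ := Metric.mem_nhds_iff.1 hs
  obtain ⟨c, hc, hcX⟩ : ∃ c : ℝ, 0 < c ∧ c * ‖X‖ < min δ ρ := by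
    refine ⟨min δ ρ / (‖X‖ + 1), by positivity, ?_⟩
    rw [div_mul_eq_mul_div, div_lt_iff₀ (by positivity)]
    nlinarith [norm_nonneg X, lt_min hδ hρ]
  have hn : ∀ w : ℂ, ‖w • c • X‖ = ‖w‖ * (c * ‖X‖) := fun w => by
    rw [norm_smul, norm_smul, Real.norm_of_nonneg hc.le]
  have hm := h x (c • X) fun w hw => hρs (by
    rw [mem_ball, dist_eq_norm, add_sub_cancel_left, hn]
    have := min_le_right δ ρ
    have : 0 ≤ c * ‖X‖ := by positivity
    nlinarith [norm_nonneg w])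
  set J := Complex.I • X with hJ
  set ε' := ε / (‖X‖ ^ 2 + 1) with hε'
  let P : Polynomial ℂ := Polynomial.C ((v x + c ^ 2 / 4 * (Q X X + Q J J) + ε' * c ^ 2 * ‖X‖ ^ 2
      : ℝ) : ℂ) + Polynomial.C ((c : ℂ) * ⟨fderiv ℝ v x X, -fderiv ℝ v x J⟩) * Polynomial.X +
      Polynomial.C (((c ^ 2 / 2 : ℝ) : ℂ) * ⟨(Q X X - Q J J) / 2, -(Q X J + Q J X) / 2⟩) *
        Polynomial.X ^ 2
  have hP : circleAverage (fun w => v (x + w • c • X)) 0 1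
      ≤ circleAverage (fun w => (P.eval w).re) 0 1 := by
    refine Real.circleAverage_mono ?_ ?_ fun w hw => ?_
    · refine ContinuousOn.circleIntegrable zero_le_one ?_
      have := hv.continuous
      fun_prop
    · exact ContinuousOn.circleIntegrable zero_le_one (by fun_prop)
    · have hw1 : ‖w‖ = 1 := by simpa using hw
      have hw2 : w.re ^ 2 + w.im ^ 2 = 1 := by
        have := Complex.sq_norm w
        rw [hw1, Complex.normSq_apply] at this
        linarith
      refine (ht (w • c • X) (by rw [hn, hw1, one_mul]; exact hcX.trans_le (min_le_left _ _))).trans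
        (le_of_eq ?_)
      rw [hn, hw1, one_mul, mul_pow]
      have hw3 : w • c • X = (c * w.re) • X + (c * w.im) • J := by
        rw [smul_comm, real_smul_add_I_smul w X, smul_add, smul_smul, smul_smul]
      rw [hw3]
      simp only [map_add, map_smul, add_apply, smul_apply,
        smul_eq_mul, P, Polynomial.eval_add, Polynomial.eval_mul, Polynomial.eval_C,
        Polynomial.eval_X, Polynomial.eval_pow, Complex.add_re, Complex.mul_re, Complex.mul_im,
        Complex.ofReal_re, Complex.ofReal_im, pow_two w]
      linear_combination (c ^ 2 / 4 * (Q X X + Q J J)) * hw2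
  rw [Polynomial.circleAverage_re] at hP
  have h0 : (P.eval 0).re = v x + c ^ 2 / 4 * (Q X X + Q J J) + ε' * c ^ 2 * ‖X‖ ^ 2 := by
    simp [P, -Complex.ofReal_add, -Complex.ofReal_mul]
  rw [h0] at hP
  have hl : leviDir v x X = 1 / 4 * (Q X X + Q J J) := rfl
  have h1 : 0 ≤ c ^ 2 * (leviDir v x X + ε' * ‖X‖ ^ 2) := by rw [hl]; linarith
  have h2 : ε' * ‖X‖ ^ 2 ≤ ε := by
    rw [hε', div_mul_eq_mul_div, div_le_iff₀ (by positivity)]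
    nlinarith
  have h3 := nonneg_of_mul_nonneg_right h1 (by positivity)
  linarith

theorem exists_contDiff_approx {Ω : Set V} (hΩ : IsOpen Ω) {Φ : V → ℝ} (hΦ : ContinuousOn Φ Ω)
    (hs : CircleSubmean Φ Ω) {K : Set V} (hK : IsCompact K) (hKΩ : K ⊆ Ω) {δ : ℝ} (hδ : 0 < δ) :
    ∃ v : V → ℝ, ContDiff ℝ ∞ v ∧ (∀ x ∈ K, |v x - Φ x| ≤ δ) ∧
      ∀ x ∈ interior K, ∀ X, 0 ≤ leviDir v x X := by
  let _ := FiniteDimensional.complexToReal V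
  let _ := FiniteDimensional.proper_real V
  obtain ⟨K', hK', hKK', hK'Ω⟩ := exists_compact_between hK hΩ hKΩ
  obtain ⟨η, hη, hηc, hηs, -, -, hη1⟩ := exists_smooth_cutoff hK' hΩ hK'Ω
  set F : V → ℝ := fun x => η x * Φ x with hFdef
  have hFc : Continuous F := by
    refine (hη.continuous.continuousOn.mul hΦ).continuous_of_tsupport_subset hΩ ?_
    exact (closure_mono (show Function.support F ⊆ Function.support η from
      fun x hx h => hx (by simp [hFdef, h]))).trans hηs
  have hFs : HasCompactSupport F := hηc.mul_right
  have hFΦ : ∀ x ∈ K', F x = Φ x := fun x hx => by rw [hFdef]; simp [hη1 x hx]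
  obtain ⟨r₁, hr₁, hu⟩ := Metric.uniformContinuous_iff.1
    (hFs.uniformContinuous_of_continuous hFc) δ hδ
  obtain ⟨r₂, hr₂, ht⟩ := hK.exists_thickening_subset_open isOpen_interior hKK'
  set r := min r₁ r₂ with hrdef
  have hr : 0 < r := lt_min hr₁ hr₂
  have hlt : ∀ y : V, kern r y ≠ 0 → ‖y‖ < r := fun y hy => by
    by_contra! h
    exact hy (kern_eq_zero hr h)
  have hval : ∀ x, (moll (kern r) (toC F) x).re = ∫ y, kern r y * F (x - y) := fun x => by
    rw [moll_toC, Complex.ofReal_re]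
  have hv : ContDiff ℝ ∞ fun x => (moll (kern r) (toC F) x).re :=
    Complex.reCLM.contDiff.comp (contDiff_moll (contDiff_kern r) (hasCompactSupport_kern hr)
      (Complex.continuous_ofReal.comp hFc).locallyIntegrable)
  refine ⟨_, hv, fun x hx => ?_, fun x hx X => ?_⟩
  · rw [hval, ← hFΦ x (interior_subset (hKK' hx))]
    have h1 : F x = ∫ y : V, kern r y * F x := by
      rw [integral_mul_const, integral_kern hr, one_mul]
    have hi : ∀ g : V → ℝ, Continuous g → Integrable fun y => kern r y * g y := fun g hg =>
      ((contDiff_kern r).continuous.mul hg).integrable_of_hasCompactSupport (μ := volume)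
        (hasCompactSupport_kern hr).mul_right
    rw [h1, ← integral_sub (hi _ (by fun_prop)) (hi _ (by fun_prop))]
    have h2 : δ = ∫ y : V, kern r y * δ := by
      rw [integral_mul_const, integral_kern hr, one_mul]
    rw [h2, ← Real.norm_eq_abs]
    refine norm_integral_le_of_norm_le (hi _ (by fun_prop)) (Eventually.of_forall fun y => ?_)
    rw [← mul_sub, norm_mul, Real.norm_of_nonneg (kern_nonneg hr y)]
    by_cases hy : kern r y = 0
    · simp [hy]
    · refine mul_le_mul_of_nonneg_left (hu ?_).le (kern_nonneg hr y)
      rw [dist_eq_norm, sub_sub_cancel_left, norm_neg]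
      exact (hlt y hy).trans_le (min_le_left _ _)
  · refine leviDir_nonneg_of_circleSubmean hv (s := interior K) ?_
      (isOpen_interior.mem_nhds hx) X
    intro a b hab
    simp only [hval]
    refine integral_mul_comp_le_circleAverage (contDiff_kern r).continuous
      (hasCompactSupport_kern hr) (kern_nonneg hr) hFc fun y hy => ?_
    have hmem : ∀ w : ℂ, ‖w‖ ≤ 1 → a - y + w • b ∈ K' := fun w hw => by
      refine interior_subset (ht (Metric.mem_thickening_iff.2
        ⟨a + w • b, interior_subset (hab w hw), ?_⟩))
      rw [dist_eq_norm, sub_add_eq_add_sub, sub_sub_cancel_left, norm_neg]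
      exact (hlt y hy).trans_le (min_le_right _ _)
    have h0 := hmem 0 (by simp)
    rw [zero_smul, add_zero] at h0
    rw [hFΦ _ h0]
    refine (hs (a - y) b fun w hw => hK'Ω (hmem w hw)).trans_eq ?_
    refine Real.circleAverage_congr_sphere fun w hw => ?_
    exact (hFΦ _ (hmem w (by simpa using hw.le))).symm

end Regularization

section Weights

theorem exists_convex_vanishing (s : ℝ) : ∃ l l₁ l₂ : ℝ → ℝ, ContDiff ℝ ∞ l ∧
    (∀ t, HasDerivAt l (l₁ t) t) ∧ (∀ t, HasDerivAt l₁ (l₂ t) t) ∧ (∀ t, 0 ≤ l₁ t) ∧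
    (∀ t, 0 ≤ l₂ t) ∧ (∀ t ≤ s, l t = 0) ∧ ∀ t₀ > s, ∃ m > 0, ∀ t ≥ t₀, m ≤ l₁ t := by
  let k : ℝ → ℝ := fun t => t * expNegInvGlue t
  let k₁ : ℝ → ℝ := fun t => (1 + t⁻¹) * expNegInvGlue t
  let k₂ : ℝ → ℝ := fun t => t⁻¹ ^ 3 * expNegInvGlue t
  have hk₁ : ∀ t, HasDerivAt k (k₁ t) t := fun t => by
    have h1 := expNegInvGlue.hasDerivAt_polynomial_eval_inv_mul 1 t
    simp only [Polynomial.eval_one, one_mul, Polynomial.derivative_one, sub_zero, mul_one,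
      Polynomial.eval_pow, Polynomial.eval_X] at h1
    refine ((hasDerivAt_id t).mul h1).congr_deriv ?_
    simp only [k₁, id]
    rcases eq_or_ne t 0 with rfl | ht
    · simp
    · field_simp
  have hk₂ : ∀ t, HasDerivAt k₁ (k₂ t) t := fun t => by
    have h1 := expNegInvGlue.hasDerivAt_polynomial_eval_inv_mul (1 + Polynomial.X) t
    simp only [Polynomial.eval_add, Polynomial.eval_one, Polynomial.eval_X, Polynomial.derivative_add,
      Polynomial.derivative_one, Polynomial.derivative_X, zero_add, add_sub_cancel_left,
      Polynomial.eval_mul, Polynomial.eval_pow] at h1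
    refine h1.congr_deriv ?_
    simp only [k₂]
    ring
  have hk₁0 : ∀ t, 0 ≤ k₁ t := fun t => by
    rcases le_or_gt t 0 with ht | ht
    · simp [k₁, expNegInvGlue.zero_of_nonpos ht]
    · have := expNegInvGlue.pos_of_pos ht
      simp only [k₁]
      positivity
  have hk₂0 : ∀ t, 0 ≤ k₂ t := fun t => by
    rcases le_or_gt t 0 with ht | ht
    · simp [k₂, expNegInvGlue.zero_of_nonpos ht]
    · have := expNegInvGlue.pos_of_pos ht
      simp only [k₂]
      positivity
  refine ⟨fun t => k (t - s), fun t => k₁ (t - s), fun t => k₂ (t - s), ?_,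
    fun t => (hk₁ (t - s)).comp_sub_const t s, fun t => (hk₂ (t - s)).comp_sub_const t s,
    fun t => hk₁0 _, fun t => hk₂0 _, fun t ht => ?_, fun t₀ ht₀ => ?_⟩
  · exact (contDiff_id.mul expNegInvGlue.contDiff).comp (contDiff_id.sub contDiff_const)
  · simp [k, expNegInvGlue.zero_of_nonpos (sub_nonpos.2 ht)]
  · refine ⟨k₁ (t₀ - s), ?_, fun t ht => ?_⟩
    · have := expNegInvGlue.pos_of_pos (sub_pos.2 ht₀)
      have := sub_pos.2 ht₀
      simp only [k₁]
      positivity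
    · refine monotone_of_deriv_nonneg (fun t => (hk₂ t).differentiableAt) (fun t => ?_)
        (sub_le_sub_right ht s)
      rw [(hk₂ t).deriv]
      exact hk₂0 t

variable {V : Type*} [NormedAddCommGroup V] [InnerProductSpace ℂ V]

theorem isTest_toC {W : Set V} {η : V → ℝ} (hη : ContDiff ℝ ∞ η) (hc : HasCompactSupport η)
    (hs : tsupport η ⊆ W) : IsTest W (toC η) := by
  have h : Function.support (toC η) ⊆ Function.support η := fun x hx h => hx (by simp [toC, h])
  exact ⟨contDiff_toC hη, hc.mono h, (closure_mono h).trans hs⟩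

theorem del_eq_zero_of_eventuallyEq_const {σ : ℂ} {v : V} {k : V → ℂ} {c : ℂ} {x : V}
    (h : k =ᶠ[𝓝 x] fun _ => c) : del σ v k x = 0 := by
  simp [del, h.fderiv_eq]

variable [FiniteDimensional ℂ V] [MeasureSpace V] [BorelSpace V]
  [(volume : Measure V).IsAddHaarMeasure] {ι : Type*} [Fintype ι]

/-- The basic estimate on sublevel sets of a strictly plurisubharmonic exhaustion function `Φ`,
with weights formed from smooth approximations of `Φ`. -/
theorem exists_smooth_weight_estimate (e : OrthonormalBasis ι ℂ V) {Ω : Set V} (hΩ : IsOpen Ω)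
    {Φ : V → ℝ} (hΦ : ContinuousOn Φ Ω) (hs : CircleSubmean (fun z => Φ z - ‖z‖ ^ 2) Ω)
    (hex : ∀ c, IsCompact {z ∈ Ω | Φ z ≤ c}) (b : ℝ) {δ : ℝ} (hδ : 0 < δ) (hδ4 : δ ≤ 1 / 4) :
    ∃ v : V → ℝ, ContDiff ℝ ∞ v ∧ (∀ x ∈ Ω, Φ x < b → |v x - Φ x| ≤ δ) ∧
      ∀ N m ε : ℝ, ∀ p : V, 1 ≤ N → 0 ≤ m → 0 < ε → ∀ χ : V → ℂ, IsTest {z ∈ Ω | Φ z < b} χ →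
      ∀ h : ι → V → ℂ, (∀ i, IsTest {z ∈ Ω | Φ z < b} (h i)) →
      ‖∫ x, ∑ i, conj (del 1 (e i) χ x) * h i x‖ ^ 2
        ≤ (∫ x, (∑ i, ‖del 1 (e i) χ x‖ ^ 2)
            * expNeg (fun z => N * v z + m * Real.log (‖z - p‖ ^ 2 + ε)) x)
          * ∫ x, ‖∑ i, del (-1) (e i) (h i) x‖ ^ 2
            * Real.exp (N * v x + m * Real.log (‖x - p‖ ^ 2 + ε)) := by
  have hopen : ∀ c, IsOpen {z ∈ Ω | Φ z < c} := fun c =>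
    hΦ.isOpen_inter_preimage hΩ (isOpen_Iio (a := c))
  set K := {z ∈ Ω | Φ z ≤ b + 5}
  set W := {z ∈ Ω | Φ z < b + 5} with hWdef
  have hWK : W ⊆ interior K := interior_maximal (fun z hz => ⟨hz.1, hz.2.le⟩) (hopen _)
  obtain ⟨v₀, hv₀, hvK, hvL⟩ := exists_contDiff_approx hΩ
    (hΦ.sub (continuous_norm.pow 2).continuousOn) hs (hex (b + 5)) (fun z hz => hz.1) hδ
  set v : V → ℝ := fun z => v₀ z + ‖z - 0‖ ^ 2 with hvdef
  have hv : ContDiff ℝ ∞ v := hv₀.add (contDiff_norm_sub_sq 0)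
  have hvΦ : ∀ x ∈ Ω, Φ x < b + 5 → |v x - Φ x| ≤ δ := fun x hx hb => by
    have h : |v₀ x - (Φ x - ‖x‖ ^ 2)| ≤ δ := hvK x ⟨hx, hb.le⟩
    have h1 : v x - Φ x = v₀ x - (Φ x - ‖x‖ ^ 2) := by simp only [hvdef, sub_zero]; ring
    rwa [h1]
  have hvX : ∀ x ∈ W, ∀ X, ‖X‖ ^ 2 ≤ leviDir v x X := fun x hx X => by
    rw [hvdef, leviDir_add hv₀ (contDiff_norm_sub_sq 0), leviDir_norm_sub_sq]
    linarith [hvL x (hWK hx) X]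
  have hnorm : ∀ ξ : ι → ℂ, ‖∑ i, ξ i • e i‖ ^ 2 = ∑ i, ‖ξ i‖ ^ 2 := fun ξ => by
    rw [← EuclideanSpace.norm_sq_eq (WithLp.toLp 2 ξ),
      ← e.repr.symm.norm_map (WithLp.toLp 2 ξ), ← e.sum_repr_symm]
  obtain ⟨l, l₁, l₂, hl, hl₁, hl₂, hl₁0, hl₂0, hl0, hlm⟩ := exists_convex_vanishing (b + 1 / 2)
  obtain ⟨μ, hμ, hμl⟩ := hlm (b + 3 / 4) (by linarith)
  have cut : ∀ c d, c < d → ∃ η : V → ℝ, ContDiff ℝ ∞ η ∧ HasCompactSupport η ∧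
      tsupport η ⊆ {z ∈ Ω | Φ z < d} ∧ ∀ x ∈ Ω, Φ x ≤ c → η x = 1 := fun c d hcd => by
    obtain ⟨η, h1, h2, h3, -, -, h4⟩ := exists_smooth_cutoff (hex c) (hopen d)
      (fun z hz => ⟨hz.1, hz.2.trans_lt hcd⟩)
    exact ⟨η, h1, h2, h3, fun x hx hc => h4 x ⟨hx, hc⟩⟩
  obtain ⟨η₀, hη₀, hη₀c, hη₀s, hη₀1⟩ := cut (b + 1) (b + 3) (by linarith)
  obtain ⟨η₁, hη₁, hη₁c, hη₁s, hη₁1⟩ := cut (b + 3) (b + 5) (by linarith)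
  have hη₀t : IsTest W (toC η₀) := isTest_toC hη₀ hη₀c fun x hx =>
    ⟨(hη₀s hx).1, (hη₀s hx).2.trans (by linarith)⟩
  obtain ⟨M, hM⟩ := (hasCompactSupport_gradSq (e := e) hη₀t).exists_bound_of_continuous
      (continuous_gradSq hη₀)
  have hM0 : 0 ≤ M := (norm_nonneg _).trans (hM 0)
  have hl₁c : Continuous l₁ := continuous_iff_continuousAt.2 fun t => (hl₂ t).continuousAt
  refine ⟨v, hv, fun x hx hb => hvΦ x hx (by linarith), fun N m ε p hN hm hε χ hχ h hh => ?_⟩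
  have hψ : ContDiff ℝ ∞ fun z => N * v z + m * Real.log (‖z - p‖ ^ 2 + ε) :=
    (contDiff_const.mul hv).add (contDiff_const.mul (contDiff_log_norm_sub_sq p hε))
  refine basic_estimate (e := e) hψ (hl.comp hv) (τ := fun x => l₁ (v x)) (hopen (b + 5)) (hopen b)
    (fun x hx => ⟨hx.1, hx.2.trans (by linarith)⟩) (hl₁c.comp hv.continuous) (fun x => hl₁0 _)
    (fun x hx ξ => ?_) (fun x hx ξ => ?_) hη₀ hη₁ hη₀t (isTest_toC hη₁ hη₁c hη₁s)
    (fun x hx => hη₀1 x hx.1 (by linarith [hx.2])) (fun x hx => hη₁1 x hx.1 (by linarith [hx.2]))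
    (fun x hx => ?_) (C₀ := M / μ) (by positivity) (fun x => ?_) hχ hh
  · rw [leviForm_eq hψ, leviDir_add (contDiff_const.mul hv)
      (contDiff_const.mul (contDiff_log_norm_sub_sq p hε)), leviDir_const_mul hv,
      leviDir_const_mul (contDiff_log_norm_sub_sq p hε), ← hnorm]
    have h1 := hvX x hx (∑ i, ξ i • e i)
    have h2 := mul_nonneg hm (leviDir_log_nonneg p hε x (∑ i, ξ i • e i))
    have h3 := sq_nonneg ‖∑ i, ξ i • e i‖
    nlinarith
  · rw [leviForm_eq (hl.comp hv), ← hnorm]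
    exact (mul_le_mul_of_nonneg_left (hvX x hx _) (hl₁0 _)).trans
      (leviDir_comp_ge hv (fun x => hl₁ _) (fun x => hl₂ _) x _ (hl₂0 _))
  · have := (abs_le.1 (hvΦ x hx.1 (by linarith [hx.2]))).2
    exact hl0 _ (by linarith [hx.2])
  · have hr0 : 0 ≤ M / μ * (l₁ (v x) * η₁ x ^ 2) := by
      have := hl₁0 (v x)
      positivity
    have hz : (∀ i, del 1 (e i) (toC η₀) x = 0) → gradSq e η₀ x ≤ M / μ * (l₁ (v x) * η₁ x ^ 2) :=
      fun h0 => by simpa [gradSq, h0] using hr0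
    by_cases hx : x ∈ tsupport (toC η₀)
    · obtain ⟨hxΩ, hx3⟩ : x ∈ {z ∈ Ω | Φ z < b + 3} :=
        hη₀s (closure_mono (show Function.support (toC η₀) ⊆ Function.support η₀ from
          fun x hx h => hx (by simp [toC, h])) hx)
      by_cases hx1 : Φ x < b + 1
      · refine hz fun i => del_eq_zero_of_eventuallyEq_const (c := 1) ?_
        filter_upwards [(hopen (b + 1)).mem_nhds ⟨hxΩ, hx1⟩] with y hy
        simp [toC, hη₀1 y hy.1 hy.2.le]
      · have h1 := (abs_le.1 (hvΦ x hxΩ (by linarith))).1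
        rw [hη₁1 x hxΩ hx3.le, one_pow, mul_one, div_mul_eq_mul_div, le_div_iff₀ hμ]
        exact mul_le_mul ((le_abs_self _).trans (hM x)) (hμl _ (by linarith)) hμ.le hM0
    · exact hz fun i => del_eq_zero_of_notMem hx

end Weights

section Duality

theorem exists_inner_eq_of_norm_le {D H : Type*} [AddCommGroup D] [Module ℂ D]
    [NormedAddCommGroup H] [InnerProductSpace ℂ H] [CompleteSpace H] (A : D →ₗ[ℂ] H)
    (l : D →ₗ[ℂ] ℂ) {C : ℝ} (hC : 0 ≤ C) (h : ∀ x, ‖l x‖ ≤ C * ‖A x‖) :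
    ∃ u : H, ‖u‖ ≤ C ∧ ∀ x, l x = inner ℂ u (A x) := by
  have hk : LinearMap.ker A ≤ LinearMap.ker l := fun x hx => by
    have := h x
    rw [LinearMap.mem_ker.1 hx, norm_zero, mul_zero] at this
    exact LinearMap.mem_ker.2 (norm_le_zero_iff.1 this)
  let f : LinearMap.range A →ₗ[ℂ] ℂ :=
    ((LinearMap.ker A).liftQ l hk).comp A.quotKerEquivRange.symm.toLinearMap
  have hf : ∀ x, f ⟨A x, LinearMap.mem_range_self A x⟩ = l x := fun x => by
    have : A.quotKerEquivRange.symm ⟨A x, LinearMap.mem_range_self A x⟩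
        = (LinearMap.ker A).mkQ x := A.quotKerEquivRange_symm_apply_image x _
    simp [f, this]
  let g := f.mkContinuous C (by
    rintro ⟨_, x, rfl⟩
    rw [hf]
    exact h x)
  obtain ⟨G, hG, hGn⟩ := exists_extension_norm_eq (LinearMap.range A) g
  refine ⟨(InnerProductSpace.toDual ℂ H).symm G, ?_, fun x => ?_⟩
  · rw [LinearIsometryEquiv.norm_map, hGn]
    exact LinearMap.mkContinuous_norm_le _ hC _
  · rw [InnerProductSpace.toDual_symm_apply, ← hf x]
    exact (hG ⟨A x, LinearMap.mem_range_self A x⟩).symm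

end Duality

section Solution

variable {V : Type*} [NormedAddCommGroup V] [InnerProductSpace ℂ V]

theorem continuous_mul_of_tsupport_subset {F : Type*} [NormedRing F] {Ω : Set V} (hΩ : IsOpen Ω)
    {k g : V → F} (hk : Continuous k) (hs : tsupport k ⊆ Ω) (hg : ContinuousOn g Ω) :
    Continuous fun x => k x * g x :=
  (hk.continuousOn.mul hg).continuous_of_tsupport_subset hΩ
    ((closure_mono (show Function.support (fun x => k x * g x) ⊆ Function.support k from
      fun x hx h => hx (by simp [h]))).trans hs)

variable [FiniteDimensional ℂ V] [MeasureSpace V] [BorelSpace V]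
  [(volume : Measure V).IsAddHaarMeasure] {ι : Type*} [Fintype ι]

theorem integrable_mul_of_tsupport_subset {F : Type*} [NormedRing F] {Ω : Set V} (hΩ : IsOpen Ω)
    {k g : V → F} (hk : Continuous k) (hc : HasCompactSupport k) (hs : tsupport k ⊆ Ω)
    (hg : ContinuousOn g Ω) : Integrable fun x => k x * g x :=
  (continuous_mul_of_tsupport_subset hΩ hk hs hg).integrable_of_hasCompactSupport hc.mul_right

theorem IsTest.sum {Ω : Set V} (s : Finset ι) {k : ι → V → ℂ} (h : ∀ i, IsTest Ω (k i)) :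
    IsTest Ω fun x => ∑ i ∈ s, k i x := by
  classical
  induction s using Finset.induction_on with
  | empty => simpa using IsTest.zero
  | insert a s ha ih => simpa [Finset.sum_insert ha] using (h a).add ih

/-- The basic estimate on `Ω` for the (non-smooth) weight `N Φ + m log (‖z - p‖² + ε)`, where `Φ`
is a strictly plurisubharmonic exhaustion function. -/
theorem test_estimate (e : OrthonormalBasis ι ℂ V) {Ω : Set V} (hΩ : IsOpen Ω)
    {Φ : V → ℝ} (hΦ : ContinuousOn Φ Ω) (hs : CircleSubmean (fun z => Φ z - ‖z‖ ^ 2) Ω)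
    (hex : ∀ c, IsCompact {z ∈ Ω | Φ z ≤ c}) {N m ε : ℝ} (p : V) (hN : 1 ≤ N) (hm : 0 ≤ m)
    (hε : 0 < ε) {χ : V → ℂ} (hχ : IsTest Ω χ) {h : ι → V → ℂ} (hh : ∀ i, IsTest Ω (h i)) :
    ‖∫ x, ∑ i, conj (del 1 (e i) χ x) * h i x‖ ^ 2
      ≤ Real.exp 1 * (∫ x, (∑ i, ‖del 1 (e i) χ x‖ ^ 2)
          * Real.exp (-(N * Φ x + m * Real.log (‖x - p‖ ^ 2 + ε))))
        * ∫ x, ‖∑ i, del (-1) (e i) (h i) x‖ ^ 2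
          * Real.exp (N * Φ x + m * Real.log (‖x - p‖ ^ 2 + ε)) := by
  obtain ⟨b, hb⟩ : ∃ b, ∀ x ∈ tsupport χ ∪ ⋃ i, tsupport (h i), Φ x < b := by
    have hc : IsCompact (tsupport χ ∪ ⋃ i, tsupport (h i)) :=
      hχ.compact.isCompact.union (isCompact_iUnion fun i => (hh i).compact.isCompact)
    obtain ⟨C, hC⟩ := hc.exists_bound_of_continuousOn
      (hΦ.mono (union_subset hχ.subset (iUnion_subset fun i => (hh i).subset)))
    exact ⟨C + 1, fun x hx => by linarith [(le_abs_self _).trans (hC x hx)]⟩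
  have hχ' : IsTest {z ∈ Ω | Φ z < b} χ :=
    ⟨hχ.contDiff, hχ.compact, fun x hx => ⟨hχ.subset hx, hb x (Or.inl hx)⟩⟩
  have hh' : ∀ i, IsTest {z ∈ Ω | Φ z < b} (h i) := fun i =>
    ⟨(hh i).contDiff, (hh i).compact, fun x hx => ⟨(hh i).subset hx,
      hb x (Or.inr (mem_iUnion.2 ⟨i, hx⟩))⟩⟩
  obtain ⟨v, hv, hvΦ, hest⟩ := exists_smooth_weight_estimate e hΩ hΦ hs hex b
    (δ := min (1 / 4) (1 / (2 * N))) (by positivity) (min_le_left _ _)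
  have hclose : ∀ x ∈ {z ∈ Ω | Φ z < b}, |N * v x - N * Φ x| ≤ 1 / 2 := fun x hx => by
    rw [← mul_sub, abs_mul, abs_of_pos (by linarith : 0 < N)]
    have h1 := (hvΦ x hx.1 hx.2).trans (min_le_right _ _)
    calc N * |v x - Φ x| ≤ N * (1 / (2 * N)) := by gcongr
      _ = 1 / 2 := by field_simp
  have hL : Continuous fun x : V => m * Real.log (‖x - p‖ ^ 2 + ε) :=
    continuous_const.mul (contDiff_log_norm_sub_sq p hε).continuous
  have hw : ContinuousOn (fun x => N * Φ x + m * Real.log (‖x - p‖ ^ 2 + ε)) Ω :=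
    (continuousOn_const.mul hΦ).add hL.continuousOn
  have compare : ∀ S : V → ℝ, Continuous S → HasCompactSupport S →
      tsupport S ⊆ {z ∈ Ω | Φ z < b} → (∀ x, 0 ≤ S x) → ∀ a c : V → ℝ, Continuous a →
      ContinuousOn c Ω → (∀ x ∈ {z ∈ Ω | Φ z < b}, a x ≤ c x + 1 / 2) →
      ∫ x, S x * Real.exp (a x) ≤ Real.exp (1 / 2) * ∫ x, S x * Real.exp (c x) := by
    intro S hS hSc hSs hS0 a c ha hc hac
    rw [← integral_const_mul]
    have hsub := hSs.trans (sep_subset Ω _)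
    refine integral_mono (integrable_mul_of_tsupport_subset hΩ hS hSc hsub
      (Real.continuous_exp.comp ha).continuousOn)
      ((integrable_mul_of_tsupport_subset hΩ hS hSc hsub
        (Real.continuous_exp.comp_continuousOn hc)).const_mul _) fun x => ?_
    by_cases hx : x ∈ tsupport S
    · have := Real.exp_le_exp.2 (hac x (hSs hx))
      rw [Real.exp_add] at this
      calc S x * Real.exp (a x) ≤ S x * (Real.exp (c x) * Real.exp (1 / 2)) := by
            gcongr
            exact hS0 x
        _ = _ := by ring
    · simp [image_eq_zero_of_notMem_tsupport hx]
  have hS := compare (fun x => ∑ i, ‖del 1 (e i) χ x‖ ^ 2)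
    (continuous_finsetSum _ fun i _ => (hχ'.del 1 (e i)).continuous.norm.pow 2)
    (hχ'.compact.mono' fun x hx => by
      by_contra hn
      exact hx (by simp [del_eq_zero_of_notMem hn]))
    ((closure_minimal (fun x hx => by
      by_contra hn
      exact hx (by simp [del_eq_zero_of_notMem hn])) (isClosed_tsupport χ)).trans hχ'.subset)
    (fun x => Finset.sum_nonneg fun _ _ => by positivity)
    (fun x => -(N * v x + m * Real.log (‖x - p‖ ^ 2 + ε)))
    (fun x => -(N * Φ x + m * Real.log (‖x - p‖ ^ 2 + ε)))
    ((continuous_const.mul hv.continuous).add hL).neg hw.neg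
    (fun x hx => by linarith [(abs_le.1 (hclose x hx)).1])
  have hdt : IsTest {z ∈ Ω | Φ z < b} fun x => ∑ i, del (-1) (e i) (h i) x :=
    IsTest.sum _ fun i => (hh' i).del (-1) (e i)
  have hsq : Function.support (fun x => ‖∑ i, del (-1) (e i) (h i) x‖ ^ 2)
      ⊆ Function.support fun x => ∑ i, del (-1) (e i) (h i) x := fun x hx hn => hx (by
    dsimp only at hn ⊢
    rw [hn]; simp)
  have hD := compare (fun x => ‖∑ i, del (-1) (e i) (h i) x‖ ^ 2)
    (hdt.continuous.norm.pow 2) (hdt.compact.mono hsq) ((closure_mono hsq).trans hdt.subset)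
    (fun x => by positivity)
    (fun x => N * v x + m * Real.log (‖x - p‖ ^ 2 + ε))
    (fun x => N * Φ x + m * Real.log (‖x - p‖ ^ 2 + ε))
    ((continuous_const.mul hv.continuous).add hL) hw
    (fun x hx => by linarith [(abs_le.1 (hclose x hx)).2])
  refine (hest N m ε p hN hm hε χ hχ' h hh').trans ((mul_le_mul hS hD
    (integral_nonneg fun x => by positivity) ?_).trans_eq ?_)
  · exact mul_nonneg (Real.exp_pos _).le (integral_nonneg fun x =>
      mul_nonneg (Finset.sum_nonneg fun _ _ => by positivity) (Real.exp_pos _).le)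
  · rw [show (1 : ℝ) = 1 / 2 + 1 / 2 by norm_num, Real.exp_add]
    norm_num
    ring

end Solution

section WeakSolution

variable {V : Type*} [NormedAddCommGroup V] [InnerProductSpace ℂ V]

/-- The space of tuples of test functions on `Ω`. -/
def testTuples (ι : Type*) (Ω : Set V) : Submodule ℂ (ι → V → ℂ) where
  carrier := {h | ∀ i, IsTest Ω (h i)}
  add_mem' hh hk i := (hh i).add (hk i)
  zero_mem' _ := IsTest.zero
  smul_mem' c _ hh i := (hh i).const_mul c

variable [FiniteDimensional ℂ V] [MeasureSpace V] [BorelSpace V]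
  [(volume : Measure V).IsAddHaarMeasure] {ι : Type*} [Fintype ι]

theorem exists_weak_solution (e : ι → V) {Ω : Set V} (hΩ : IsOpen Ω) {w : V → ℝ}
    (hw : ContinuousOn w Ω) {χ : V → ℂ} (hχ : IsTest Ω χ) {C : ℝ} (hC : 0 ≤ C)
    (hest : ∀ h : ι → V → ℂ, (∀ i, IsTest Ω (h i)) →
      ‖∫ x, ∑ i, conj (del 1 (e i) χ x) * h i x‖ ^ 2
        ≤ C * ∫ x, ‖∑ i, del (-1) (e i) (h i) x‖ ^ 2 * Real.exp (w x)) :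
    ∃ U : V → ℂ, AEStronglyMeasurable U ∧
      IntegrableOn (fun x => ‖U x‖ ^ 2 * Real.exp (-w x)) Ω ∧
      ∫ x in Ω, ‖U x‖ ^ 2 * Real.exp (-w x) ≤ C ∧ (∀ x ∉ Ω, U x = 0) ∧
      ∀ i k, IsTest Ω k → ∫ x, U x * del 1 (e i) k x = -∫ x, del 1 (e i) χ x * k x := by
  classical
  set B : V → ℂ := Ω.indicator fun x => (Real.exp (w x / 2) : ℂ) with hB
  have hBc : ContinuousOn (fun x => (Real.exp (w x / 2) : ℂ)) Ω :=
    Complex.continuous_ofReal.comp_continuousOn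
      (Real.continuous_exp.comp_continuousOn (hw.div_const 2))
  have hBm : AEStronglyMeasurable B :=
    (aestronglyMeasurable_indicator_iff hΩ.measurableSet).2
      (hBc.aestronglyMeasurable hΩ.measurableSet)
  have hd : ∀ h : testTuples ι Ω, IsTest Ω fun x => ∑ i, del (-1) (e i) (h.1 i) x := fun h =>
    IsTest.sum _ fun i => (h.2 i).del (-1) (e i)
  have hmul : ∀ k : V → ℂ, IsTest Ω k → (fun x => k x * B x)
      = fun x => k x * (Real.exp (w x / 2) : ℂ) := fun k hk => by
    ext x
    by_cases hx : x ∈ Ω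
    · rw [hB, indicator_of_mem hx]
    · simp [image_eq_zero_of_notMem_tsupport fun h => hx (hk.subset h)]
  have hmem : ∀ k : V → ℂ, IsTest Ω k → MemLp (fun x => k x * B x) 2 := fun k hk => by
    rw [hmul k hk]
    exact (continuous_mul_of_tsupport_subset hΩ hk.continuous hk.subset
      hBc).memLp_of_hasCompactSupport hk.compact.mul_right
  let A : testTuples ι Ω →ₗ[ℂ] Lp ℂ 2 (volume : Measure V) :=
    { toFun := fun h => (hmem _ (hd h)).toLp _
      map_add' := fun h k => by
        rw [← MemLp.toLp_add]
        refine MemLp.toLp_congr _ _ (Eventually.of_forall fun x => ?_)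
        dsimp only [Pi.add_apply]
        rw [← add_mul, ← Finset.sum_add_distrib]
        congr 1
        exact Finset.sum_congr rfl fun i _ =>
          del_add ((h.2 i).differentiableAt x) ((k.2 i).differentiableAt x)
      map_smul' := fun c h => by
        rw [RingHom.id_apply, ← MemLp.toLp_const_smul]
        refine MemLp.toLp_congr _ _ (Eventually.of_forall fun x => ?_)
        dsimp only [Pi.smul_apply]
        rw [smul_eq_mul, ← mul_assoc, Finset.mul_sum]
        congr 1
        exact Finset.sum_congr rfl fun i _ => del_const_mul c ((h.2 i).differentiableAt x) }
  have hi : ∀ (h : testTuples ι Ω) i, Integrable fun x => conj (del 1 (e i) χ x) * h.1 i x :=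
    fun h i => ((h.2 i).mul_left ((hχ.del 1 (e i)).star.contDiff)).integrable
  let l : testTuples ι Ω →ₗ[ℂ] ℂ :=
    { toFun := fun h => ∫ x, ∑ i, conj (del 1 (e i) χ x) * h.1 i x
      map_add' := fun h k => by
        rw [← integral_add (integrable_finsetSum _ fun i _ => hi h i)
          (integrable_finsetSum _ fun i _ => hi k i)]
        refine integral_congr_ae (Eventually.of_forall fun x => ?_)
        dsimp only
        rw [← Finset.sum_add_distrib]
        exact Finset.sum_congr rfl fun i _ => mul_add _ _ _
      map_smul' := fun c h => by
        rw [RingHom.id_apply, smul_eq_mul, ← integral_const_mul]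
        refine integral_congr_ae (Eventually.of_forall fun x => ?_)
        dsimp only
        rw [Finset.mul_sum]
        exact Finset.sum_congr rfl fun i _ => mul_left_comm _ _ _ }
  have hAn : ∀ h, ‖A h‖ ^ 2 = ∫ x, ‖∑ i, del (-1) (e i) (h.1 i) x‖ ^ 2 * Real.exp (w x) := by
    intro h
    change ‖(hmem _ (hd h)).toLp _‖ ^ 2 = _
    rw [Lp.norm_toLp, ← integral_norm_sq_eq (hmem _ (hd h))]
    congr 1
    ext x
    have hx := congrFun (hmul _ (hd h)) x
    rw [hx, norm_mul, mul_pow, Complex.norm_real, Real.norm_of_nonneg (Real.exp_pos _).le,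
      ← Real.exp_nat_mul]
    congr 2
    push_cast
    ring
  obtain ⟨u, hu, hul⟩ := exists_inner_eq_of_norm_le A l (Real.sqrt_nonneg C) fun h => by
    refine abs_le_of_sq_le_sq' ?_ (by positivity) |>.2
    rw [mul_pow, Real.sq_sqrt hC, hAn]
    exact hest h.1 h.2
  have hu2 : ∫ x, ‖u x‖ ^ 2 ≤ C := by
    rw [integral_norm_sq_eq (Lp.memLp u), ← Lp.norm_def]
    calc ‖u‖ ^ 2 ≤ (Real.sqrt C) ^ 2 := by gcongr
      _ = C := Real.sq_sqrt hC
  have hui : Integrable fun x => ‖u x‖ ^ 2 := (Lp.memLp u).integrable_norm_pow (by simp)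
  have hU : EqOn (fun x => ‖-(u x * B x)‖ ^ 2 * Real.exp (-w x)) (fun x => ‖u x‖ ^ 2) Ω :=
    fun x hx => by
      dsimp only
      rw [norm_neg, norm_mul, hB, indicator_of_mem hx, Complex.norm_real,
        Real.norm_of_nonneg (Real.exp_pos _).le, mul_pow, ← Real.exp_nat_mul, mul_assoc,
        ← Real.exp_add]
      simp [mul_div_cancel₀]
  refine ⟨fun x => -(u x * B x), ((Lp.aestronglyMeasurable u).mul hBm).neg, ?_, ?_,
    fun x hx => by simp [hB, hx], fun i k hk => ?_⟩
  · exact hui.integrableOn.congr_fun hU.symm hΩ.measurableSet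
  · rw [setIntegral_congr_fun hΩ.measurableSet hU]
    exact (setIntegral_le_integral hui (Eventually.of_forall fun x => by positivity)).trans hu2
  · let h : testTuples ι Ω := ⟨Pi.single i fun x => conj (k x), fun j => by
      by_cases hj : j = i
      · subst hj; simpa using hk.star
      · rw [Pi.single_eq_of_ne hj]; exact IsTest.zero⟩
    have h1 : l h = ∫ x, conj (del 1 (e i) χ x * k x) := by
      change ∫ x, ∑ j, conj (del 1 (e j) χ x) * h.1 j x = _
      congr 1
      ext x
      rw [Finset.sum_eq_single i]
      · simp [h]
      · intro j _ hj
        simp [h, Pi.single_eq_of_ne hj]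
      · simp
    have h2 : inner ℂ u (A h) = ∫ x, conj (u x * B x * del 1 (e i) k x) := by
      rw [L2.inner_def]
      refine integral_congr_ae ?_
      filter_upwards [(hmem _ (hd h)).coeFn_toLp] with x hx
      change inner ℂ _ (((hmem _ (hd h)).toLp _ : Lp ℂ 2 (volume : Measure V)) x) = _
      rw [hx, Finset.sum_eq_single i]
      · simp only [h, Pi.single_eq_same]
        rw [del_conj (hk.differentiableAt x)]
        have hBr : conj (B x) = B x := by
          rw [hB]
          by_cases hx : x ∈ Ω
          · rw [indicator_of_mem hx, Complex.conj_ofReal]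
          · rw [indicator_of_notMem hx, map_zero]
        simp only [RCLike.inner_apply, map_mul, hBr, map_neg, map_one, neg_neg]
        ring
      · intro j _ hj
        simp only [h, Pi.single_eq_of_ne hj]
        exact del_const _ _
      · simp
    have h3 := hul h
    rw [h1, h2, integral_conj, integral_conj] at h3
    have h4 := (starRingEnd ℂ).injective h3
    rw [h4, ← integral_neg]
    congr 1
    ext x
    ring

end WeakSolution

section Regularity

variable {V : Type*} [NormedAddCommGroup V] [InnerProductSpace ℂ V] [FiniteDimensional ℂ V]
  [MeasureSpace V] [BorelSpace V] [(volume : Measure V).IsAddHaarMeasure]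

theorem differentiableAt_of_del_eq_zero {ι : Type*} [Fintype ι] (e : OrthonormalBasis ι ℂ V)
    {f : V → ℂ} {x : V} (hf : DifferentiableAt ℝ f x) (h : ∀ i, del 1 (e i) f x = 0) :
    DifferentiableAt ℂ f x := by
  have hz : ∀ v, del 1 v f x = 0 := fun v => by
    rw [← e.sum_repr v, del_sum_dir]
    exact Finset.sum_eq_zero fun i _ => by rw [del_one_smul_dir, h, mul_zero]
  have hI : ∀ v, fderiv ℝ f x (Complex.I • v) = Complex.I * fderiv ℝ f x v := fun v => by
    have h1 := hz v
    simp only [del, one_mul] at h1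
    have h2 : fderiv ℝ f x v + Complex.I * fderiv ℝ f x (Complex.I • v) = 0 := by
      simpa using h1
    linear_combination (-Complex.I) * h2
      + fderiv ℝ f x (Complex.I • v) * Complex.I_mul_I
  refine (differentiableAt_iff_restrictScalars ℝ hf).2
    ⟨{ toFun := fderiv ℝ f x
       map_add' := map_add _
       map_smul' := fun c v => ?_
       cont := (fderiv ℝ f x).continuous }, rfl⟩
  rw [real_smul_add_I_smul c v, map_add, map_smul, map_smul, hI, RingHom.id_apply, smul_eq_mul,
    Complex.real_smul, Complex.real_smul]
  nth_rw 3 [← Complex.re_add_im c]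
  ring

theorem moll_kern_eq_of_differentiableOn {f : V → ℂ} (hfc : Continuous f) {x : V} {s s' : ℝ}
    (hs : 0 < s) (hss : s ≤ s') (hf : DifferentiableOn ℂ f (ball x s')) :
    moll (kern s) f x = f x := by
  have hkc : Continuous fun z : V => (kern s z : ℂ) :=
    Complex.continuous_ofReal.comp (contDiff_kern s).continuous
  have hgc : Continuous fun z => f (x - z) * (kern s z : ℂ) :=
    (hfc.comp (continuous_const.sub continuous_id)).mul hkc
  have hgi : Integrable (fun z => f (x - z) * (kern s z : ℂ)) (volume : Measure V) :=
    hgc.integrable_of_hasCompactSupport ((hasCompactSupport_kern hs).toC.mul_left)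
  have h1 : moll (kern s) f x = ∫ z, f (x - z) * (kern s z : ℂ) := by
    rw [moll, ← integral_sub_left_eq_self _ volume x]
    simp only [sub_sub_cancel]
  have hav : ∀ z : V, Real.circleAverage (fun w : ℂ => f (x - w • z) * (kern s (w • z) : ℂ)) 0 1
      = f x * (kern s z : ℂ) := by
    intro z
    have hcongr : Real.circleAverage (fun w : ℂ => f (x - w • z) * (kern s (w • z) : ℂ)) 0 1
        = Real.circleAverage (fun w : ℂ => f (x - w • z) * (kern s z : ℂ)) 0 1 := by
      refine Real.circleAverage_congr_sphere fun w hw => ?_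
      have hw1 : ‖w‖ = 1 := by simpa using hw
      rw [kern_congr s (x := w • z) (y := z) (by rw [norm_smul, hw1, one_mul])]
    rw [hcongr]
    rcases le_or_gt s ‖z‖ with hz | hz
    · simp [kern_eq_zero hs hz, Real.circleAverage_def]
    · have hd : DiffContOnCl ℂ (fun w : ℂ => f (x - w • z) * (kern s z : ℂ)) (ball 0 |1|) := by
        refine DifferentiableOn.diffContOnCl ?_
        rw [closure_ball _ (by norm_num)]
        refine DifferentiableOn.mul_const (hf.comp (Differentiable.differentiableOn (by fun_prop))
          fun w hw => ?_) _
        rw [mem_ball, dist_eq_norm, sub_sub_cancel_left, norm_neg, norm_smul]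
        have hw1 : ‖w‖ ≤ 1 := by simpa using hw
        nlinarith [norm_nonneg z]
      simpa using hd.circleAverage
  rw [h1, ← integral_circleAverage_smul hgc.stronglyMeasurable hgi]
  simp only [hav]
  rw [integral_const_mul, integral_complex_ofReal, integral_kern hs]
  simp

theorem moll_comm {a b : V → ℝ} (ha : Continuous a) (hac : HasCompactSupport a)
    (hb : Continuous b) (hbc : HasCompactSupport b) {G : V → ℂ} (hG : Integrable G) (x : V) :
    moll a (moll b G) x = moll b (moll a G) x := by
  have key : ∀ a b : V → ℝ, Continuous a → HasCompactSupport a → Continuous b →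
      HasCompactSupport b → moll a (moll b G) x
        = ∫ u, G u * ∫ y, (b (y - u) : ℂ) * (a (x - y) : ℂ) := by
    intro a b ha hac hb hbc
    have hbi : Integrable (fun y : V => (b y : ℂ)) (volume : Measure V) :=
      (Complex.continuous_ofReal.comp hb).integrable_of_hasCompactSupport hbc.toC
    obtain ⟨C, hC⟩ := hac.exists_bound_of_continuous ha
    have hi : Integrable (fun q : V × V => G q.2 * (b (q.1 - q.2) : ℂ) * (a (x - q.1) : ℂ))
        ((volume : Measure V).prod volume) := by
      refine (hG.convolution_integrand (ContinuousLinearMap.mul ℝ ℂ) hbi).mul_bdd (c := C) ?_ ?_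
      · exact (Complex.continuous_ofReal.comp (ha.comp
          (continuous_const.sub continuous_fst))).aestronglyMeasurable
      · exact Eventually.of_forall fun q => by simpa using hC (x - q.1)
    simp only [moll, ← integral_mul_const, ← integral_const_mul]
    rw [integral_integral_swap hi]
    simp only [mul_assoc]
  rw [key a b ha hac hb hbc, key b a hb hbc ha hac]
  congr 1
  ext u
  congr 1
  rw [← integral_sub_left_eq_self _ volume (x + u)]
  congr 1
  ext y
  rw [show x + u - y - u = x - y by abel, show x - (x + u - y) = y - u by abel, mul_comm]

theorem moll_congr_ball {r : ℝ} (hr : 0 < r) {F G : V → ℂ} {x : V} (h : EqOn F G (ball x r)) :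
    moll (kern r) F x = moll (kern r) G x := by
  unfold moll
  congr 1
  ext y
  by_cases hy : y ∈ ball x r
  · rw [h hy]
  · rw [kern_eq_zero hr (x := x - y) (by rwa [mem_ball', dist_eq_norm, not_lt] at hy)]
    simp

variable {ι : Type*} [Fintype ι] {e : OrthonormalBasis ι ℂ V}

theorem differentiableAt_moll_kern {W : Set V} {G : V → ℂ} (hG : LocallyIntegrable G)
    (h0 : ∀ i k, IsTest W k → ∫ x, G x * del 1 (e i) k x = 0) {r : ℝ} (hr : 0 < r) {x : V}
    (hx : closedBall x r ⊆ W) : DifferentiableAt ℂ (moll (kern r) G) x := by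
  have hc := hasCompactSupport_kern (V := V) hr
  refine differentiableAt_of_del_eq_zero e
    ((contDiff_moll (contDiff_kern r) hc hG).differentiableAt_infty x) fun i => ?_
  have h := sum_del_moll (ι := Unit) (contDiff_kern r) hc (W := W) (x := x)
    (fun y hy => hx (by
      have := tsupport_kern_subset hr hy
      rwa [mem_closedBall_zero_iff, ← dist_eq_norm, dist_comm] at this))
    (σ := 1) (v := fun _ => e i) (G := fun _ => G) (fun _ => hG) (D := fun _ => 0)
    (fun k hk => by simpa using h0 i k hk)
  simpa [moll] using h

theorem moll_kern_eq {W : Set V} {G : V → ℂ} (hG : Integrable G)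
    (h0 : ∀ i k, IsTest W k → ∫ x, G x * del 1 (e i) k x = 0) {r s : ℝ} (hr : 0 < r)
    (hs : 0 < s) {x : V} (hx : closedBall x (r + s) ⊆ W) :
    moll (kern r) G x = moll (kern s) G x := by
  have main : ∀ r s : ℝ, 0 < r → 0 < s → closedBall x (r + s) ⊆ W →
      moll (kern s) (moll (kern r) G) x = moll (kern r) G x := by
    intro r s hr hs hx
    refine moll_kern_eq_of_differentiableOn (contDiff_moll (contDiff_kern r)
      (hasCompactSupport_kern hr) hG.locallyIntegrable).continuous hs le_rfl fun y hy =>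
      (differentiableAt_moll_kern (e := e) hG.locallyIntegrable h0 hr
        ((closedBall_subset_closedBall' ?_).trans hx)).differentiableWithinAt
    rw [mem_ball] at hy
    linarith
  rw [← main r s hr hs hx, ← main s r hs hr (by rwa [add_comm])]
  exact moll_comm (contDiff_kern s).continuous (hasCompactSupport_kern hs)
    (contDiff_kern r).continuous (hasCompactSupport_kern hr) hG x

/-- Weyl's lemma for the Cauchy-Riemann operator. -/
theorem exists_differentiableOn_of_weak {Ω : Set V} (hΩ : IsOpen Ω) {F : V → ℂ}
    (hF : LocallyIntegrableOn F Ω)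
    (h0 : ∀ i k, IsTest Ω k → ∫ x, F x * del 1 (e i) k x = 0) :
    ∃ f : V → ℂ, DifferentiableOn ℂ f Ω ∧
      ∀ x r, 0 < r → ball x (3 * r) ⊆ Ω → f x = moll (kern r) F x := by
  let _ := FiniteDimensional.proper ℂ V
  have hloc : ∀ x R, closedBall x R ⊆ Ω → ∃ G : V → ℂ, Integrable G ∧ EqOn F G (ball x R) ∧
      ∀ i k, IsTest (ball x R) k → ∫ x, G x * del 1 (e i) k x = 0 := by
    intro x R hR
    refine ⟨(ball x R).indicator F, ?_, fun y hy => (indicator_of_mem hy F).symm, ?_⟩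
    · rw [integrable_indicator_iff measurableSet_ball]
      exact (hF.integrableOn_compact_subset hR (isCompact_closedBall x R)).mono_set
        ball_subset_closedBall
    · intro i k hk
      rw [← h0 i k (hk.mono (ball_subset_closedBall.trans hR))]
      congr 1
      ext y
      by_cases hy : y ∈ ball x R
      · rw [indicator_of_mem hy]
      · rw [del_eq_zero_of_notMem fun h => hy (hk.subset h), mul_zero, mul_zero]
  have indep : ∀ x r s, 0 < r → r ≤ s → ball x (3 * s) ⊆ Ω →
      moll (kern r) F x = moll (kern s) F x := by
    intro x r s hr hrs hx
    obtain ⟨G, hG, hFG, hG0⟩ := hloc x (5 / 2 * s)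
      ((closedBall_subset_ball (by linarith)).trans hx)
    rw [moll_congr_ball hr (hFG.mono (ball_subset_ball (by linarith))),
      moll_congr_ball (hr.trans_le hrs) (hFG.mono (ball_subset_ball (by linarith)))]
    exact moll_kern_eq hG hG0 hr (hr.trans_le hrs) (closedBall_subset_ball (by linarith))
  have hρ : ∀ x, ∃ ρ : ℝ, 0 < ρ ∧ (x ∈ Ω → ball x (3 * ρ) ⊆ Ω) := fun x => by
    by_cases hx : x ∈ Ω
    · obtain ⟨ε, hε, h⟩ := Metric.isOpen_iff.1 hΩ x hx
      exact ⟨ε / 3, by positivity, fun _ => by rwa [mul_div_cancel₀ _ (by norm_num)]⟩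
    · exact ⟨1, one_pos, fun h => absurd h hx⟩
  choose ρ hρ0 hρ using hρ
  have hf : ∀ x r, 0 < r → ball x (3 * r) ⊆ Ω →
      moll (kern (ρ x)) F x = moll (kern r) F x := fun x r hr hx => by
    have hxΩ : x ∈ Ω := hx (mem_ball_self (by positivity))
    rcases le_total (ρ x) r with h | h
    · exact indep x _ _ (hρ0 x) h hx
    · exact (indep x _ _ hr h (hρ x hxΩ)).symm
  refine ⟨fun x => moll (kern (ρ x)) F x, fun x hx => ?_, hf⟩
  obtain ⟨G, hG, hFG, hG0⟩ := hloc x (2 * ρ x)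
    ((closedBall_subset_ball (by linarith [hρ0 x])).trans (hρ x hx))
  have hr : 0 < ρ x / 2 := half_pos (hρ0 x)
  have hd : DifferentiableAt ℂ (moll (kern (ρ x / 2)) G) x :=
    differentiableAt_moll_kern (e := e) hG.locallyIntegrable hG0 hr
      (closedBall_subset_ball (by linarith))
  refine (hd.congr_of_eventuallyEq ?_).differentiableWithinAt
  filter_upwards [ball_mem_nhds x hr] with y hy
  rw [mem_ball] at hy
  rw [hf y _ hr ((ball_subset_ball' (by linarith)).trans (hρ x hx))]
  exact moll_congr_ball hr (hFG.mono (ball_subset_ball' (by linarith)))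

end Regularity

section PointwiseBound

variable {V : Type*} [NormedAddCommGroup V] [InnerProductSpace ℂ V] [FiniteDimensional ℂ V]
  [MeasureSpace V] [BorelSpace V] [(volume : Measure V).IsAddHaarMeasure]

theorem sq_integral_mul_le {α : Type*} [MeasurableSpace α] {μ : Measure α} {u g : α → ℝ}
    (hg : ∀ x, 0 ≤ g x) (hg1 : ∫ x, g x ∂μ = 1) (hgi : Integrable g μ)
    (hi : Integrable (fun x => u x * g x) μ) (hi2 : Integrable (fun x => u x ^ 2 * g x) μ) :
    (∫ x, u x * g x ∂μ) ^ 2 ≤ ∫ x, u x ^ 2 * g x ∂μ := by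
  obtain ⟨a, ha⟩ : ∃ a, a = ∫ x, u x * g x ∂μ := ⟨_, rfl⟩
  have h : 0 ≤ ∫ x, (u x - a) ^ 2 * g x ∂μ :=
    integral_nonneg fun x => mul_nonneg (sq_nonneg _) (hg x)
  have h2 : ∫ x, (u x - a) ^ 2 * g x ∂μ
      = (∫ x, u x ^ 2 * g x ∂μ) - (2 * a) * (∫ x, u x * g x ∂μ) + a ^ 2 * ∫ x, g x ∂μ := by
    have h3 : Integrable (fun x => u x ^ 2 * g x - 2 * a * (u x * g x)) μ :=
      hi2.sub (hi.const_mul _)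
    rw [← integral_const_mul, ← integral_const_mul, ← integral_sub hi2 (hi.const_mul _),
      ← integral_add h3 (hgi.const_mul _)]
    congr 1
    ext x
    ring
  rw [h2, ← ha, hg1] at h
  rw [← ha]
  linarith

theorem integrableOn_of_norm_sq {α : Type*} [MeasurableSpace α] {μ : Measure α} {s : Set α}
    {U : α → ℂ} (hU : AEStronglyMeasurable U μ) (hs : μ s ≠ ⊤)
    (h : IntegrableOn (fun x => ‖U x‖ ^ 2) s μ) : IntegrableOn U s μ := by
  refine Integrable.mono' ((integrableOn_const (C := (1 : ℝ)) hs).add h) hU.restrict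
    (Eventually.of_forall fun x => ?_)
  simp only [Pi.add_apply]
  nlinarith [sq_nonneg (‖U x‖ - 1), norm_nonneg (U x)]

theorem norm_moll_sub_sq_le {F U : V → ℂ} (hU : AEStronglyMeasurable U) {x : V} {r M : ℝ}
    (hr : 0 < r) (hM : ∀ y : V, kern r y ≤ M) {c : ℂ} (hF : ∀ y ∈ ball x r, F y = c - U y)
    (hi : IntegrableOn (fun y => ‖U y‖ ^ 2) (ball x r)) :
    ‖moll (kern r) F x - c‖ ^ 2 ≤ M * ∫ y in ball x r, ‖U y‖ ^ 2 := by
  let _ := FiniteDimensional.proper ℂ V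
  set g : V → ℝ := fun y => kern r (x - y) with hg
  have hgc : Continuous g := (contDiff_kern r).continuous.comp (by fun_prop)
  have hg0 : ∀ y, 0 ≤ g y := fun y => kern_nonneg hr _
  have hg1 : ∫ y, g y = 1 := by
    rw [hg, integral_sub_left_eq_self (fun y : V => kern r y) volume x, integral_kern hr]
  have hgi : Integrable g := (kern_integrable hr).comp_sub_left x
  have hgz : ∀ y ∉ ball x r, g y = 0 := fun y hy =>
    kern_eq_zero hr (by rwa [mem_ball', dist_eq_norm, not_lt] at hy)
  have hbd : ∀ y, ‖g y‖ ≤ M := fun y => by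
    rw [Real.norm_of_nonneg (hg0 y)]
    exact hM _
  have hmul : ∀ u : V → ℝ, IntegrableOn u (ball x r) → Integrable fun y => u y * g y :=
    fun u hu => by
      have h1 := ((integrable_indicator_iff measurableSet_ball).2 hu).mul_bdd (c := M)
        hgc.aestronglyMeasurable (Eventually.of_forall hbd)
      refine h1.congr (Eventually.of_forall fun y => ?_)
      dsimp only
      by_cases hy : y ∈ ball x r
      · rw [indicator_of_mem hy]
      · rw [hgz y hy, mul_zero, mul_zero]
  have hU1 : IntegrableOn U (ball x r) :=
    integrableOn_of_norm_sq hU measure_ball_lt_top.ne hi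
  have hUg := hmul _ hU1.norm
  have hUg' : Integrable fun y => U y * (g y : ℂ) := by
    refine Integrable.mono' hUg (hU.mul
      (Complex.continuous_ofReal.comp hgc).aestronglyMeasurable)
      (Eventually.of_forall fun y => ?_)
    rw [norm_mul, Complex.norm_real, Real.norm_of_nonneg (hg0 y)]
  have hmoll : moll (kern r) F x - c = -∫ y, U y * (g y : ℂ) := by
    have h1 : moll (kern r) F x = ∫ y, (c * (g y : ℂ) - U y * (g y : ℂ)) := by
      unfold moll
      congr 1
      ext y
      by_cases hy : y ∈ ball x r
      · rw [hF y hy, sub_mul]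
      · change F y * (g y : ℂ) = _
        rw [hgz y hy]
        simp
    have hcg : Integrable fun y => c * (g y : ℂ) := Integrable.const_mul hgi.ofReal c
    rw [h1, integral_sub hcg hUg', integral_const_mul,
      integral_complex_ofReal, hg1]
    simp
  rw [hmoll, norm_neg]
  calc ‖∫ y, U y * (g y : ℂ)‖ ^ 2 ≤ (∫ y, ‖U y‖ * g y) ^ 2 := by
        gcongr
        refine (norm_integral_le_integral_norm _).trans_eq ?_
        congr 1
        ext y
        rw [norm_mul, Complex.norm_real, Real.norm_of_nonneg (hg0 y)]
    _ ≤ ∫ y, ‖U y‖ ^ 2 * g y := sq_integral_mul_le hg0 hg1 hgi hUg (hmul _ hi)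
    _ ≤ ∫ y, M * (ball x r).indicator (fun y => ‖U y‖ ^ 2) y := by
        refine integral_mono (hmul _ hi)
          (((integrable_indicator_iff measurableSet_ball).2 hi).const_mul M) fun y => ?_
        dsimp only
        by_cases hy : y ∈ ball x r
        · rw [indicator_of_mem hy, mul_comm]
          gcongr
          exact hM _
        · rw [hgz y hy, indicator_of_notMem hy, mul_zero, mul_zero]
    _ = M * ∫ y in ball x r, ‖U y‖ ^ 2 := by
        rw [integral_const_mul, integral_indicator measurableSet_ball]

theorem setIntegral_le_of_le_weight {α : Type*} [MeasurableSpace α] {μ : Measure α} {s t : Set α}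
    (hs : MeasurableSet s) (hst : s ⊆ t) {u a : α → ℝ} {β : ℝ}
    (hβ : 0 < β) (hu : AEStronglyMeasurable u μ) (hu0 : ∀ x, 0 ≤ u x) (ha : ∀ x, 0 ≤ a x)
    (hβa : ∀ x ∈ s, β ≤ a x) (hi : IntegrableOn (fun x => u x * a x) t μ) :
    IntegrableOn u s μ ∧ ∫ x in s, u x ∂μ ≤ β⁻¹ * ∫ x in t, u x * a x ∂μ := by
  have hle : ∀ x ∈ s, u x ≤ β⁻¹ * (u x * a x) := fun x hx => by
    rw [le_inv_mul_iff₀ hβ, mul_comm]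
    exact mul_le_mul_of_nonneg_left (hβa x hx) (hu0 x)
  have hi' : IntegrableOn (fun x => β⁻¹ * (u x * a x)) s μ := (hi.mono_set hst).const_mul _
  have h1 : IntegrableOn u s μ := by
    refine Integrable.mono' hi' hu.restrict ((ae_restrict_iff' hs).2
      (Eventually.of_forall fun x hx => ?_))
    rw [Real.norm_of_nonneg (hu0 x)]
    exact hle x hx
  refine ⟨h1, (setIntegral_mono_on h1 hi' hs hle).trans ?_⟩
  rw [integral_const_mul]
  gcongr
  exact Eventually.of_forall fun x => mul_nonneg (hu0 x) (ha x)

variable {ι : Type*} [Fintype ι]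

/-- Solving `∂̄U = ∂̄χ` with a weighted `L²` bound and passing to the holomorphic function
`f = χ - U`. -/
theorem exists_holomorphic_correction (e : OrthonormalBasis ι ℂ V) {Ω : Set V} (hΩ : IsOpen Ω)
    {Φ : V → ℝ} (hΦ : ContinuousOn Φ Ω) (hs : CircleSubmean (fun z => Φ z - ‖z‖ ^ 2) Ω)
    (hex : ∀ c, IsCompact {z ∈ Ω | Φ z ≤ c}) {N m ε : ℝ} (p : V) (hN : 1 ≤ N) (hm : 0 ≤ m)
    (hε : 0 < ε) {χ : V → ℂ} (hχ : IsTest Ω χ) :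
    ∃ f : V → ℂ, DifferentiableOn ℂ f Ω ∧ ∀ (x : V) (r M β : ℝ) (c : ℂ), 0 < r → 0 < β →
      ball x (3 * r) ⊆ Ω → (∀ y : V, kern r y ≤ M) → (∀ y ∈ ball x r, χ y = c) →
      (∀ y ∈ ball x r, β ≤ Real.exp (-(N * Φ y + m * Real.log (‖y - p‖ ^ 2 + ε)))) →
      ‖f x - c‖ ^ 2 ≤ M * (β⁻¹ * (Real.exp 1 * ∫ x, (∑ i, ‖del 1 (e i) χ x‖ ^ 2)
        * Real.exp (-(N * Φ x + m * Real.log (‖x - p‖ ^ 2 + ε))))) := by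
  set w : V → ℝ := fun x => N * Φ x + m * Real.log (‖x - p‖ ^ 2 + ε) with hwdef
  have hw : ContinuousOn w Ω := (continuousOn_const.mul hΦ).add
    (continuous_const.mul (contDiff_log_norm_sub_sq p hε).continuous).continuousOn
  obtain ⟨U, hUm, hUi, hUC, -, hU⟩ := exists_weak_solution e hΩ hw hχ
    (C := Real.exp 1 * ∫ x, (∑ i, ‖del 1 (e i) χ x‖ ^ 2) * Real.exp (-w x))
    (mul_nonneg (Real.exp_pos _).le (integral_nonneg fun x => mul_nonneg
      (Finset.sum_nonneg fun _ _ => by positivity) (Real.exp_pos _).le))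
    fun h hh => test_estimate e hΩ hΦ hs hex p hN hm hε hχ hh
  have hUm2 : AEStronglyMeasurable (fun x => ‖U x‖ ^ 2) := (hUm.norm.pow 2)
  have hloc : ∀ K ⊆ Ω, IsCompact K → IntegrableOn U K := fun K hK hKc => by
    obtain ⟨B, hB⟩ := hKc.exists_bound_of_continuousOn (hw.mono hK)
    refine integrableOn_of_norm_sq hUm hKc.measure_lt_top.ne
      (setIntegral_le_of_le_weight hKc.measurableSet hK (Real.exp_pos (-B))
        hUm2 (fun x => by positivity) (fun x => (Real.exp_pos _).le)
        (fun x hx => Real.exp_le_exp.2 ?_) hUi).1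
    linarith [(le_abs_self _).trans (hB x hx)]
  have hUl : LocallyIntegrableOn U Ω :=
    (locallyIntegrableOn_iff hΩ.isLocallyClosed).2 hloc
  obtain ⟨f, hf, hfm⟩ := exists_differentiableOn_of_weak (e := e) hΩ
    (F := fun x => χ x - U x) ((hχ.integrable.locallyIntegrable.locallyIntegrableOn Ω).sub hUl)
    fun i k hk => by
      have hk' := hk.del 1 (e i)
      obtain ⟨B, hB⟩ := hk'.compact.exists_bound_of_continuous hk'.continuous
      have hUk : Integrable fun x => U x * del 1 (e i) k x := by
        have h1 := ((integrable_indicator_iff hk'.compact.isCompact.measurableSet).2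
          (hloc _ hk'.subset hk'.compact.isCompact)).mul_bdd (c := B)
          hk'.continuous.aestronglyMeasurable (Eventually.of_forall hB)
        refine h1.congr (Eventually.of_forall fun y => ?_)
        dsimp only
        by_cases hy : y ∈ tsupport fun x => del 1 (e i) k x
        · rw [indicator_of_mem hy]
        · rw [image_eq_zero_of_notMem_tsupport hy, mul_zero, mul_zero]
      simp only [sub_mul]
      rw [integral_sub (hk'.mul_left hχ.contDiff).integrable hUk, hU i k hk,
        integral_mul_del hχ.contDiff hk, sub_self]
  refine ⟨f, hf, fun x r M β c hr hβ hxr hM hc hβw => ?_⟩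
  obtain ⟨h1, h2⟩ := setIntegral_le_of_le_weight measurableSet_ball
    ((ball_subset_ball (by linarith)).trans hxr) hβ hUm2
    (fun x => by positivity) (fun x => (Real.exp_pos _).le) hβw hUi
  rw [hfm x r hr hxr]
  have hM0 : 0 ≤ M := (kern_nonneg hr 0).trans (hM 0)
  refine (norm_moll_sub_sq_le hUm hr hM (fun y hy => by rw [hc y hy]) h1).trans ?_
  gcongr
  exact h2.trans (by gcongr)

end PointwiseBound

section Separation

variable {V : Type*} [NormedAddCommGroup V] [InnerProductSpace ℂ V] [FiniteDimensional ℂ V]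
  [MeasureSpace V] [BorelSpace V] [(volume : Measure V).IsAddHaarMeasure]
  {ι : Type*} [Fintype ι]

/-- Points outside a sublevel set of a strictly plurisubharmonic exhaustion function are separated
from it by holomorphic functions. -/
theorem exists_holomorphic_separating (e : OrthonormalBasis ι ℂ V) {Ω : Set V} (hΩ : IsOpen Ω)
    {Φ : V → ℝ} (hΦ : ContinuousOn Φ Ω) (hs : CircleSubmean (fun z => Φ z - ‖z‖ ^ 2) Ω)
    (hex : ∀ c, IsCompact {z ∈ Ω | Φ z ≤ c}) {c : ℝ} {p : V} (hp : p ∈ Ω) (hcp : c < Φ p) :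
    ∃ f : V → ℂ, DifferentiableOn ℂ f Ω ∧ (∀ z ∈ Ω, Φ z ≤ c → ‖f z‖ ≤ 1 / 4) ∧
      ‖f p - 1‖ ≤ 1 / 4 := by
  let _ := FiniteDimensional.proper ℂ V
  obtain ⟨δ, hδ, hδp⟩ : ∃ δ, 0 < δ ∧ Φ p = c + 4 * δ :=
    ⟨(Φ p - c) / 4, by linarith, by ring⟩
  have hA : IsOpen (Ω ∩ Φ ⁻¹' Ioi (c + 3 * δ)) := hΦ.isOpen_inter_preimage hΩ isOpen_Ioi
  obtain ⟨R, hR, hRA⟩ := Metric.isOpen_iff.1 hA p ⟨hp, by rw [mem_preimage, mem_Ioi]; linarith⟩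
  obtain ⟨r₁, hr₁, hr₁1, hr₁A⟩ : ∃ r₁, 0 < r₁ ∧ r₁ ≤ 1 ∧
      closedBall p (3 * r₁) ⊆ Ω ∩ Φ ⁻¹' Ioi (c + 3 * δ) := by
    refine ⟨min (R / 4) 1, by positivity, min_le_right _ _,
      (closedBall_subset_ball ?_).trans hRA⟩
    linarith [min_le_left (R / 4) 1]
  obtain ⟨η, hη, hηc, hηA, -, -, hη1⟩ := exists_smooth_cutoff (isCompact_closedBall p r₁) hA
    ((closedBall_subset_closedBall (by linarith)).trans hr₁A)
  have hχA : IsTest (Ω ∩ Φ ⁻¹' Ioi (c + 3 * δ)) (toC η) := isTest_toC hη hηc hηA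
  have hχ : IsTest Ω (toC η) := hχA.mono inter_subset_left
  have hχ1 : ∀ y ∈ closedBall p r₁, toC η y = 1 := fun y hy => by simp [toC, hη1 y hy]
  obtain ⟨Ck, hCk, hkern⟩ := exists_kern_le (V := V)
  set d := Module.finrank ℝ V with hd
  set m : ℝ := ((d + 1 : ℕ) : ℝ) with hmdef
  have hm : 0 ≤ m := by positivity
  have hkern' : ∀ r : ℝ, 0 < r → ∀ y : V, kern r y ≤ Ck / r ^ d := fun r hr y => by
    rw [le_div_iff₀ (by positivity)]
    exact hkern r hr y
  have hS0 : ∀ x, 0 ≤ ∑ i, ‖del 1 (e i) (toC η) x‖ ^ 2 := fun x =>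
    Finset.sum_nonneg fun _ _ => by positivity
  have hSi : Integrable fun x => ∑ i, ‖del 1 (e i) (toC η) x‖ ^ 2 :=
    integrable_finsetSum _ fun i _ => ((hχ.del 1 (e i)).continuous.norm.pow
      2).integrable_of_hasCompactSupport ((hχ.del 1 (e i)).compact.mono fun x hx hn => hx (by
        simp [hn]))
  have hSI0 : 0 ≤ ∫ x, ∑ i, ‖del 1 (e i) (toC η) x‖ ^ 2 := integral_nonneg hS0
  set S₀ := (∫ x, ∑ i, ‖del 1 (e i) (toC η) x‖ ^ 2) * Real.exp (-(m * Real.log (r₁ ^ 2)))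
    with hS₀
  have hS₀0 : 0 ≤ S₀ := mul_nonneg hSI0 (Real.exp_pos _).le
  have hI : ∀ N ε : ℝ, 0 ≤ N → 0 < ε → ∫ x, (∑ i, ‖del 1 (e i) (toC η) x‖ ^ 2)
      * Real.exp (-(N * Φ x + m * Real.log (‖x - p‖ ^ 2 + ε)))
      ≤ S₀ * Real.exp (-(N * (c + 3 * δ))) := by
    intro N ε hN hε
    rw [hS₀, mul_assoc, ← Real.exp_add, ← integral_mul_const]
    refine integral_mono_of_nonneg
      (Eventually.of_forall fun x => mul_nonneg (hS0 x) (Real.exp_pos _).le)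
      (hSi.mul_const _) (Eventually.of_forall fun x => ?_)
    dsimp only
    by_cases hx : x ∈ tsupport (toC η) ∧ x ∉ ball p r₁
    · refine mul_le_mul_of_nonneg_left (Real.exp_le_exp.2 ?_) (hS0 x)
      have h1 : N * (c + 3 * δ) ≤ N * Φ x := by
        gcongr
        exact (hχA.subset hx.1).2.le
      have h2 : m * Real.log (r₁ ^ 2) ≤ m * Real.log (‖x - p‖ ^ 2 + ε) := by
        have h3 := hx.2
        rw [mem_ball, dist_eq_norm, not_lt] at h3
        gcongr
        nlinarith
      linarith
    · have hz : ∀ i, del 1 (e i) (toC η) x = 0 := fun i => by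
        rw [not_and_or, not_not] at hx
        rcases hx with hx | hx
        · exact del_eq_zero_of_notMem hx
        · refine del_eq_zero_of_eventuallyEq_const (c := 1) ?_
          filter_upwards [isOpen_ball.mem_nhds hx] with y hy
          exact hχ1 y (ball_subset_closedBall hy)
      simp [hz]
  have hW : IsOpen (Ω ∩ Φ ⁻¹' Iio (c + 2 * δ)) := hΦ.isOpen_inter_preimage hΩ isOpen_Iio
  obtain ⟨ρ, hρ, hρW⟩ := (hex c).exists_thickening_subset_open hW fun z hz =>
    ⟨hz.1, by rw [mem_preimage, mem_Iio]; linarith [hz.2]⟩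
  obtain ⟨D, hD⟩ := (hex (c + 2 * δ)).exists_bound_of_continuousOn
    (f := fun y => ‖y - p‖ ^ 2 + 1) (by fun_prop)
  obtain ⟨Q, hQ⟩ := (isCompact_closedBall p r₁).exists_bound_of_continuousOn
    (hΦ.mono ((closedBall_subset_closedBall (by linarith)).trans
      (hr₁A.trans inter_subset_left)))
  set B := Ck / (ρ / 3) ^ d * (Real.exp (m * Real.log D) * (Real.exp 1 * S₀)) with hB
  have hB0 : 0 ≤ B := by positivity
  obtain ⟨N, hN1, hNB⟩ : ∃ N : ℝ, 1 ≤ N ∧ B * Real.exp (-(N * δ)) ≤ 1 / 16 := by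
    refine ⟨max 1 (16 * B / δ), le_max_left _ _, ?_⟩
    have h1 : 16 * B ≤ max 1 (16 * B / δ) * δ := by
      rw [← div_le_iff₀ hδ]
      exact le_max_right _ _
    have h2 := Real.add_one_le_exp (max 1 (16 * B / δ) * δ)
    rw [Real.exp_neg, ← div_eq_mul_inv, div_le_iff₀ (Real.exp_pos _)]
    linarith
  set G := Ck * (Real.exp (N * Q) * (Real.exp 1 * (S₀ * Real.exp (-(N * (c + 3 * δ))))))
    * 2 ^ (d + 1) with hG
  have hG0 : 0 ≤ G := by positivity
  obtain ⟨s, hs0, hsr, hs1, hsG⟩ : ∃ s : ℝ, 0 < s ∧ s ≤ r₁ ∧ s ≤ 1 ∧ G * s ≤ 1 / 16 := by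
    refine ⟨min r₁ (1 / (16 * (G + 1))), by positivity, min_le_left _ _,
      (min_le_left _ _).trans hr₁1, ?_⟩
    calc G * min r₁ (1 / (16 * (G + 1))) ≤ G * (1 / (16 * (G + 1))) := by
          gcongr
          exact min_le_right _ _
      _ ≤ 1 / 16 := by
          rw [mul_one_div, div_le_div_iff₀ (by positivity) (by norm_num)]
          linarith
  have hs2 : 0 < s ^ 2 := by positivity
  have hN0 : 0 ≤ N := by linarith
  obtain ⟨f, hf, hfb⟩ := exists_holomorphic_correction e hΩ hΦ hs hex p hN1 hm hs2 hχ
  have sq_le : ∀ a : ℝ, 0 ≤ a → a ^ 2 ≤ 1 / 16 → a ≤ 1 / 4 := fun a ha h => by nlinarith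
  refine ⟨f, hf, fun z hz hzc => sq_le _ (norm_nonneg _) ?_, sq_le _ (norm_nonneg _) ?_⟩
  · have hball : ball z (3 * (ρ / 3)) ⊆ Ω ∩ Φ ⁻¹' Iio (c + 2 * δ) := by
      rw [mul_div_cancel₀ _ (by norm_num)]
      exact (ball_subset_thickening (show z ∈ {z ∈ Ω | Φ z ≤ c} from ⟨hz, hzc⟩) ρ).trans hρW
    have hball' : ball z (ρ / 3) ⊆ Ω ∩ Φ ⁻¹' Iio (c + 2 * δ) :=
      (ball_subset_ball (by linarith)).trans hball
    have h := hfb z (ρ / 3) (Ck / (ρ / 3) ^ d)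
      (Real.exp (-(N * (c + 2 * δ) + m * Real.log D))) 0 (by positivity) (Real.exp_pos _)
      (hball.trans inter_subset_left) (hkern' _ (by positivity)) (fun y hy => ?_) fun y hy => ?_
    · rw [sub_zero] at h
      refine (h.trans ?_).trans hNB
      rw [← Real.exp_neg, neg_neg, Real.exp_add]
      calc Ck / (ρ / 3) ^ d * (Real.exp (N * (c + 2 * δ)) * Real.exp (m * Real.log D)
            * (Real.exp 1 * _))
          ≤ Ck / (ρ / 3) ^ d * (Real.exp (N * (c + 2 * δ)) * Real.exp (m * Real.log D)
            * (Real.exp 1 * (S₀ * Real.exp (-(N * (c + 3 * δ)))))) := by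
            gcongr
            exact hI N (s ^ 2) hN0 hs2
        _ = B * (Real.exp (N * (c + 2 * δ)) * Real.exp (-(N * (c + 3 * δ)))) := by
            rw [hB]; ring
        _ = B * Real.exp (-(N * δ)) := by
            rw [← Real.exp_add]
            ring_nf
    · refine image_eq_zero_of_notMem_tsupport fun hn => ?_
      have h1 := (hχA.subset hn).2
      have h2 := (hball' hy).2
      rw [mem_preimage, mem_Ioi] at h1
      rw [mem_preimage, mem_Iio] at h2
      linarith
    · have hy' := hball' hy
      have h1 : N * Φ y ≤ N * (c + 2 * δ) := by
        gcongr
        exact hy'.2.le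
      have h2 : m * Real.log (‖y - p‖ ^ 2 + s ^ 2) ≤ m * Real.log D := by
        have h3 := (le_abs_self _).trans (hD y ⟨hy'.1, hy'.2.le⟩)
        have h4 : s ^ 2 ≤ 1 := by nlinarith
        gcongr
        linarith
      exact Real.exp_le_exp.2 (by linarith)
  · have h := hfb p s (Ck / s ^ d) (Real.exp (-(N * Q + m * Real.log (2 * s ^ 2)))) 1 hs0
      (Real.exp_pos _) ((ball_subset_closedBall.trans
        (closedBall_subset_closedBall (by linarith))).trans (hr₁A.trans inter_subset_left))
      (hkern' _ hs0) (fun y hy => hχ1 y ((ball_subset_closedBall.trans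
        (closedBall_subset_closedBall hsr)) hy)) fun y hy => ?_
    · refine (h.trans ?_).trans hsG
      rw [← Real.exp_neg, neg_neg, Real.exp_add, hmdef, Real.exp_nat_mul,
        Real.exp_log (by positivity)]
      calc Ck / s ^ d * (Real.exp (N * Q) * (2 * s ^ 2) ^ (d + 1) * (Real.exp 1 * _))
          ≤ Ck / s ^ d * (Real.exp (N * Q) * (2 * s ^ 2) ^ (d + 1)
            * (Real.exp 1 * (S₀ * Real.exp (-(N * (c + 3 * δ)))))) := by
            gcongr
            exact hI N (s ^ 2) hN0 hs2
        _ = G * s ^ (d + 2) := by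
            rw [hG]
            field_simp
            ring
        _ ≤ G * s := by
            gcongr
            exact pow_le_of_le_one hs0.le hs1 (by omega)
    · have h1 : N * Φ y ≤ N * Q := by
        gcongr
        exact (le_abs_self _).trans (hQ y ((ball_subset_closedBall.trans
          (closedBall_subset_closedBall hsr)) hy))
      have h2 : m * Real.log (‖y - p‖ ^ 2 + s ^ 2) ≤ m * Real.log (2 * s ^ 2) := by
        rw [mem_ball, dist_eq_norm] at hy
        gcongr
        nlinarith [norm_nonneg (y - p)]
      exact Real.exp_le_exp.2 (by linarith)

end Separation

section Exhaustion

variable {V : Type*} [NormedAddCommGroup V] [NormedSpace ℝ V] [ProperSpace V] {Ω : Set V}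

theorem isCompact_neg_log_infDist_add_sq_le (hΩ : IsOpen Ω) (hf : (frontier Ω).Nonempty) (c : ℝ) :
    IsCompact {z ∈ Ω | -Real.log (infDist z (frontier Ω)) + ‖z‖ ^ 2 ≤ c} := by
  have hcont : ContinuousOn (fun z => -Real.log (infDist z (frontier Ω)) + ‖z‖ ^ 2) Ω :=
    (continuousOn_neg_log_infDist hΩ hf).add (continuous_norm.pow 2).continuousOn
  have hdist : ∀ z ∈ {z ∈ Ω | -Real.log (infDist z (frontier Ω)) + ‖z‖ ^ 2 ≤ c},
      Real.exp (-c) ≤ infDist z (frontier Ω) := fun z hz => by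
    rw [← Real.le_log_iff_exp_le (infDist_frontier_pos hΩ hf hz.1)]
    linarith [hz.2, sq_nonneg ‖z‖]
  have hcl : closure {z ∈ Ω | -Real.log (infDist z (frontier Ω)) + ‖z‖ ^ 2 ≤ c} ⊆ Ω := by
    intro z hz
    have h1 : z ∈ closure Ω := closure_mono (sep_subset _ _) hz
    have h2 : Real.exp (-c) ≤ infDist z (frontier Ω) :=
      closure_minimal hdist (isClosed_le continuous_const (continuous_infDist_pt _)) hz
    by_contra hn
    have h3 : z ∈ frontier Ω := by
      rw [frontier, hΩ.interior_eq]
      exact ⟨h1, hn⟩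
    rw [infDist_zero_of_mem h3] at h2
    linarith [Real.exp_pos (-c)]
  refine Metric.isCompact_of_isClosed_isBounded ?_ ?_
  · refine isClosed_of_closure_subset fun z hz => ⟨hcl hz, ?_⟩
    exact ContinuousWithinAt.closure_le hz
      ((hcont z (hcl hz)).mono (sep_subset _ _)) continuousWithinAt_const fun y hy => hy.2
  · obtain ⟨q, hq⟩ := hf
    refine (isBounded_iff_subset_closedBall 0).2 ⟨|c| + ‖q‖ + 2, fun z hz => ?_⟩
    rw [mem_closedBall_zero_iff]
    have h1 : infDist z (frontier Ω) ≤ ‖z‖ + ‖q‖ :=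
      (infDist_le_dist_of_mem hq).trans (by rw [dist_eq_norm]; exact norm_sub_le _ _)
    have h2 := Real.log_le_sub_one_of_pos (infDist_frontier_pos hΩ ⟨q, hq⟩ hz.1)
    have h3 := hz.2
    have h4 := le_abs_self c
    by_contra! hn
    nlinarith [norm_nonneg z, norm_nonneg q, abs_nonneg c]

end Exhaustion

section HolomorphicConvexity

variable {n : ℕ} {Ω : Set (EuclideanSpace ℂ (Fin n))}

theorem IsPlurisubharmonicOn.holomorphicallyConvex (hΩ : IsOpen Ω) (hf : (frontier Ω).Nonempty)
    (h : IsPlurisubharmonicOn (fun z => ((-Real.log (infDist z (frontier Ω)) : ℝ) : EReal)) Ω) :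
    HolomorphicallyConvex Ω := by
  intro K hK hKc
  have hc := continuousOn_neg_log_infDist hΩ hf
  set Φ : EuclideanSpace ℂ (Fin n) → ℝ :=
    fun z => -Real.log (infDist z (frontier Ω)) + ‖z‖ ^ 2 with hΦdef
  have hΦ : ContinuousOn Φ Ω := hc.add (continuous_norm.pow 2).continuousOn
  have hs : CircleSubmean (fun z => Φ z - ‖z‖ ^ 2) Ω := by
    simpa [hΦdef] using circleSubmean_of_submeanOn hc h.2.2.2
  have hex : ∀ c, IsCompact {z ∈ Ω | Φ z ≤ c} := isCompact_neg_log_infDist_add_sq_le hΩ hf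
  obtain ⟨c, hcK⟩ := hKc.exists_bound_of_continuousOn (hΦ.mono hK)
  have hsub : holomorphicHull Ω K ⊆ {z ∈ Ω | Φ z ≤ c} := by
    refine fun p hp => ⟨hp.1, ?_⟩
    by_contra! hcp
    obtain ⟨f, hfd, hfK, hfp⟩ := exists_holomorphic_separating
      (EuclideanSpace.basisFun (Fin n) ℂ) hΩ hΦ hs hex hp.1 hcp
    have h1 : sSup ((fun w => ‖f w‖) '' K) ≤ 1 / 4 := by
      refine Real.sSup_le ?_ (by norm_num)
      rintro _ ⟨w, hw, rfl⟩
      exact hfK w (hK hw) ((le_abs_self _).trans (hcK w hw))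
    have h2 := hp.2 f hfd
    have h3 : ‖(1 : ℂ)‖ ≤ ‖f p‖ + ‖f p - 1‖ := by
      have := norm_sub_le (f p) (f p - 1)
      rwa [sub_sub_cancel] at this
    rw [norm_one] at h3
    linarith
  refine (hex c).of_isClosed_subset (isClosed_of_closure_subset fun z hz => ?_) hsub
  have hzΩ : z ∈ Ω := (closure_minimal hsub (hex c).isClosed hz).1
  refine ⟨hzΩ, fun f hfd => ?_⟩
  exact ContinuousWithinAt.closure_le hz
    ((hfd.continuousOn.norm z hzΩ).mono fun y hy => hy.1) continuousWithinAt_const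
    fun y hy => hy.2 f hfd

end HolomorphicConvexity

end LeviProblem

/-- Theorem (statement 0, Oka's lemma): a domain `Ω ⊊ ℂⁿ` is holomorphically convex
(equivalently, a domain of holomorphy) if and only if `z ↦ -log(d_{∂Ω}(z))` is
plurisubharmonic on the whole of `Ω`. -/
theorem oka_lemma (n : ℕ) (Ω : Set (EuclideanSpace ℂ (Fin n)))
    (hopen : IsOpen Ω) (hconn : IsConnected Ω) (hne : Ω ≠ Set.univ) :
    HolomorphicallyConvex Ω ↔
      IsPlurisubharmonicOn
        (fun z => ((- Real.log (infDist z (frontier Ω)) : ℝ) : EReal)) Ω := by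
  have hf := nonempty_frontier_of_ne_univ hconn.nonempty hne
  exact ⟨fun h => h.isPlurisubharmonicOn hopen hconn.nonempty hf,
    fun h => h.holomorphicallyConvex hopen hf⟩

end
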